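/- Assume N ≥ 2 and λ ≥ 0. Then the problem (P_λ) admits exactly one positive solution, and this solution is radially symmetric and decreasing with respect to the radial variable r = |x|. -/

import Mathlib

open MeasureTheory Set Filter Topology

noncomputable section

/-- `N`-dimensional Euclidean space. -/
abbrev Euc (N : ℕ) := EuclideanSpace ℝ (Fin N)

/-- The Laplacian of a real-valued function on Euclidean space, defined as the
sum of the pure second partial derivatives in the coordinate directions. -/
def lap {N : ℕ} (u : Euc N → ℝ) (x : Euc N) : ℝ :=
  ∑ i : Fin N,
    fderiv ℝ (fun y => fderiv ℝ u y (EuclideanSpace.single i 1)) x (EuclideanSpace.single i 1)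

/-- The first Dirichlet eigenvalue of `-Δ` on `Ω`, defined as the infimum of
Rayleigh quotients of nonzero smooth functions with compact support contained in `Ω`. -/
def firstEig {N : ℕ} (Ω : Set (Euc N)) : ℝ :=
  sInf { r : ℝ | ∃ φ : Euc N → ℝ, ContDiff ℝ (⊤ : ℕ∞) φ ∧ HasCompactSupport φ ∧
    tsupport φ ⊆ Ω ∧ φ ≠ 0 ∧
    r = (∫ x, ‖fderiv ℝ φ x‖ ^ 2) / (∫ x, (φ x) ^ 2) }

/-- `u` is a (classical) positive solution of `-Δ u + lam • u = f(x, u)` in `Ω`,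
vanishing on the boundary: `u ∈ C²(Ω) ∩ C(closure Ω)`, `u > 0` in `Ω`, `u = 0` on `∂Ω`. -/
def IsPosSolution {N : ℕ} (Ω : Set (Euc N)) (f : Euc N → ℝ → ℝ) (lam : ℝ)
    (u : Euc N → ℝ) : Prop :=
  ContDiffOn ℝ 2 u Ω ∧ ContinuousOn u (closure Ω) ∧ (∀ x ∈ Ω, 0 < u x) ∧
    (∀ x ∈ frontier Ω, u x = 0) ∧ ∀ x ∈ Ω, - lap u x + lam * u x = f x (u x)

/-- The nonlinearity `(1 + |x|^k)^{-s} t^{p-1}` of problem `(P_λ)` on the unit ball. -/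
def fker (N : ℕ) (k s p : ℝ) : Euc N → ℝ → ℝ :=
  fun x t => (1 + ‖x‖ ^ k) ^ (-s) * t ^ (p - 1)

/-- The weighted average `∫₀¹ tᵐ g(rt) dt`. -/
def avg (m : ℕ) (g : ℝ → ℝ) (r : ℝ) : ℝ := ∫ t in (0 : ℝ)..1, t ^ m * g (r * t)

/-- The inverse of the radial operator `u ↦ u'' + (m/r) u'` with zero initial data. -/
def volt (m : ℕ) (g : ℝ → ℝ) (r : ℝ) : ℝ := ∫ ρ in (0 : ℝ)..r, ρ * avg m g ρ

lemma continuous_avg (m : ℕ) {g : ℝ → ℝ} (hg : Continuous g) : Continuous (avg m g) := by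
  unfold avg
  apply intervalIntegral.continuous_parametric_intervalIntegral_of_continuous'
  fun_prop

lemma hasDerivAt_volt (m : ℕ) {g : ℝ → ℝ} (hg : Continuous g) (r : ℝ) :
    HasDerivAt (volt m g) (r * avg m g r) r := by
  have hc : Continuous fun ρ => ρ * avg m g ρ := continuous_id.mul (continuous_avg m hg)
  exact intervalIntegral.integral_hasDerivAt_right (hc.intervalIntegrable _ _)
    (hc.stronglyMeasurableAtFilter _ _) hc.continuousAt

lemma continuous_volt (m : ℕ) {g : ℝ → ℝ} (hg : Continuous g) : Continuous (volt m g) :=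
  continuous_iff_continuousAt.2 fun r => (hasDerivAt_volt m hg r).continuousAt

lemma volt_zero (m : ℕ) (g : ℝ → ℝ) : volt m g 0 = 0 := by simp [volt]

lemma avg_zero (m : ℕ) (g : ℝ → ℝ) : avg m g 0 = g 0 / (m + 1) := by
  simp [avg, integral_pow]; ring

lemma pow_mul_avg (m : ℕ) (g : ℝ → ℝ) (r : ℝ) :
    r ^ (m + 1) * avg m g r = ∫ s in (0 : ℝ)..r, s ^ m * g s := by
  have h := intervalIntegral.smul_integral_comp_mul_left (a := 0) (b := 1)
    (fun s => s ^ m * g s) r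
  simp only [mul_zero, mul_one, smul_eq_mul] at h
  rw [← h, avg, pow_succ', mul_assoc, ← intervalIntegral.integral_const_mul]
  congr 2
  ext t
  ring

lemma hasDerivAt_pow_mul_avg (m : ℕ) {g : ℝ → ℝ} (hg : Continuous g) (r : ℝ) :
    HasDerivAt (fun r => r ^ (m + 1) * avg m g r) (r ^ m * g r) r := by
  have hc : Continuous fun s => s ^ m * g s := by fun_prop
  simp only [pow_mul_avg]
  exact intervalIntegral.integral_hasDerivAt_right (hc.intervalIntegrable _ _)
    (hc.stronglyMeasurableAtFilter _ _) hc.continuousAt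

lemma hasDerivAt_avg (m : ℕ) {g : ℝ → ℝ} (hg : Continuous g) {r : ℝ} (hr : 0 < r) :
    HasDerivAt (avg m g) ((g r - (m + 1) * avg m g r) / r) r := by
  have h1 := (hasDerivAt_pow_mul_avg m hg r).div (hasDerivAt_pow (m + 1) r)
    (pow_ne_zero _ hr.ne')
  have h2 : avg m g =ᶠ[𝓝 r] fun r => r ^ (m + 1) * avg m g r / r ^ (m + 1) := by
    filter_upwards [lt_mem_nhds hr] with x hx
    field_simp
  refine (h1.congr_of_eventuallyEq h2).congr_deriv ?_
  have := hr.ne'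
  simp only [Nat.add_sub_cancel]
  push_cast
  field_simp
  ring

lemma avg_mono (m : ℕ) {f g : ℝ → ℝ} (hf : Continuous f) (hg : Continuous g) {r : ℝ}
    (hr : 0 ≤ r) (h : ∀ s ∈ Icc 0 r, f s ≤ g s) : avg m f r ≤ avg m g r := by
  refine intervalIntegral.integral_mono_on zero_le_one
    (Continuous.intervalIntegrable (by fun_prop) _ _)
    (Continuous.intervalIntegrable (by fun_prop) _ _) fun t ht => ?_
  refine mul_le_mul_of_nonneg_left (h _ ⟨mul_nonneg hr ht.1, ?_⟩) (pow_nonneg ht.1 _)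
  nlinarith [ht.2]

lemma volt_mono (m : ℕ) {f g : ℝ → ℝ} (hf : Continuous f) (hg : Continuous g) {r : ℝ}
    (hr : 0 ≤ r) (h : ∀ s ∈ Icc 0 r, f s ≤ g s) : volt m f r ≤ volt m g r := by
  have h1 := continuous_avg m hf
  have h2 := continuous_avg m hg
  refine intervalIntegral.integral_mono_on hr
    (Continuous.intervalIntegrable (by fun_prop) _ _)
    (Continuous.intervalIntegrable (by fun_prop) _ _) fun t ht => ?_
  exact mul_le_mul_of_nonneg_left
    (avg_mono m hf hg ht.1 fun s hs => h s ⟨hs.1, hs.2.trans ht.2⟩) ht.1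

lemma volt_congr (m : ℕ) {f g : ℝ → ℝ} (hf : Continuous f) (hg : Continuous g) {r : ℝ}
    (hr : 0 ≤ r) (h : ∀ s ∈ Icc 0 r, f s = g s) : volt m f r = volt m g r :=
  le_antisymm (volt_mono m hf hg hr fun s hs => (h s hs).le)
    (volt_mono m hg hf hr fun s hs => (h s hs).ge)

lemma volt_add (m : ℕ) {f g : ℝ → ℝ} (hf : Continuous f) (hg : Continuous g) (a : ℝ) (r : ℝ) :
    volt m (fun s => f s + a * g s) r = volt m f r + a * volt m g r := by
  have h1 := continuous_avg m hf
  have h2 := continuous_avg m hg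
  have h : ∀ ρ, avg m (fun s => f s + a * g s) ρ = avg m f ρ + a * avg m g ρ := fun ρ => by
    unfold avg
    rw [← intervalIntegral.integral_const_mul, ← intervalIntegral.integral_add
      (Continuous.intervalIntegrable (by fun_prop) _ _)
      (Continuous.intervalIntegrable (by fun_prop) _ _)]
    congr 1; ext t; ring
  unfold volt
  simp only [h]
  rw [← intervalIntegral.integral_const_mul, ← intervalIntegral.integral_add
      (Continuous.intervalIntegrable (by fun_prop) _ _)
      (Continuous.intervalIntegrable (by fun_prop) _ _)]
  congr 1; ext t; ring

lemma volt_exp_le (m : ℕ) {g : ℝ → ℝ} (hg : Continuous g) {r A c : ℝ} (hr : r ∈ Icc (0 : ℝ) 1)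
    (hA : 0 < A) (hc : 0 ≤ c) (h : ∀ s ∈ Icc 0 r, g s ≤ c * Real.exp (A * s)) :
    volt m g r ≤ c / A * Real.exp (A * r) := by
  have h1 := continuous_avg m hg
  have key : ∀ ρ ∈ Icc 0 r, ρ * avg m g ρ ≤ c * Real.exp (A * ρ) := by
    intro ρ hρ
    have h3 : avg m g ρ ≤ c * Real.exp (A * ρ) := by
      have : avg m g ρ ≤ ∫ t in (0 : ℝ)..1, c * Real.exp (A * ρ) := by
        refine intervalIntegral.integral_mono_on zero_le_one
          (Continuous.intervalIntegrable (by fun_prop) _ _)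
          (Continuous.intervalIntegrable (by fun_prop) _ _) fun t ht => ?_
        have h4 : ρ * t ≤ ρ := by nlinarith [ht.2, hρ.1]
        have h5 : g (ρ * t) ≤ c * Real.exp (A * ρ) :=
          (h _ ⟨mul_nonneg hρ.1 ht.1, h4.trans hρ.2⟩).trans
            (mul_le_mul_of_nonneg_left (Real.exp_le_exp.2 (by nlinarith)) hc)
        have h6 : t ^ m ≤ 1 := pow_le_one₀ ht.1 ht.2
        have h7 : 0 ≤ t ^ m := pow_nonneg ht.1 _
        have h8 : 0 ≤ c * Real.exp (A * ρ) := by positivity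
        nlinarith
      simpa using this
    have h8 : 0 ≤ c * Real.exp (A * ρ) := by positivity
    nlinarith [hρ.1, hρ.2, hr.2]
  have h2 : volt m g r ≤ ∫ ρ in (0 : ℝ)..r, c * Real.exp (A * ρ) :=
    intervalIntegral.integral_mono_on hr.1
      (Continuous.intervalIntegrable (by fun_prop) _ _)
      (Continuous.intervalIntegrable (by fun_prop) _ _) key
  have h3 : ∫ ρ in (0 : ℝ)..r, c * Real.exp (A * ρ) =
      c / A * Real.exp (A * r) - c / A * Real.exp (A * 0) := by
    refine intervalIntegral.integral_eq_sub_of_hasDerivAt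
      (f := fun ρ => c / A * Real.exp (A * ρ)) (fun x _ => ?_)
      (Continuous.intervalIntegrable (by fun_prop) _ _)
    have := (((hasDerivAt_id x).const_mul A).exp).const_mul (c / A)
    refine this.congr_deriv ?_
    simp; field_simp
  have h4 : 0 ≤ c / A * Real.exp (A * 0) := by positivity
  linarith

/-- Gronwall's inequality for the operator `volt`. -/
lemma volt_gronwall (m : ℕ) {φ : ℝ → ℝ} (hφ : Continuous φ) {L a R : ℝ} (hL : 0 < L) (ha : 0 ≤ a)
    (hR : R ∈ Icc (0 : ℝ) 1) (h : ∀ r ∈ Icc 0 R, φ r ≤ a + L * volt m φ r) :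
    ∀ r ∈ Icc 0 R, φ r ≤ 2 * a * Real.exp (2 * L * r) := by
  obtain ⟨x, hx, hmax⟩ := (isCompact_Icc (a := (0 : ℝ)) (b := R)).exists_isMaxOn
    ⟨0, le_rfl, hR.1⟩ (f := fun r => φ r * Real.exp (-(2 * L * r)))
    (by fun_prop)
  set S := φ x * Real.exp (-(2 * L * x)) with hS
  have h1 : ∀ r ∈ Icc 0 R, φ r ≤ S * Real.exp (2 * L * r) := fun r hr => by
    have h2 : φ r * Real.exp (-(2 * L * r)) ≤ S := hmax hr
    have h3 : Real.exp (-(2 * L * r)) * Real.exp (2 * L * r) = 1 := by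
      rw [← Real.exp_add]; simp
    calc φ r = φ r * Real.exp (-(2 * L * r)) * Real.exp (2 * L * r) := by
          rw [mul_assoc, h3, mul_one]
      _ ≤ _ := mul_le_mul_of_nonneg_right h2 (Real.exp_pos _).le
  suffices hS2 : S ≤ 2 * a from fun r hr =>
    (h1 r hr).trans (mul_le_mul_of_nonneg_right hS2 (Real.exp_pos _).le)
  by_contra! hcon
  have hS0 : 0 ≤ S := by linarith
  have h4 := volt_exp_le m hφ (r := x) (A := 2 * L) ⟨hx.1, hx.2.trans hR.2⟩ (by positivity) hS0
    fun s hs => h1 s ⟨hs.1, hs.2.trans hx.2⟩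
  have h5 := h x hx
  have h6 : φ x ≤ a + S / 2 * Real.exp (2 * L * x) := by
    have : L * (S / (2 * L) * Real.exp (2 * L * x)) = S / 2 * Real.exp (2 * L * x) := by
      field_simp
    nlinarith [mul_le_mul_of_nonneg_left h4 hL.le]
  have h3 : Real.exp (2 * L * x) * Real.exp (-(2 * L * x)) = 1 := by
    rw [← Real.exp_add]; simp
  have h7 : S ≤ a * Real.exp (-(2 * L * x)) + S / 2 := by
    calc S ≤ (a + S / 2 * Real.exp (2 * L * x)) * Real.exp (-(2 * L * x)) :=
          mul_le_mul_of_nonneg_right h6 (Real.exp_pos _).le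
      _ = a * Real.exp (-(2 * L * x)) + S / 2 * (Real.exp (2 * L * x) * Real.exp (-(2 * L * x))) := by
          ring
      _ = _ := by rw [h3, mul_one]
  have h8 : Real.exp (-(2 * L * x)) ≤ 1 := Real.exp_le_one_iff.2 (by nlinarith [hx.1])
  nlinarith [mul_le_mul_of_nonneg_left h8 ha]

lemma abs_volt_le (m : ℕ) {f g : ℝ → ℝ} (hf : Continuous f) (hg : Continuous g) {r : ℝ}
    (hr : 0 ≤ r) (h : ∀ s ∈ Icc 0 r, |f s| ≤ g s) : |volt m f r| ≤ volt m g r := by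
  have h0 := volt_add m (f := fun _ => 0) continuous_const hf (-1) r
  have h1 : volt m (fun _ => 0) r = 0 := by simp [volt, avg]
  rw [abs_le']
  refine ⟨volt_mono m hf hg hr fun s hs => (le_abs_self _).trans (h s hs), ?_⟩
  have h2 : -volt m f r = volt m (fun s => 0 + (-1) * f s) r := by rw [h0, h1]; ring
  rw [h2]
  refine volt_mono m (by fun_prop) hg hr fun s hs => ?_
  have := (neg_le_abs (f s)).trans (h s hs)
  linarith

/-- The Volterra problem `u = d + volt (G (·, u))` with `G` globally Lipschitz has a solution. -/
lemma exists_volt_sol (m : ℕ) {G : ℝ → ℝ → ℝ} (hG : Continuous fun x : ℝ × ℝ => G x.1 x.2)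
    {L : ℝ} (hL : 0 < L) (hLip : ∀ s a b, |G s a - G s b| ≤ L * |a - b|) (d : ℝ) :
    ∃ u : ℝ → ℝ, Continuous u ∧
      ∀ r ∈ Icc (0 : ℝ) 1, u r = d + volt m (fun s => G s (u s)) r := by
  let E : (C(Icc (0 : ℝ) 1, ℝ)) → ℝ → ℝ := fun y s =>
    Real.exp (2 * L * s) * y (projIcc 0 1 zero_le_one s)
  have hE : ∀ y, Continuous (E y) := fun y => by
    have : Continuous fun s => y (projIcc 0 1 zero_le_one s) :=
      y.continuous.comp continuous_projIcc
    simp only [E]; fun_prop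
  have hGE : ∀ y, Continuous fun s => G s (E y s) := fun y =>
    hG.comp (continuous_id.prodMk (hE y))
  let T : C(Icc (0 : ℝ) 1, ℝ) → C(Icc (0 : ℝ) 1, ℝ) := fun y =>
    ⟨fun r => Real.exp (-(2 * L * r)) * (d + volt m (fun s => G s (E y s)) r), by
      have := continuous_volt m (hGE y)
      fun_prop⟩
  have hT : ContractingWith (1 / 2) T := by
    refine ⟨by
      rw [← NNReal.coe_lt_coe]; norm_num, LipschitzWith.of_dist_le_mul fun y z => ?_⟩
    rw [ContinuousMap.dist_le (by positivity)]
    intro r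
    have h1 : |volt m (fun s => G s (E y s)) r - volt m (fun s => G s (E z s)) r| ≤
        dist y z / 2 * Real.exp (2 * L * r) := by
      have h2 := volt_add m (hGE y) (hGE z) (-1) (r : ℝ)
      have h3 : volt m (fun s => G s (E y s)) r - volt m (fun s => G s (E z s)) r =
        volt m (fun s => G s (E y s) + (-1) * G s (E z s)) r := by rw [h2]; ring
      rw [h3]
      have h4 := abs_volt_le m (f := fun s => G s (E y s) + (-1) * G s (E z s))
        (g := fun s => L * dist y z * Real.exp (2 * L * s)) (by
          have := hGE y
          have := hGE z
          fun_prop) (by fun_prop) r.2.1 (fun s hs => by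
          have h5 := hLip s (E y s) (E z s)
          have h6 : G s (E y s) + (-1) * G s (E z s) = G s (E y s) - G s (E z s) := by ring
          rw [h6]
          refine h5.trans ?_
          rw [mul_assoc]
          refine mul_le_mul_of_nonneg_left ?_ hL.le
          have h7 : E y s - E z s = Real.exp (2 * L * s) * (y (projIcc 0 1 zero_le_one s) -
            z (projIcc 0 1 zero_le_one s)) := by simp only [E]; ring
          rw [h7, abs_mul, abs_of_pos (Real.exp_pos _), mul_comm]
          refine mul_le_mul_of_nonneg_right ?_ (Real.exp_pos _).le
          rw [← Real.dist_eq]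
          exact ContinuousMap.dist_apply_le_dist _)
      refine h4.trans ?_
      have h8 := volt_exp_le m (g := fun s => L * dist y z * Real.exp (2 * L * s)) (r := r)
        (A := 2 * L) (c := L * dist y z) (by fun_prop) r.2 (by positivity) (by positivity)
        fun s _ => le_rfl
      refine h8.trans (le_of_eq ?_)
      field_simp
    have h9 : T y r - T z r = Real.exp (-(2 * L * r)) *
        (volt m (fun s => G s (E y s)) r - volt m (fun s => G s (E z s)) r) := by
      simp only [T, ContinuousMap.coe_mk]; ring
    rw [Real.dist_eq, h9, abs_mul, abs_of_pos (Real.exp_pos _)]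
    refine (mul_le_mul_of_nonneg_left h1 (Real.exp_pos _).le).trans (le_of_eq ?_)
    have h3 : Real.exp (-(2 * L * r)) * Real.exp (2 * L * r) = 1 := by
      rw [← Real.exp_add]; simp
    push_cast
    linear_combination (dist y z / 2) * h3
  have hfix := hT.fixedPoint_isFixedPt
  set y := hT.fixedPoint
  refine ⟨E y, hE y, fun r hr => ?_⟩
  have h1 : T y ⟨r, hr⟩ = y ⟨r, hr⟩ := by rw [hfix]
  have h3 : Real.exp (2 * L * r) * Real.exp (-(2 * L * r)) = 1 := by
    rw [← Real.exp_add]; simp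
  simp only [T, ContinuousMap.coe_mk] at h1
  have h4 : E y r = Real.exp (2 * L * r) * y ⟨r, hr⟩ := by
    simp only [E, projIcc_of_mem zero_le_one hr]
  rw [h4, ← h1, ← mul_assoc, h3, one_mul]

/-- Lipschitz dependence of solutions of the Volterra problem on the initial value. -/
lemma volt_sol_lipschitz (m : ℕ) {G : ℝ → ℝ → ℝ} (hG : Continuous fun x : ℝ × ℝ => G x.1 x.2)
    {L : ℝ} (hL : 0 < L) (hLip : ∀ s a b, |G s a - G s b| ≤ L * |a - b|) {d e R : ℝ}
    (hR : R ∈ Icc (0 : ℝ) 1) {u w : ℝ → ℝ} (hu : Continuous u) (hw : Continuous w)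
    (hud : ∀ r ∈ Icc 0 R, u r = d + volt m (fun s => G s (u s)) r)
    (hwe : ∀ r ∈ Icc 0 R, w r = e + volt m (fun s => G s (w s)) r) :
    ∀ r ∈ Icc 0 R, |u r - w r| ≤ 2 * |d - e| * Real.exp (2 * L * r) := by
  have hGu : Continuous fun s => G s (u s) := hG.comp (continuous_id.prodMk hu)
  have hGw : Continuous fun s => G s (w s) := hG.comp (continuous_id.prodMk hw)
  refine volt_gronwall m (φ := fun r => |u r - w r|) (by fun_prop) hL (abs_nonneg _) hR
    fun r hr => ?_
  have h2 := volt_add m hGu hGw (-1) r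
  have h3 : u r - w r = (d - e) + volt m (fun s => G s (u s) + (-1) * G s (w s)) r := by
    rw [h2, hud r hr, hwe r hr]; ring
  have h4 := volt_add m (f := fun _ => 0) (g := fun s => |u s - w s|) (by fun_prop)
    (by fun_prop) L r
  have h1 : volt m (fun _ => 0) r = 0 := by simp [volt, avg]
  rw [h1, zero_add] at h4
  rw [h3, ← h4]
  refine (abs_add_le _ _).trans (add_le_add le_rfl (abs_volt_le m (by fun_prop) (by fun_prop) hr.1
    fun s _ => ?_))
  have h6 : G s (u s) + (-1) * G s (w s) = G s (u s) - G s (w s) := by ring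
  rw [h6, zero_add]
  exact hLip s _ _

/-- Differentiable dependence of solutions of the Volterra problem on the initial value. -/
lemma volt_sol_hasDerivAt (m : ℕ) {G g' : ℝ → ℝ → ℝ} (hG : Continuous fun x : ℝ × ℝ => G x.1 x.2)
    (hg' : Continuous fun x : ℝ × ℝ => g' x.1 x.2)
    {L : ℝ} (hL : 0 < L) (hLip : ∀ s a b, |G s a - G s b| ≤ L * |a - b|)
    (hbd : ∀ s a, |g' s a| ≤ L)
    (hdiff : ∀ ε > 0, ∃ η > 0, ∀ s ∈ Icc (0 : ℝ) 1, ∀ a b, |b - a| ≤ η →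
      |G s b - G s a - g' s a * (b - a)| ≤ ε * |b - a|)
    {u : ℝ → ℝ → ℝ} (hu : ∀ d, Continuous (u d))
    (hud : ∀ d, ∀ r ∈ Icc (0 : ℝ) 1, u d r = d + volt m (fun s => G s (u d s)) r) (d : ℝ)
    {v : ℝ → ℝ} (hv : Continuous v)
    (hvd : ∀ r ∈ Icc (0 : ℝ) 1, v r = 1 + volt m (fun s => g' s (u d s) * v s) r)
    {r : ℝ} (hr : r ∈ Icc (0 : ℝ) 1) : HasDerivAt (fun d => u d r) (v r) d := by
  have h01 : (1 : ℝ) ∈ Icc (0 : ℝ) 1 := ⟨zero_le_one, le_rfl⟩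
  rw [hasDerivAt_iff_isLittleO, Asymptotics.isLittleO_iff]
  intro c hc
  set C := 2 * Real.exp (2 * L) with hC
  have hC0 : 0 < C := by positivity
  obtain ⟨η, hη, hη'⟩ := hdiff (c / (C * C)) (by positivity)
  have hnear : ∀ᶠ e in 𝓝 d, |e - d| ≤ η / C := by
    have : Tendsto (fun e => |e - d|) (𝓝 d) (𝓝 0) := by
      have : Continuous fun e => |e - d| := by fun_prop
      simpa using this.tendsto d
    exact (this.eventually (gt_mem_nhds (by positivity : 0 < η / C))).mono fun e he => he.le
  filter_upwards [hnear] with e he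
  have hexp : ∀ s ∈ Icc (0 : ℝ) 1, Real.exp (2 * L * s) ≤ Real.exp (2 * L) := fun s hs =>
    Real.exp_le_exp.2 (by nlinarith [hs.2])
  have hlip : ∀ s ∈ Icc (0 : ℝ) 1, |u e s - u d s| ≤ C * |e - d| := fun s hs => by
    have := volt_sol_lipschitz m hG hL hLip h01 (hu e) (hu d) (hud e) (hud d) s hs
    refine this.trans ?_
    have := mul_le_mul_of_nonneg_left (hexp s hs) (by positivity : 0 ≤ 2 * |e - d|)
    rw [hC]; linarith
  have hG' : ∀ d, Continuous fun s => G s (u d s) := fun d => hG.comp (continuous_id.prodMk (hu d))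
  have hgc : Continuous fun s => g' s (u d s) := hg'.comp (continuous_id.prodMk (hu d))
  have hue := hu e
  have hud' := hu d
  have hGe := hG' e
  have hGd := hG' d
  set φ : ℝ → ℝ := fun s => |u e s - u d s - (e - d) * v s| with hφ
  have hφc : Continuous φ := by simp only [hφ]; fun_prop
  have hgr : ∀ s ∈ Icc (0 : ℝ) 1, φ s ≤ c / C * |e - d| + L * volt m φ s := by
    intro s hs
    have e1 : u e s - u d s - (e - d) * v s =
        volt m (fun s => (G s (u e s) + (-1) * G s (u d s)) +
          (-(e - d)) * (g' s (u d s) * v s)) s := by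
      rw [volt_add m (by fun_prop) (by fun_prop), volt_add m hGe hGd, hud e s hs, hud d s hs,
        hvd s hs]
      ring
    have e2 : |u e s - u d s - (e - d) * v s| ≤
        volt m (fun s => c / C * |e - d| + L * φ s) s := by
      rw [e1]
      refine abs_volt_le m (by fun_prop) (by fun_prop) hs.1 fun t ht => ?_
      have ht' : t ∈ Icc (0 : ℝ) 1 := ⟨ht.1, ht.2.trans hs.2⟩
      have h1 := hη' t ht' (u d t) (u e t) ((hlip t ht').trans (by
        rw [le_div_iff₀ hC0] at he; linarith))
      have h2 : G t (u e t) + (-1) * G t (u d t) + (-(e - d)) * (g' t (u d t) * v t) =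
        (G t (u e t) - G t (u d t) - g' t (u d t) * (u e t - u d t)) +
          g' t (u d t) * (u e t - u d t - (e - d) * v t) := by ring
      rw [h2]
      refine (abs_add_le _ _).trans (add_le_add (h1.trans ?_) ?_)
      · calc c / (C * C) * |u e t - u d t| ≤ c / (C * C) * (C * |e - d|) :=
              mul_le_mul_of_nonneg_left (hlip t ht') (by positivity)
          _ = _ := by field_simp
      · rw [abs_mul]
        exact mul_le_mul_of_nonneg_right (hbd _ _) (abs_nonneg _)
    refine e2.trans ?_
    rw [volt_add m (by fun_prop) hφc]
    refine add_le_add ?_ le_rfl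
    have h3 : ∀ ρ, avg m (fun _ : ℝ => c / C * |e - d|) ρ = c / C * |e - d| / (m + 1) := by
      intro ρ
      simp [avg, integral_pow]; ring
    have h4 : volt m (fun _ : ℝ => c / C * |e - d|) s =
        s ^ 2 / 2 * (c / C * |e - d| / (m + 1)) := by
      simp [volt, h3]
    rw [h4]
    have h5 : c / C * |e - d| / (m + 1) ≤ c / C * |e - d| :=
      div_le_self (by positivity) (by linarith [(Nat.cast_nonneg m : (0 : ℝ) ≤ m)])
    have h6 : s ^ 2 / 2 ≤ 1 := by nlinarith [hs.1, hs.2]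
    have h7 : 0 ≤ c / C * |e - d| / (m + 1) := by positivity
    nlinarith [sq_nonneg s]
  have hfin := volt_gronwall m hφc hL (by positivity) h01 hgr r hr
  rw [Real.norm_eq_abs, Real.norm_eq_abs, smul_eq_mul]
  refine hfin.trans ?_
  calc 2 * (c / C * |e - d|) * Real.exp (2 * L * r)
      ≤ 2 * (c / C * |e - d|) * Real.exp (2 * L) :=
        mul_le_mul_of_nonneg_left (hexp r hr) (by positivity)
    _ = c * |e - d| * (2 * Real.exp (2 * L) / C) := by ring
    _ = c * |e - d| := by rw [← hC, div_self hC0.ne', mul_one]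

lemma monotoneOn_of_hasDerivAt {f f' : ℝ → ℝ} {a c : ℝ} (hc : ContinuousOn f (Icc a c))
    (hd : ∀ x ∈ Ioo a c, HasDerivAt f (f' x) x) (h : ∀ x ∈ Ioo a c, 0 ≤ f' x) :
    MonotoneOn f (Icc a c) :=
  monotoneOn_of_hasDerivWithinAt_nonneg (f' := f') (convex_Icc a c) hc
    (fun x hx => (hd x (by rwa [interior_Icc] at hx)).hasDerivWithinAt)
    (fun x hx => h x (by rwa [interior_Icc] at hx))

lemma antitoneOn_of_hasDerivAt {f f' : ℝ → ℝ} {a c : ℝ} (hc : ContinuousOn f (Icc a c))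
    (hd : ∀ x ∈ Ioo a c, HasDerivAt f (f' x) x) (h : ∀ x ∈ Ioo a c, f' x ≤ 0) :
    AntitoneOn f (Icc a c) :=
  antitoneOn_of_hasDerivWithinAt_nonpos (f' := f') (convex_Icc a c) hc
    (fun x hx => (hd x (by rwa [interior_Icc] at hx)).hasDerivWithinAt)
    (fun x hx => h x (by rwa [interior_Icc] at hx))

lemma strictMonoOn_of_hasDerivAt {f f' : ℝ → ℝ} {a c : ℝ} (hc : ContinuousOn f (Icc a c))
    (hd : ∀ x ∈ Ioo a c, HasDerivAt f (f' x) x) (h : ∀ x ∈ Ioo a c, 0 < f' x) :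
    StrictMonoOn f (Icc a c) :=
  strictMonoOn_of_hasDerivWithinAt_pos (f' := f') (convex_Icc a c) hc
    (fun x hx => (hd x (by rwa [interior_Icc] at hx)).hasDerivWithinAt)
    (fun x hx => h x (by rwa [interior_Icc] at hx))

lemma strictAntiOn_of_hasDerivAt {f f' : ℝ → ℝ} {a c : ℝ} (hc : ContinuousOn f (Icc a c))
    (hd : ∀ x ∈ Ioo a c, HasDerivAt f (f' x) x) (h : ∀ x ∈ Ioo a c, f' x < 0) :
    StrictAntiOn f (Icc a c) :=
  strictAntiOn_of_hasDerivWithinAt_neg (f' := f') (convex_Icc a c) hc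
    (fun x hx => (hd x (by rwa [interior_Icc] at hx)).hasDerivWithinAt)
    (fun x hx => h x (by rwa [interior_Icc] at hx))

/-- The first zero of a continuous function that starts positive and becomes nonpositive. -/
lemma exists_first_zero {f : ℝ → ℝ} {a c : ℝ} (hf : ContinuousOn f (Icc a c))
    (ha : 0 < f a) (h : ∃ x ∈ Icc a c, f x ≤ 0) :
    ∃ x ∈ Ioc a c, f x = 0 ∧ ∀ t ∈ Ico a x, 0 < f t := by
  obtain ⟨x₁, hx₁, hfx₁⟩ := h
  have hcl : IsClosed (Icc a c ∩ f ⁻¹' Iic 0) := hf.preimage_isClosed_of_isClosed isClosed_Icc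
    isClosed_Iic
  have hco : IsCompact (Icc a c ∩ f ⁻¹' Iic 0) :=
    isCompact_Icc.of_isClosed_subset hcl inter_subset_left
  obtain ⟨x, ⟨hx, hfx⟩, hmin⟩ := hco.exists_isLeast ⟨x₁, hx₁, hfx₁⟩
  have hpos : ∀ t ∈ Ico a x, 0 < f t := fun t ht => by
    by_contra! hcon
    exact absurd (hmin ⟨⟨ht.1, ht.2.le.trans hx.2⟩, hcon⟩) (not_le.2 ht.2)
  have hax : a < x := lt_of_le_of_ne hx.1 fun heq => by
    subst heq
    exact absurd hfx (not_le.2 ha)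
  refine ⟨x, ⟨hax, hx.2⟩, le_antisymm hfx ?_, hpos⟩
  have h1 : Tendsto f (𝓝[Ico a x] x) (𝓝 (f x)) :=
    (hf x hx).mono fun t ht => ⟨ht.1, ht.2.le.trans hx.2⟩
  have : (𝓝[Ico a x] x).NeBot := by
    rw [← mem_closure_iff_nhdsWithin_neBot, closure_Ico hax.ne]
    exact ⟨hax.le, le_rfl⟩
  exact ge_of_tendsto h1 (eventually_nhdsWithin_of_forall fun t ht => (hpos t ht).le)

/-- A function positive to the left of a zero has nonpositive derivative there. -/
lemma deriv_nonpos_of_pos_left {f : ℝ → ℝ} {f' a x : ℝ} (hax : a < x) (h0 : f x = 0)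
    (hpos : ∀ t ∈ Ioo a x, 0 < f t) (hd : HasDerivAt f f' x) : f' ≤ 0 := by
  have h1 := (hasDerivAt_iff_tendsto_slope.1 hd).mono_left
    (nhdsWithin_mono x (fun t (ht : t < x) => ht.ne))
  refine le_of_tendsto (f := slope f x) (x := 𝓝[<] x) h1 ?_
  filter_upwards [Ioo_mem_nhdsLT hax] with t ht
  rw [slope_def_field, h0]
  have := hpos t ht
  exact div_nonpos_of_nonneg_of_nonpos (by linarith) (by linarith [ht.2])

/-- A function that starts negative and decreases strictly through each of its zeros stays
negative. -/
lemma neg_of_deriv_neg_at_zeros {f f' : ℝ → ℝ} {a c : ℝ} (hf : ContinuousOn f (Icc a c))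
    (ha : f a < 0) (hd : ∀ x ∈ Ioc a c, f x = 0 → (∀ t ∈ Ico a x, f t < 0) →
      HasDerivAt f (f' x) x ∧ f' x < 0) :
    ∀ x ∈ Icc a c, f x < 0 := by
  by_contra! hcon
  obtain ⟨x₁, hx₁, h1⟩ := hcon
  obtain ⟨x, hx, h0, hpos⟩ := exists_first_zero (f := fun x => -f x) hf.neg (by linarith)
    ⟨x₁, hx₁, by linarith⟩
  obtain ⟨h2, h3⟩ := hd x hx (by linarith) (fun t ht => by have := hpos t ht; linarith)
  have := deriv_nonpos_of_pos_left hx.1 h0 (fun t ht => hpos t ⟨ht.1.le, ht.2⟩) h2.neg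
  linarith

/-- Backward uniqueness for second order differential inequalities. -/
lemma eq_zero_of_cauchy_data_right {z b β : ℝ → ℝ} {a c C : ℝ} (hac : a ≤ c) (hC : 0 ≤ C)
    (hz : ∀ r ∈ Icc a c, HasDerivAt z (b r) r) (hb : ∀ r ∈ Icc a c, HasDerivAt b (β r) r)
    (hβ : ∀ r ∈ Icc a c, |β r| ≤ C * (|z r| + |b r|)) (hzc : z c = 0) (hbc : b c = 0) :
    ∀ r ∈ Icc a c, z r = 0 := by
  have hd : ∀ r ∈ Icc a c, HasDerivAt (fun r => (z r ^ 2 + b r ^ 2) * Real.exp ((1 + 3 * C) * r))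
      ((2 * z r * b r + 2 * b r * β r + (1 + 3 * C) * (z r ^ 2 + b r ^ 2)) *
        Real.exp ((1 + 3 * C) * r)) r := fun r hr => by
    have h1 := ((hz r hr).pow 2).add ((hb r hr).pow 2)
    have h2 := ((hasDerivAt_id r).const_mul (1 + 3 * C)).exp
    refine (h1.mul h2).congr_deriv ?_
    simp
    ring
  have hmono := monotoneOn_of_hasDerivAt (fun r hr => (hd r hr).continuousAt.continuousWithinAt)
    (fun r hr => hd r ⟨hr.1.le, hr.2.le⟩) (fun r hr => by
      have h1 := hβ r ⟨hr.1.le, hr.2.le⟩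
      refine mul_nonneg ?_ (Real.exp_pos _).le
      have h2 : -(|b r| * |β r|) ≤ b r * β r := by
        rw [← abs_mul]; exact neg_abs_le _
      have h3 := mul_le_mul_of_nonneg_left h1 (abs_nonneg (b r))
      have h4 := sq_abs (z r)
      have h5 := sq_abs (b r)
      nlinarith [sq_nonneg (z r + b r), mul_nonneg hC (sq_nonneg (|z r| - |b r|)),
        mul_nonneg hC (sq_nonneg (z r))])
  intro r hr
  have h1 := hmono hr ⟨hac, le_rfl⟩ hr.2
  simp only [hzc, hbc] at h1
  have h2 : z r ^ 2 + b r ^ 2 ≤ 0 := by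
    by_contra! hcon
    have := mul_pos hcon (Real.exp_pos ((1 + 3 * C) * r))
    norm_num at h1
    linarith
  nlinarith [sq_nonneg (z r), sq_nonneg (b r)]

/-- The properties of the weight `K` used in the analysis; `y` is its logarithmic slope
`-r K' / K`. -/
structure IsWeight (K y : ℝ → ℝ) : Prop where
  cont : Continuous K
  pos : ∀ r, 0 < K r
  le_one : ∀ r, K r ≤ 1
  hasDerivAt : ∀ r, 0 < r → HasDerivAt K (-(y r * K r / r)) r
  y_nonneg : ∀ r, 0 < r → 0 ≤ y r
  y_mono : MonotoneOn y (Ioi 0)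
  y_zero : Tendsto y (𝓝[>] 0) (𝓝 0)

lemma IsWeight.antitone {K y : ℝ → ℝ} (hw : IsWeight K y) {a b : ℝ} (ha : 0 ≤ a) (hab : a ≤ b) :
    K b ≤ K a :=
  antitoneOn_of_hasDerivAt (f' := fun r => -(y r * K r / r)) hw.cont.continuousOn
    (fun r hr => hw.hasDerivAt r (ha.trans_lt hr.1)) (fun r hr => by
      have h0 := ha.trans_lt hr.1
      have := div_nonneg (mul_nonneg (hw.y_nonneg r h0) (hw.pos r).le) h0.le
      linarith) ⟨le_rfl, hab⟩ ⟨hab, le_rfl⟩ hab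

/-- `u` solves `u'' + (m/r) u' = lam u - K u₊^q` on `[0,1]`, with `u' = r h`. -/
structure IsRad (m : ℕ) (K : ℝ → ℝ) (lam q : ℝ) (u h : ℝ → ℝ) : Prop where
  cu : Continuous u
  ch : Continuous h
  du : ∀ r ∈ Icc (0 : ℝ) 1, HasDerivAt u (r * h r) r
  dh : ∀ r ∈ Ioc (0 : ℝ) 1,
    HasDerivAt h ((lam * u r - K r * (max (u r) 0) ^ q - (m + 1) * h r) / r) r
  h0 : h 0 = (lam * u 0 - K 0 * (max (u 0) 0) ^ q) / (m + 1)

section Radial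

variable {m : ℕ} {K y : ℝ → ℝ} {lam q : ℝ} {u h : ℝ → ℝ}

lemma IsRad.db (hs : IsRad m K lam q u h) {r : ℝ} (hr : r ∈ Ioc (0 : ℝ) 1) :
    HasDerivAt (fun r => r * h r) (lam * u r - K r * (max (u r) 0) ^ q - m * h r) r := by
  refine ((hasDerivAt_id r).mul (hs.dh r hr)).congr_deriv ?_
  have := hr.1.ne'
  simp
  field_simp
  ring

lemma rpow_sub_one_mul_self {q t : ℝ} (hq : 1 < q) (ht : 0 ≤ t) : t ^ q = t ^ (q - 1) * t := by
  rcases ht.eq_or_lt with rfl | ht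
  · rw [Real.zero_rpow (by linarith)]; simp
  · rw [← Real.rpow_add_one ht.ne']; ring_nf

lemma rpow_add_one_eq {q t : ℝ} (hq : 1 < q) (ht : 0 ≤ t) : t ^ (q + 1) = t ^ (q - 1) * t ^ 2 := by
  rcases ht.eq_or_lt with rfl | ht
  · rw [Real.zero_rpow (by linarith)]; simp
  · rw [Real.rpow_add_one ht.ne', rpow_sub_one_mul_self hq ht.le]; ring

lemma IsRad.deriv_ne_zero (hs : IsRad m K lam q u h) (hw : IsWeight K y) (hlam : 0 ≤ lam)
    (hq : 1 < q) {ρ : ℝ} (hρ : ρ ∈ Ioc (0 : ℝ) 1) (hu0 : u 0 ≠ 0) (hz : u ρ = 0) : h ρ ≠ 0 := by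
  intro hcon
  have hzero : ∀ r ∈ Ioc 0 ρ, u r = 0 := by
    intro r hr
    obtain ⟨M, hM⟩ := (isCompact_Icc (a := (0 : ℝ)) (b := 1)).exists_bound_of_continuousOn
      (f := fun r => (max (u r) 0) ^ (q - 1)) (by
        have := hs.cu
        exact (Continuous.rpow_const (by fun_prop) fun _ => Or.inr (by linarith)).continuousOn)
    have hM0 : 0 ≤ M := (norm_nonneg _).trans (hM 0 ⟨le_rfl, zero_le_one⟩)
    refine eq_zero_of_cauchy_data_right (z := u) (b := fun r => r * h r)
      (C := lam + M + m / r) hr.2 (by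
        have := hr.1
        positivity)
      (fun t ht => hs.du t ⟨hr.1.le.trans ht.1, ht.2.trans hρ.2⟩)
      (fun t ht => hs.db ⟨hr.1.trans_le ht.1, ht.2.trans hρ.2⟩) (fun t ht => ?_) hz
      (by simp [hcon]) r ⟨le_rfl, hr.2⟩
    have ht0 := hr.1.trans_le ht.1
    have h1 := hM t ⟨ht0.le, ht.2.trans hρ.2⟩
    rw [rpow_sub_one_mul_self hq (le_max_right _ _)]
    have hX : 0 ≤ (max (u t) 0) ^ (q - 1) := by positivity
    rw [Real.norm_of_nonneg hX] at h1
    have hmax : |max (u t) 0| ≤ |u t| := by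
      rw [abs_of_nonneg (le_max_right _ _)]
      exact max_le (le_abs_self _) (abs_nonneg _)
    have h2 : |lam * u t| = lam * |u t| := by rw [abs_mul, abs_of_nonneg hlam]
    have h3 : |K t * ((max (u t) 0) ^ (q - 1) * max (u t) 0)| ≤ M * |u t| := by
      rw [abs_mul, abs_mul, abs_of_pos (hw.pos t), abs_of_nonneg hX]
      have h4 : (max (u t) 0) ^ (q - 1) * |max (u t) 0| ≤ M * |u t| :=
        mul_le_mul h1 hmax (abs_nonneg _) hM0
      have h5 : 0 ≤ (max (u t) 0) ^ (q - 1) * |max (u t) 0| := by positivity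
      nlinarith [hw.le_one t, hw.pos t]
    have h4 : |(m : ℝ) * h t| ≤ m / r * |t * h t| := by
      rw [abs_mul, abs_mul, abs_of_pos ht0, abs_of_nonneg (Nat.cast_nonneg m : (0 : ℝ) ≤ m)]
      have h6 : 0 ≤ (m : ℝ) * |h t| := by positivity
      have h7 : 1 ≤ t / r := (one_le_div hr.1).2 ht.1
      calc (m : ℝ) * |h t| ≤ (m * |h t|) * (t / r) := le_mul_of_one_le_right h6 h7
        _ = _ := by ring
    have h5 := abs_sub (lam * u t - K t * ((max (u t) 0) ^ (q - 1) * max (u t) 0)) (m * h t)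
    have h6 := abs_sub (lam * u t) (K t * ((max (u t) 0) ^ (q - 1) * max (u t) 0))
    have h7 : 0 ≤ (m : ℝ) / r * |u t| := by have := hr.1; positivity
    have h8 : 0 ≤ (lam + M) * |t * h t| := by positivity
    nlinarith
  apply hu0
  have h1 : Tendsto u (𝓝[Ioc 0 ρ] 0) (𝓝 (u 0)) := hs.cu.continuousAt.continuousWithinAt
  have : (𝓝[Ioc 0 ρ] (0 : ℝ)).NeBot := by
    rw [← mem_closure_iff_nhdsWithin_neBot, closure_Ioc hρ.1.ne]
    exact ⟨le_rfl, hρ.1.le⟩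
  refine tendsto_nhds_unique h1 ?_
  exact tendsto_const_nhds.congr' (eventually_nhdsWithin_of_forall fun t ht => (hzero t ht).symm)

end Radial

section Radial

variable {m : ℕ} {K y : ℝ → ℝ} {lam q : ℝ} {u h : ℝ → ℝ}

lemma IsRad.hasDerivAt_rpow (hs : IsRad m K lam q u h) {r a : ℝ} (hr : r ∈ Icc (0 : ℝ) 1)
    (hu : 0 < u r) : HasDerivAt (fun r => u r ^ (a + 1)) ((a + 1) * u r ^ a * (r * h r)) r := by
  have := (hs.du r hr).rpow_const (p := a + 1) (Or.inl hu.ne')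
  refine this.congr_deriv ?_
  rw [add_sub_cancel_right]
  ring

/-- Up to its first zero, a radial solution is decreasing. -/
lemma IsRad.h_neg (hs : IsRad m K lam q u h) (hw : IsWeight K y) (hlam : 0 ≤ lam)
    (hq : 1 < q) {ρ : ℝ} (hρ : ρ ∈ Ioc (0 : ℝ) 1) (hpos : ∀ r ∈ Ico 0 ρ, 0 < u r)
    (hz : u ρ = 0) : ∀ r ∈ Icc 0 ρ, h r < 0 := by
  have hu0 : 0 < u 0 := hpos 0 ⟨le_rfl, hρ.1⟩
  have hne := hs.deriv_ne_zero hw hlam hq hρ hu0.ne' hz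
  have hend : h ρ < 0 := by
    have h1 := deriv_nonpos_of_pos_left hρ.1 hz (fun t ht => hpos t ⟨ht.1.le, ht.2⟩)
      (hs.du ρ ⟨hρ.1.le, hρ.2⟩)
    rcases lt_or_gt_of_ne hne with h2 | h2
    · exact h2
    · nlinarith [mul_pos hρ.1 h2]
  let E : ℝ → ℝ := fun r => (r * h r) ^ 2 / 2 - lam * u r ^ 2 / 2 + K r * u r ^ (q + 1) / (q + 1)
  have hE : AntitoneOn E (Icc 0 ρ) := by
    refine antitoneOn_of_hasDerivAt
      (f' := fun r => -(m * r * h r ^ 2) - y r * K r * u r ^ (q + 1) / (r * (q + 1))) ?_ ?_ ?_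
    · have h1 := hs.cu
      have h2 := hs.ch
      have h3 := hw.cont
      have h4 : Continuous fun r => u r ^ (q + 1) :=
        h1.rpow_const fun _ => Or.inr (by linarith)
      simp only [E]
      fun_prop
    · intro r hr
      have hr1 : r ∈ Ioc (0 : ℝ) 1 := ⟨hr.1, hr.2.le.trans hρ.2⟩
      have hur := hpos r ⟨hr.1.le, hr.2⟩
      have d1 := hs.db hr1
      have d2 := hs.du r ⟨hr1.1.le, hr1.2⟩
      have d3 := hs.hasDerivAt_rpow (a := q) ⟨hr1.1.le, hr1.2⟩ hur
      have d4 := hw.hasDerivAt r hr.1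
      refine ((((d1.pow 2).div_const 2).sub (((d2.pow 2).const_mul lam).div_const 2)).add
        ((d4.mul d3).div_const (q + 1))).congr_deriv ?_
      rw [max_eq_left hur.le]
      have := hr.1.ne'
      have : q + 1 ≠ 0 := by linarith
      simp
      field_simp
      ring
    · intro r hr
      have hur := hpos r ⟨hr.1.le, hr.2⟩
      have h1 : 0 ≤ y r * K r * u r ^ (q + 1) / (r * (q + 1)) := by
        have := hw.y_nonneg r hr.1
        have := (hw.pos r).le
        have := hr.1
        positivity
      have h2 : 0 ≤ m * r * h r ^ 2 := by
        have := hr.1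
        positivity
      linarith
  have hEρ : 0 < E ρ := by
    simp only [E, hz]
    rw [Real.zero_rpow (by linarith)]
    have h1 : 0 < (ρ * h ρ) ^ 2 := sq_pos_of_ne_zero (mul_ne_zero hρ.1.ne' hne)
    simp only [ne_eq, OfNat.ofNat_ne_zero, not_false_eq_true, zero_pow, mul_zero, zero_div]
    linarith
  have hcrit : ∀ r ∈ Ico 0 ρ, r * h r = 0 → lam * u r - K r * u r ^ q < 0 := by
    intro r hr h1
    have hur := hpos r hr
    have h2 := hE ⟨hr.1, hr.2.le⟩ ⟨hρ.1.le, le_rfl⟩ hr.2.le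
    have h3 : 0 < E r := hEρ.trans_le h2
    simp only [E, h1] at h3
    rw [rpow_add_one_eq hq hur.le] at h3
    rw [rpow_sub_one_mul_self hq hur.le]
    have h4 : 0 < u r ^ 2 * (K r * u r ^ (q - 1) * 2 - lam * (q + 1)) := by
      have h5 : 0 < 2 * (q + 1) * (0 ^ 2 / 2 - lam * u r ^ 2 / 2 +
        K r * (u r ^ (q - 1) * u r ^ 2) / (q + 1)) := by positivity
      have h6 : 2 * (q + 1) * (0 ^ 2 / 2 - lam * u r ^ 2 / 2 +
        K r * (u r ^ (q - 1) * u r ^ 2) / (q + 1)) =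
          u r ^ 2 * (K r * u r ^ (q - 1) * 2 - lam * (q + 1)) := by
        have : q + 1 ≠ 0 := by linarith
        field_simp
        ring
      linarith
    have h7 : 0 < K r * u r ^ (q - 1) * 2 - lam * (q + 1) := by
      by_contra! hcon
      nlinarith [sq_nonneg (u r)]
    have h8 : lam < K r * u r ^ (q - 1) := by nlinarith
    nlinarith
  have hstart : h 0 < 0 := by
    rw [hs.h0, max_eq_left hu0.le]
    exact div_neg_of_neg_of_pos (hcrit 0 ⟨le_rfl, hρ.1⟩ (by simp)) (by positivity)
  refine neg_of_deriv_neg_at_zeros (f' := fun r =>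
    (lam * u r - K r * (max (u r) 0) ^ q - (m + 1) * h r) / r) hs.ch.continuousOn hstart ?_
  intro r hr h0 _
  have hr1 : r ∈ Ioc (0 : ℝ) 1 := ⟨hr.1, hr.2.trans hρ.2⟩
  refine ⟨hs.dh r hr1, ?_⟩
  have hrρ : r < ρ := lt_of_le_of_ne hr.2 fun heq => by
    subst heq
    exact hend.ne h0
  rw [h0, max_eq_left (hpos r ⟨hr.1.le, hrρ⟩).le]
  have := hcrit r ⟨hr.1.le, hrρ⟩ (by simp [h0])
  exact div_neg_of_neg_of_pos (by linarith) hr.1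

lemma IsRad.strictAntiOn (hs : IsRad m K lam q u h) (hw : IsWeight K y) (hlam : 0 ≤ lam)
    (hq : 1 < q) {ρ : ℝ} (hρ : ρ ∈ Ioc (0 : ℝ) 1) (hpos : ∀ r ∈ Ico 0 ρ, 0 < u r)
    (hz : u ρ = 0) : StrictAntiOn u (Icc 0 ρ) :=
  strictAntiOn_of_hasDerivAt (f' := fun r => r * h r) hs.cu.continuousOn
    (fun r hr => hs.du r ⟨hr.1.le, hr.2.le.trans hρ.2⟩)
    (fun r hr => mul_neg_of_pos_of_neg hr.1
      (hs.h_neg hw hlam hq hρ hpos hz r ⟨hr.1.le, hr.2.le⟩))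

/-- The Pohozaev function of a radial solution. -/
def pohozaev (m : ℕ) (K : ℝ → ℝ) (lam q : ℝ) (u h : ℝ → ℝ) (r : ℝ) : ℝ :=
  r ^ (m + 1) * ((r * h r) ^ 2 / 2 + K r * u r ^ (q + 1) / (q + 1) - lam * u r ^ 2 / 2) +
    (m - 1) / 2 * (r ^ m * u r * (r * h r))

lemma IsRad.continuous_pohozaev (hs : IsRad m K lam q u h) (hw : IsWeight K y) (hq : 1 < q) :
    Continuous (pohozaev m K lam q u h) := by
  have h1 := hs.cu
  have h2 := hs.ch
  have h3 := hw.cont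
  have h4 : Continuous fun r => u r ^ (q + 1) := h1.rpow_const fun _ => Or.inr (by linarith)
  unfold pohozaev
  fun_prop

lemma IsRad.hasDerivAt_pohozaev (hs : IsRad m K lam q u h) (hw : IsWeight K y) (hq : 1 < q)
    (hm : 1 ≤ m) {r : ℝ} (hr : r ∈ Ioc (0 : ℝ) 1) (hur : 0 < u r) :
    HasDerivAt (pohozaev m K lam q u h) (r ^ m * u r ^ 2 *
      (((m + 1 - y r) / (q + 1) - (m - 1) / 2) * (K r * u r ^ (q - 1)) - lam)) r := by
  have d1 := hs.db hr
  have d2 := hs.du r ⟨hr.1.le, hr.2⟩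
  have d3 := hs.hasDerivAt_rpow (a := q) ⟨hr.1.le, hr.2⟩ hur
  have d4 := hw.hasDerivAt r hr.1
  refine (((hasDerivAt_pow (m + 1) r).mul ((((d1.pow 2).div_const 2).add
    ((d4.mul d3).div_const (q + 1))).sub (((d2.pow 2).const_mul lam).div_const 2))).add
      ((((hasDerivAt_pow m r).mul d2).mul d1).const_mul (((m : ℝ) - 1) / 2))).congr_deriv ?_
  obtain ⟨n, rfl⟩ := Nat.exists_eq_add_of_le hm
  rw [max_eq_left hur.le]
  have := hr.1.ne'
  have : q + 1 ≠ 0 := by linarith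
  simp only [Pi.mul_apply, Pi.pow_apply, Pi.add_apply, Pi.sub_apply]
  rw [rpow_sub_one_mul_self hq hur.le, rpow_add_one_eq hq hur.le]
  simp
  field_simp
  ring

/-- Positivity of the Pohozaev function. -/
lemma IsRad.pohozaev_pos (hs : IsRad m K lam q u h) (hw : IsWeight K y) (hlam : 0 ≤ lam)
    (hq : 1 < q) (hm : 1 ≤ m) {ρ : ℝ} (hρ : ρ ∈ Ioc (0 : ℝ) 1) (hpos : ∀ r ∈ Ico 0 ρ, 0 < u r)
    (hz : u ρ = 0) : ∀ r ∈ Ioo 0 ρ, 0 < pohozaev m K lam q u h r := by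
  have hanti := hs.strictAntiOn hw hlam hq hρ hpos hz
  have hend := hs.h_neg hw hlam hq hρ hpos hz ρ ⟨hρ.1.le, le_rfl⟩
  have hcont := hs.continuous_pohozaev hw hq
  set κ : ℝ → ℝ := fun r => (m + 1 - y r) / (q + 1) - (m - 1) / 2 with hκ
  set χ : ℝ → ℝ := fun r => κ r * (K r * u r ^ (q - 1)) - lam with hχ
  have hder : ∀ r ∈ Ioo 0 ρ, HasDerivAt (pohozaev m K lam q u h) (r ^ m * u r ^ 2 * χ r) r :=
    fun r hr => hs.hasDerivAt_pohozaev hw hq hm ⟨hr.1, hr.2.le.trans hρ.2⟩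
      (hpos r ⟨hr.1.le, hr.2⟩)
  have hχmono : ∀ a ∈ Ioo 0 ρ, ∀ b ∈ Ioo 0 ρ, a ≤ b → χ a ≤ 0 → χ b ≤ 0 := by
    intro a ha b hb hab h1
    have hua := hpos a ⟨ha.1.le, ha.2⟩
    have hub := hpos b ⟨hb.1.le, hb.2⟩
    have hle : u b ≤ u a := hanti.antitoneOn ⟨ha.1.le, ha.2.le⟩ ⟨hb.1.le, hb.2.le⟩ hab
    have h2 : u b ^ (q - 1) ≤ u a ^ (q - 1) :=
      Real.rpow_le_rpow hub.le hle (by linarith)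
    have h3 : K b * u b ^ (q - 1) ≤ K a * u a ^ (q - 1) :=
      mul_le_mul (hw.antitone ha.1.le hab) h2 (Real.rpow_nonneg hub.le _) (hw.pos a).le
    have h4 : κ b ≤ κ a := by
      simp only [hκ]
      have := hw.y_mono ha.1 hb.1 hab
      gcongr
    have h5 : 0 ≤ K b * u b ^ (q - 1) := mul_nonneg (hw.pos b).le (Real.rpow_nonneg hub.le _)
    simp only [hχ] at h1 ⊢
    rcases le_or_gt (κ b) 0 with h6 | h6
    · nlinarith
    · nlinarith [mul_le_mul h4 h3 h5 (h6.le.trans h4)]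
  have hPρ : 0 < pohozaev m K lam q u h ρ := by
    simp only [pohozaev, hz]
    rw [Real.zero_rpow (by linarith)]
    have := hρ.1
    have h2 : 0 < (ρ * h ρ) ^ 2 := by
      have : ρ * h ρ ≠ 0 := mul_ne_zero hρ.1.ne' hend.ne
      positivity
    have h3 : 0 < ρ ^ (m + 1) := by positivity
    have := mul_pos h3 h2
    norm_num
    nlinarith
  intro r hr
  rcases le_or_gt (χ r) 0 with h1 | h1
  · have hA : AntitoneOn (pohozaev m K lam q u h) (Icc r ρ) :=
      antitoneOn_of_hasDerivAt (f' := fun r => r ^ m * u r ^ 2 * χ r) hcont.continuousOn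
        (fun t ht => hder t ⟨hr.1.trans ht.1, ht.2⟩) (fun t ht => by
          have h2 := hχmono r hr t ⟨hr.1.trans ht.1, ht.2⟩ ht.1.le h1
          have : 0 < t := hr.1.trans ht.1
          exact mul_nonpos_of_nonneg_of_nonpos (by positivity) h2)
    exact hPρ.trans_le (hA ⟨le_rfl, hr.2.le⟩ ⟨hr.2.le, le_rfl⟩ hr.2.le)
  · have hA : StrictMonoOn (pohozaev m K lam q u h) (Icc 0 r) :=
      strictMonoOn_of_hasDerivAt (f' := fun r => r ^ m * u r ^ 2 * χ r) hcont.continuousOn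
        (fun t ht => hder t ⟨ht.1, ht.2.trans hr.2⟩) (fun t ht => by
          have h2 : 0 < χ t := by
            by_contra! hcon
            exact absurd (hχmono t ⟨ht.1, ht.2.trans hr.2⟩ r hr ht.2.le hcon) (not_le.2 h1)
          have := ht.1
          have := hpos t ⟨ht.1.le, ht.2.trans hr.2⟩
          positivity)
    have h2 := hA ⟨le_rfl, hr.1.le⟩ ⟨hr.1.le, le_rfl⟩ hr.1
    have h3 : pohozaev m K lam q u h 0 = 0 := by simp [pohozaev]
    linarith

/-- The logarithmic slope `-r u' / u` of a radial solution is increasing. -/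
lemma IsRad.slope_strictMono (hs : IsRad m K lam q u h) (hw : IsWeight K y) (hlam : 0 ≤ lam)
    (hq : 1 < q) (hm : 1 ≤ m) {ρ : ℝ} (hρ : ρ ∈ Ioc (0 : ℝ) 1) (hpos : ∀ r ∈ Ico 0 ρ, 0 < u r)
    (hz : u ρ = 0) {a b : ℝ} (ha : 0 < a) (hab : a < b) (hb : b < ρ) :
    -(a * (a * h a)) / u a < -(b * (b * h b)) / u b := by
  have hu : ∀ t ∈ Icc a b, 0 < u t := fun t ht =>
    hpos t ⟨ha.le.trans ht.1, ht.2.trans_lt hb⟩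
  refine strictMonoOn_of_hasDerivAt (f := fun r => -(r * (r * h r)) / u r) (f' := fun r =>
    (2 * pohozaev m K lam q u h r / r ^ m + r * K r * u r ^ (q + 1) * (1 - 2 / (q + 1))) /
      u r ^ 2) ?_ ?_ ?_ ⟨le_rfl, hab.le⟩ ⟨hab.le, le_rfl⟩ hab
  · have h1 := hs.cu
    have h2 := hs.ch
    refine ContinuousOn.div (by fun_prop) (by fun_prop) fun t ht => (hu t ht).ne'
  · intro r hr
    have hr0 := ha.trans hr.1
    have hr1 : r ∈ Ioc (0 : ℝ) 1 := ⟨hr0, (hr.2.trans hb).le.trans hρ.2⟩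
    have hur := hu r ⟨hr.1.le, hr.2.le⟩
    have d1 := hs.db hr1
    have d2 := hs.du r ⟨hr1.1.le, hr1.2⟩
    refine (((hasDerivAt_id r).mul d1).neg.div d2 hur.ne').congr_deriv ?_
    obtain ⟨n, rfl⟩ := Nat.exists_eq_add_of_le hm
    rw [max_eq_left hur.le]
    have : q + 1 ≠ 0 := by linarith
    have := hur.ne'
    have := hr0.ne'
    simp only [pohozaev]
    rw [rpow_sub_one_mul_self hq hur.le, rpow_add_one_eq hq hur.le]
    simp
    field_simp
    ring
  · intro r hr
    have hr0 := ha.trans hr.1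
    have h1 := hs.pohozaev_pos hw hlam hq hm hρ hpos hz r ⟨hr0, hr.2.trans hb⟩
    have hur := hu r ⟨hr.1.le, hr.2.le⟩
    have h2 : 0 < 1 - 2 / (q + 1) := by
      rw [sub_pos, div_lt_one (by linarith)]; linarith
    have := hw.pos r
    positivity

end Radial

section Linearized

variable {m : ℕ} {K y : ℝ → ℝ} {lam q : ℝ} {u h v η : ℝ → ℝ}

/-- `v` solves the linearization of the radial equation at `u`, with `v' = r η`. -/
structure IsLin (m : ℕ) (K : ℝ → ℝ) (lam q : ℝ) (u v η : ℝ → ℝ) : Prop where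
  cη : Continuous η
  dv : ∀ r ∈ Icc (0 : ℝ) 1, HasDerivAt v (r * η r) r
  db : ∀ r ∈ Ioc (0 : ℝ) 1, HasDerivAt (fun r => r * η r)
    ((lam - q * (K r * (max (u r) 0) ^ (q - 1))) * v r - m * η r) r
  v0 : v 0 = 1

lemma IsLin.deriv_ne_zero (hv : IsLin m K lam q u v η) (hK : Continuous K) (hu : Continuous u)
    (hq : 1 < q) {a c : ℝ} (ha : 0 < a) (hac : a < c) (hc : c ≤ 1) (hva : v a ≠ 0)
    (hvc : v c = 0) : η c ≠ 0 := by
  intro hηc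
  apply hva
  have hγ : Continuous fun r => lam - q * (K r * (max (u r) 0) ^ (q - 1)) := by
    have : Continuous fun r => (max (u r) 0) ^ (q - 1) :=
      (hu.max continuous_const).rpow_const fun _ => Or.inr (by linarith)
    fun_prop
  obtain ⟨L, hL⟩ := isCompact_Icc.exists_bound_of_continuousOn (s := Icc (0 : ℝ) 1) hγ.continuousOn
  have hL0 : 0 ≤ L := (norm_nonneg _).trans (hL 0 ⟨le_rfl, zero_le_one⟩)
  have hma : 0 ≤ m / a := by positivity
  refine eq_zero_of_cauchy_data_right (z := v) (b := fun r => r * η r)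
    (β := fun r => (lam - q * (K r * (max (u r) 0) ^ (q - 1))) * v r - m * η r) (C := L + m / a)
    hac.le (by positivity)
    (fun r hr => hv.dv r ⟨ha.le.trans hr.1, hr.2.trans hc⟩)
    (fun r hr => hv.db r ⟨ha.trans_le hr.1, hr.2.trans hc⟩) ?_ hvc (by simp [hηc]) a ⟨le_rfl, hac.le⟩
  intro r hr
  have hr0 := ha.trans_le hr.1
  have h1 := hL r ⟨hr0.le, hr.2.trans hc⟩
  rw [Real.norm_eq_abs] at h1
  have h2 : |(m : ℝ) * η r| ≤ m / a * |r * η r| := by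
    rw [abs_mul, abs_mul, abs_of_pos hr0, Nat.abs_cast]
    have : (m : ℝ) / a * (r * |η r|) = m * |η r| * (r / a) := by ring
    rw [this]
    exact le_mul_of_one_le_right (by positivity) ((one_le_div ha).2 hr.1)
  have h3 := mul_le_mul_of_nonneg_right h1 (abs_nonneg (v r))
  rw [← abs_mul] at h3
  have h4 := abs_sub ((lam - q * (K r * (max (u r) 0) ^ (q - 1))) * v r) (m * η r)
  have h5 : 0 ≤ L * |r * η r| := by positivity
  have h6 : 0 ≤ m / a * |v r| := by positivity
  nlinarith

/-- The first radial zero is nondegenerate with respect to the value at the origin. -/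
theorem IsLin.ne_zero (hv : IsLin m K lam q u v η) (hs : IsRad m K lam q u h)
    (hw : IsWeight K y) (hlam : 0 ≤ lam) (hq : 1 < q) (hm : 1 ≤ m) {ρ : ℝ}
    (hρ : ρ ∈ Ioc (0 : ℝ) 1) (hpos : ∀ r ∈ Ico 0 ρ, 0 < u r) (hz : u ρ = 0) : v ρ ≠ 0 := by
  intro hvρ
  have hneg := hs.h_neg hw hlam hq hρ hpos hz
  have hanti := hs.strictAntiOn hw hlam hq hρ hpos hz
  have cv : ContinuousOn v (Icc 0 1) := fun r hr => (hv.dv r hr).continuousAt.continuousWithinAt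
  have cη := hv.cη
  have ch := hs.ch
  have cu := hs.cu
  have cK := hw.cont
  have cuq : Continuous fun r => u r ^ q := cu.rpow_const fun _ => Or.inr (by linarith)
  have db : ∀ r ∈ Ioo 0 ρ, HasDerivAt (fun r => r * h r) (lam * u r - K r * u r ^ q - m * h r) r :=
    fun r hr => by
      have := hs.db ⟨hr.1, hr.2.le.trans hρ.2⟩
      rwa [max_eq_left (hpos r ⟨hr.1.le, hr.2⟩).le] at this
  have dη : ∀ r ∈ Ioo 0 ρ, HasDerivAt (fun r => r * η r)
      ((lam - q * (K r * u r ^ (q - 1))) * v r - m * η r) r := fun r hr => by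
      have := hv.db r ⟨hr.1, hr.2.le.trans hρ.2⟩
      rwa [max_eq_left (hpos r ⟨hr.1.le, hr.2⟩).le] at this
  obtain ⟨n, rfl⟩ := Nat.exists_eq_add_of_le hm
  obtain ⟨τ, hτ, hvτ, hvpos⟩ := exists_first_zero (f := v) (a := 0) (c := ρ)
    (cv.mono (Icc_subset_Icc le_rfl hρ.2)) (by rw [hv.v0]; exact one_pos)
    ⟨ρ, ⟨hρ.1.le, le_rfl⟩, hvρ.le⟩
  have hτρ : τ < ρ := by
    refine lt_of_le_of_ne hτ.2 fun heq => ?_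
    subst heq
    have := strictMonoOn_of_hasDerivAt (f := fun r => r ^ (1 + n) * (r * h r * v r - u r * (r * η r)))
      (f' := fun r => r ^ (1 + n) * v r * ((q - 1) * (K r * u r ^ q))) (a := 0) (c := τ) ?_ ?_ ?_
      ⟨le_rfl, hρ.1.le⟩ ⟨hρ.1.le, le_rfl⟩ hρ.1
    · simp [hvρ, hz] at this
    · have := cv.mono (Icc_subset_Icc le_rfl hρ.2)
      fun_prop
    · intro r hr
      have hr' : r ∈ Icc (0 : ℝ) 1 := ⟨hr.1.le, hr.2.le.trans hρ.2⟩
      refine ((hasDerivAt_pow (1 + n) r).mul (((db r hr).mul (hv.dv r hr')).sub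
        ((hs.du r hr').mul (dη r hr)))).congr_deriv ?_
      simp only [Pi.mul_apply, Pi.sub_apply]
      rw [rpow_sub_one_mul_self hq (hpos r ⟨hr.1.le, hr.2⟩).le]
      push_cast
      rw [Nat.add_sub_cancel_left, pow_add, pow_one]
      ring
    · intro r hr
      have h1 := hvpos r ⟨hr.1.le, hr.2⟩
      have h2 := Real.rpow_pos_of_pos (hpos r ⟨hr.1.le, hr.2⟩) q
      have h3 := hw.pos r
      have h4 := hr.1
      have : 0 < q - 1 := by linarith
      positivity
  have huτ := hpos τ ⟨hτ.1.le, hτρ⟩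
  obtain ⟨α, hα⟩ : ∃ α, α = -(τ * (τ * h τ)) / u τ := ⟨_, rfl⟩
  have hwτ : τ * (τ * h τ) + α * u τ = 0 := by
    rw [hα]
    field_simp
    ring
  set e : ℝ → ℝ := fun r => (α - n) * (r * h r) + r * (lam * u r - K r * u r ^ q) with he
  set Q : ℝ → ℝ := fun r => r ^ (1 + n) * (e r * v r - (r * (r * h r) + α * u r) * (r * η r)) with hQ
  have hQc : ContinuousOn Q (Icc 0 ρ) := by
    have := cv.mono (Icc_subset_Icc le_rfl hρ.2)
    fun_prop
  have hQd : ∀ r ∈ Ioo 0 ρ, HasDerivAt Q (r ^ (1 + n) * v r * (u r *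
      (2 * lam + K r * u r ^ (q - 1) * (α * (q - 1) - 2 + y r)))) r := by
    intro r hr
    have hr' : r ∈ Icc (0 : ℝ) 1 := ⟨hr.1.le, hr.2.le.trans hρ.2⟩
    have hur := hpos r ⟨hr.1.le, hr.2⟩
    have d3 : HasDerivAt (fun r => u r ^ q) (q * u r ^ (q - 1) * (r * h r)) r := by
      have := hs.hasDerivAt_rpow (a := q - 1) hr' hur
      rwa [sub_add_cancel] at this
    have d4 := hw.hasDerivAt r hr.1
    have de := ((db r hr).const_mul (α - n)).add ((hasDerivAt_id r).mul
      (((hs.du r hr').const_mul lam).sub (d4.mul d3)))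
    have dw := ((hasDerivAt_id r).mul (db r hr)).add ((hs.du r hr').const_mul α)
    refine ((hasDerivAt_pow (1 + n) r).mul ((de.mul (hv.dv r hr')).sub
        (dw.mul (dη r hr)))).congr_deriv ?_
    have hr0 := hr.1.ne'
    simp only [id, Pi.mul_apply, Pi.add_apply, Pi.sub_apply]
    rw [rpow_sub_one_mul_self hq hur.le, Nat.add_sub_cancel_left, pow_add, pow_one]
    push_cast
    field_simp
    ring
  have hQτ : Q τ = 0 := by simp [hQ, hvτ, hwτ]
  obtain ⟨ξ, hξ, hQξ⟩ := exists_hasDerivAt_eq_zero (f := Q) hτ.1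
    (hQc.mono (Icc_subset_Icc le_rfl hτρ.le)) (by rw [hQτ]; simp [hQ])
    (fun r hr => hQd r ⟨hr.1, hr.2.trans hτρ⟩)
  have hΦξ : 2 * lam + K ξ * u ξ ^ (q - 1) * (α * (q - 1) - 2 + y ξ) = 0 := by
    have h1 := hvpos ξ ⟨hξ.1.le, hξ.2⟩
    have h2 := hpos ξ ⟨hξ.1.le, hξ.2.trans hτρ⟩
    have h3 := pow_pos hξ.1 (1 + n)
    rcases mul_eq_zero.1 hQξ with h4 | h4
    · exact absurd h4 (mul_pos h3 h1).ne'
    · exact (mul_eq_zero.1 h4).resolve_left h2.ne'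
  have hΦ : ∀ r ∈ Ico ξ ρ, 0 ≤ 2 * lam + K r * u r ^ (q - 1) * (α * (q - 1) - 2 + y r) := by
    intro r hr
    have hr0 := hξ.1.trans_le hr.1
    have hur := hpos r ⟨hr0.le, hr.2⟩
    have hKr := hw.pos r
    have h1 : K r * u r ^ (q - 1) ≤ K ξ * u ξ ^ (q - 1) :=
      mul_le_mul (hw.antitone hξ.1.le hr.1) (Real.rpow_le_rpow hur.le
        (hanti.antitoneOn ⟨hξ.1.le, (hξ.2.trans hτρ).le⟩ ⟨hr0.le, hr.2.le⟩ hr.1) (by linarith))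
        (by positivity) (hw.pos ξ).le
    have h2 := hw.y_mono hξ.1 hr0 hr.1
    have h3 : 0 ≤ K r * u r ^ (q - 1) := by positivity
    rcases le_or_gt 0 (α * (q - 1) - 2 + y r) with h4 | h4
    · positivity
    · nlinarith
  have hητ : η τ < 0 := by
    have h1 := deriv_nonpos_of_pos_left hτ.1 hvτ (fun t ht => hvpos t ⟨ht.1.le, ht.2⟩)
      (hv.dv τ ⟨hτ.1.le, hτ.2.trans hρ.2⟩)
    have h2 := hv.deriv_ne_zero cK cu hq (a := τ / 2) (c := τ) (by linarith [hτ.1])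
      (by linarith [hτ.1]) (hτ.2.trans hρ.2)
      (hvpos _ ⟨by linarith [hτ.1], by linarith [hτ.1]⟩).ne' hvτ
    rcases lt_or_gt_of_ne h2 with h3 | h3
    · exact h3
    · nlinarith [mul_pos hτ.1 h3]
  obtain ⟨τ', hτ', hvneg⟩ : ∃ τ' ∈ Ioc τ ρ, ∀ t ∈ Ioc τ τ', v t < 0 := by
    have h1 := (hasDerivAt_iff_tendsto_slope.1 (hv.dv τ ⟨hτ.1.le, hτ.2.trans hρ.2⟩)).mono_left
      (nhdsWithin_mono τ (fun t (ht : τ < t) => ht.ne'))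
    have h2 := h1.eventually (gt_mem_nhds (mul_neg_of_pos_of_neg hτ.1 hητ))
    obtain ⟨t₁, ht₁, h3⟩ := (mem_nhdsGT_iff_exists_Ioc_subset).1 h2
    refine ⟨min t₁ ρ, ⟨lt_min ht₁ hτρ, min_le_right _ _⟩, fun t ht => ?_⟩
    have h4 : slope v τ t < 0 := h3 ⟨ht.1, ht.2.trans (min_le_left _ _)⟩
    rw [slope_def_field, hvτ, sub_zero] at h4
    by_contra! hcon
    exact absurd h4 (not_lt.2 (div_nonneg hcon (by linarith [ht.1])))
  obtain ⟨σ, hσ, hvσ, hvσneg⟩ := exists_first_zero (f := fun r => -v r) (a := τ') (c := ρ)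
    (cv.mono (Icc_subset_Icc (hτ.1.trans hτ'.1).le hρ.2)).neg
    (by linarith [hvneg τ' ⟨hτ'.1, le_rfl⟩]) ⟨ρ, ⟨hτ'.2, le_rfl⟩, by linarith⟩
  have hvσ' : v σ = 0 := by linarith
  have hτσ : τ < σ := hτ'.1.trans hσ.1
  have hσ0 : 0 < σ := hτ.1.trans hτσ
  have hneg' : ∀ t ∈ Ioo τ σ, v t < 0 := fun t ht => by
    rcases le_or_gt t τ' with h1 | h1
    · exact hvneg t ⟨ht.1, h1⟩
    · linarith [hvσneg t ⟨h1.le, ht.2⟩]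
  have hησ : 0 < η σ := by
    have h1 := deriv_nonpos_of_pos_left hσ.1 hvσ (fun t ht => hvσneg t ⟨ht.1.le, ht.2⟩)
      (hv.dv σ ⟨hσ0.le, hσ.2.trans hρ.2⟩).neg
    have h2 := hv.deriv_ne_zero cK cu hq (a := τ') (c := σ) (hτ.1.trans hτ'.1)
      hσ.1 (hσ.2.trans hρ.2) (hvneg _ ⟨hτ'.1, le_rfl⟩).ne hvσ'
    rcases lt_or_gt_of_ne h2 with h3 | h3
    · nlinarith [mul_neg_of_pos_of_neg hσ0 h3]
    · exact h3
  have hQanti := antitoneOn_of_hasDerivAt (f := Q) (a := τ) (c := σ)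
    (hQc.mono (Icc_subset_Icc hτ.1.le hσ.2))
    (fun r hr => hQd r ⟨hτ.1.trans hr.1, hr.2.trans_le hσ.2⟩) (fun r hr => by
      have h0 := hτ.1.trans hr.1
      have h1 := hneg' r hr
      have h2 := hpos r ⟨h0.le, hr.2.trans_le hσ.2⟩
      have h3 := hΦ r ⟨(hξ.2.trans hr.1).le, hr.2.trans_le hσ.2⟩
      exact mul_nonpos_of_nonpos_of_nonneg (mul_neg_of_pos_of_neg (by positivity) h1).le
        (by positivity))
  have hQσ := hQanti ⟨le_rfl, hτσ.le⟩ ⟨hτσ.le, le_rfl⟩ hτσ.le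
  have hwσ : σ * (σ * h σ) + α * u σ < 0 := by
    rcases eq_or_lt_of_le hσ.2 with h1 | h1
    · rw [h1, hz, mul_zero, add_zero]
      have := hneg ρ ⟨hρ.1.le, le_rfl⟩
      exact mul_neg_of_pos_of_neg hρ.1 (mul_neg_of_pos_of_neg hρ.1 this)
    · have h2 := hs.slope_strictMono hw hlam hq (by omega) hρ hpos hz hτ.1 hτσ h1
      rw [← hα, lt_div_iff₀ (hpos σ ⟨hσ0.le, h1⟩)] at h2
      linarith
  rw [hQτ] at hQσ
  simp only [hQ, hvσ', mul_zero, zero_sub] at hQσ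
  have h1 := mul_neg_of_neg_of_pos hwσ (mul_pos hσ0 hησ)
  have h2 := mul_pos (pow_pos hσ0 (1 + n)) (neg_pos.2 h1)
  linarith

end Linearized

section Shooting

variable {m : ℕ} {K y : ℝ → ℝ} {lam q : ℝ} {u h : ℝ → ℝ}

lemma IsRad.hasDerivAt_pow_mul (hs : IsRad m K lam q u h) (a : ℝ) {r : ℝ}
    (hr : r ∈ Ioc (0 : ℝ) 1) : HasDerivAt (fun r => r ^ (m + 1) * (h r + a))
      (r ^ m * (lam * u r - K r * (max (u r) 0) ^ q + (m + 1) * a)) r := by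
  refine ((hasDerivAt_pow (m + 1) r).mul ((hs.dh r hr).add_const a)).congr_deriv ?_
  have := hr.1.ne'
  rw [Nat.add_sub_cancel, pow_succ]
  push_cast
  field_simp
  ring

lemma IsRad.lower_bound (hs : IsRad m K lam q u h) (hw : IsWeight K y) (hlam : 0 ≤ lam)
    (hq : 1 < q) {ρ d : ℝ} (hρ : ρ ∈ Icc (0 : ℝ) 1) (hd : u 0 = d)
    (hu : ∀ r ∈ Icc 0 ρ, u r ∈ Icc 0 d) : d - d ^ q * ρ ^ 2 / (2 * (m + 1)) ≤ u ρ := by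
  have hm : (0 : ℝ) < m + 1 := by positivity
  have cu := hs.cu
  have ch := hs.ch
  have hF := monotoneOn_of_hasDerivAt (f := fun r => r ^ (m + 1) * (h r + d ^ q / (m + 1)))
    (a := 0) (c := ρ) (by fun_prop)
    (fun r hr => hs.hasDerivAt_pow_mul _ ⟨hr.1, hr.2.le.trans hρ.2⟩) (fun r hr => by
      have h1 := hu r ⟨hr.1.le, hr.2.le⟩
      rw [max_eq_left h1.1, mul_div_cancel₀ _ hm.ne']
      have h2 : K r * u r ^ q ≤ 1 * d ^ q := mul_le_mul (hw.le_one r)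
        (Real.rpow_le_rpow h1.1 h1.2 (by linarith)) (Real.rpow_nonneg h1.1 _) zero_le_one
      have h3 := mul_nonneg hlam h1.1
      have h4 := pow_pos hr.1 m
      exact mul_nonneg h4.le (by linarith))
  have hG := monotoneOn_of_hasDerivAt (f := fun r => u r + d ^ q * r ^ 2 / (2 * (m + 1)))
    (f' := fun r => r * h r + d ^ q * (2 * r) / (2 * (m + 1)))
    (a := 0) (c := ρ) (by fun_prop)
    (fun r hr => by
      refine ((hs.du r ⟨hr.1.le, hr.2.le.trans hρ.2⟩).add
        (((hasDerivAt_pow 2 r).const_mul (d ^ q)).div_const (2 * ((m : ℝ) + 1)))).congr_deriv ?_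
      simp) (fun r hr => by
      have h1 := hF ⟨le_rfl, hr.1.le.trans hr.2.le⟩ ⟨hr.1.le, hr.2.le⟩ hr.1.le
      simp only [ne_eq, Nat.add_eq_zero_iff, one_ne_zero, and_false, not_false_eq_true,
        zero_pow, zero_mul] at h1
      have h2 := nonneg_of_mul_nonneg_right h1 (pow_pos hr.1 (m + 1))
      have h3 : r * h r + d ^ q * (2 * r) / (2 * (m + 1)) = r * (h r + d ^ q / (m + 1)) := by
        field_simp
      rw [h3]
      exact mul_nonneg hr.1.le h2)
  have := hG ⟨le_rfl, hρ.1⟩ ⟨hρ.1, le_rfl⟩ hρ.1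
  simp only [hd] at this
  norm_num at this
  linarith

/-- Radial solutions with small value at the origin have no zero in `[0,1]`. -/
lemma IsRad.one_lt_of_zero (hs : IsRad m K lam q u h) (hw : IsWeight K y) (hlam : 0 ≤ lam)
    (hq : 1 < q) {ρ : ℝ} (hρ : ρ ∈ Ioc (0 : ℝ) 1) (hpos : ∀ r ∈ Ico 0 ρ, 0 < u r)
    (hz : u ρ = 0) : 1 < u 0 := by
  have hanti := hs.strictAntiOn hw hlam hq hρ hpos hz
  have hu0 := hpos 0 ⟨le_rfl, hρ.1⟩
  have h1 := hs.lower_bound hw hlam hq ⟨hρ.1.le, hρ.2⟩ rfl (fun r hr =>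
    ⟨hz ▸ hanti.antitoneOn hr ⟨hρ.1.le, le_rfl⟩ hr.2,
      hanti.antitoneOn ⟨le_rfl, hρ.1.le⟩ hr hr.1⟩)
  by_contra! hcon
  rw [hz] at h1
  have h2 : u 0 ^ q ≤ u 0 := by
    simpa using Real.rpow_le_rpow_of_exponent_ge hu0 hcon hq.le
  have h3 : ρ ^ 2 ≤ 1 := pow_le_one₀ hρ.1.le hρ.2
  have h4 : u 0 ^ q * ρ ^ 2 ≤ u 0 := by
    have := mul_le_mul h2 h3 (sq_nonneg ρ) hu0.le
    linarith
  have h5 : u 0 ^ q * ρ ^ 2 / (2 * (m + 1)) ≤ u 0 / 2 := by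
    rw [div_le_div_iff₀ (by positivity) (by norm_num)]
    have : (0 : ℝ) ≤ m := by positivity
    nlinarith
  linarith

set_option maxHeartbeats 1600000 in
/-- Radial solutions with large value at the origin vanish somewhere in `[0,1]`. -/
theorem eventually_exists_zero (hw : IsWeight K y) (hlam : 0 ≤ lam) (hq : 1 < q) (hm : 1 ≤ m)
    (hsub : ((m : ℝ) - 1) * (q + 1) < 2 * (m + 1)) :
    ∀ᶠ d in atTop, ∀ u h : ℝ → ℝ, IsRad m K lam q u h → u 0 = d → ∃ r ∈ Icc (0 : ℝ) 1, u r ≤ 0 := by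
  obtain ⟨K1, hK1⟩ : ∃ K1, K1 = K 1 := ⟨_, rfl⟩
  have hK1pos : 0 < K1 := hK1 ▸ hw.pos 1
  have hKge : ∀ r ∈ Icc (0 : ℝ) 1, K1 ≤ K r := fun r hr => hK1 ▸ hw.antitone hr.1 hr.2
  obtain ⟨c0, hc0⟩ : ∃ c0 : ℝ, c0 = ((m : ℝ) + 1) / (q + 1) - (m - 1) / 2 := ⟨_, rfl⟩
  have hc0pos : 0 < c0 := by
    rw [hc0, sub_pos, div_lt_div_iff₀ (by norm_num) (by linarith)]
    linarith
  have hm0 : (0 : ℝ) ≤ m := by positivity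
  have hm1 : (1 : ℝ) ≤ m := by exact_mod_cast hm
  have hq1 : 0 < q + 1 := by linarith
  obtain ⟨r0, hr0, hr0', hy⟩ : ∃ r0, 0 < r0 ∧ r0 ≤ 1 / 2 ∧ ∀ r ∈ Ioc 0 r0, y r ≤ c0 * (q + 1) / 2 := by
    have h1 := hw.y_zero.eventually (gt_mem_nhds (show (0 : ℝ) < c0 * (q + 1) / 2 by positivity))
    obtain ⟨t, ht, h3⟩ := (mem_nhdsGT_iff_exists_Ioc_subset).1 h1
    exact ⟨min t (1 / 2), lt_min ht (by norm_num), min_le_right _ _, fun r hr =>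
      (h3 ⟨hr.1, hr.2.trans (min_le_left _ _)⟩).le⟩
  obtain ⟨c, hc⟩ : ∃ c : ℝ, c = K1 / (2 * (m + 1)) := ⟨_, rfl⟩
  have hcpos : 0 < c := by rw [hc]; positivity
  have hq' : 0 < q - 1 := by linarith
  obtain ⟨M, hM0, hM1, hM2, hM3⟩ : ∃ M : ℝ, 0 < M ∧ 2 * lam ≤ K1 * M ^ (q - 1) ∧
      lam ≤ c0 / 4 * K1 * M ^ (q - 1) ∧ 2 / ((q - 1) * c * r0 ^ 2) < M ^ (q - 1) := by
    have ht := tendsto_rpow_atTop hq'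
    obtain ⟨M, h1, h2, h3, h4⟩ := ((eventually_gt_atTop 0).and
      ((ht.eventually_ge_atTop (2 * lam / K1)).and
      ((ht.eventually_ge_atTop (lam / (c0 / 4 * K1))).and
      (ht.eventually_gt_atTop (2 / ((q - 1) * c * r0 ^ 2)))))).exists
    rw [div_le_iff₀ (by positivity)] at h2 h3
    exact ⟨M, h1, by linarith, by linarith, h4⟩
  obtain ⟨E, hE⟩ : ∃ E : ℝ, E = q + 1 + (1 - q) / 2 * (m + 1) := ⟨_, rfl⟩
  have hEpos : 0 < E := by rw [hE]; nlinarith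
  obtain ⟨C, hC⟩ : ∃ C : ℝ, C = c0 / 4 * K1 * ((1 / 2) ^ (q + 1) / (m + 1)) := ⟨_, rfl⟩
  have hCpos : 0 < C := by rw [hC]; positivity
  obtain ⟨S, hS⟩ : ∃ S : ℝ, S = 2 ^ m * (M + lam * M) + 1 := ⟨_, rfl⟩
  filter_upwards [eventually_gt_atTop (2 * M), eventually_gt_atTop 1,
    ((tendsto_rpow_atTop hEpos).const_mul_atTop hCpos).eventually_ge_atTop
      (S ^ 2 / 2 + M ^ (q + 1))] with d hdM hd1 hdE u h hs hud
  by_contra! hupos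
  have cu := hs.cu
  have ch := hs.ch
  have hd0 : 0 < d := by linarith
  have hpw : ∀ r, M ≤ u r → M ^ (q - 1) ≤ u r ^ (q - 1) := fun r hr =>
    Real.rpow_le_rpow hM0.le hr hq'.le
  -- the source term while `u` stays large
  have hg : ∀ r ∈ Icc (0 : ℝ) 1, M ≤ u r →
      lam * u r - K r * (max (u r) 0) ^ q ≤ -(K1 / 2) * u r ^ q := by
    intro r hr hMu
    have hur := hupos r hr
    rw [max_eq_left hur.le, rpow_sub_one_mul_self hq hur.le]
    have h1 := hpw r hMu
    have h2 := hKge r hr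
    have h3 : 0 < u r ^ (q - 1) := Real.rpow_pos_of_pos hur _
    have h4 := mul_le_mul_of_nonneg_left h1 hK1pos.le
    have h5 := mul_le_mul_of_nonneg_right h2 h3.le
    linarith [mul_le_mul_of_nonneg_right (hM1.trans h4) hur.le, mul_le_mul_of_nonneg_right h5 hur.le]
  have hlarge : ∀ ρ ∈ Icc (0 : ℝ) 1, (∀ r ∈ Icc 0 ρ, M ≤ u r) → AntitoneOn u (Icc 0 ρ) := by
    intro ρ hρ hMu
    have hF := antitoneOn_of_hasDerivAt (f := fun r => r ^ (m + 1) * (h r + 0))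
      (a := 0) (c := ρ) (by fun_prop)
      (fun r hr => hs.hasDerivAt_pow_mul _ ⟨hr.1, hr.2.le.trans hρ.2⟩) (fun r hr => by
        have hr' : r ∈ Icc (0 : ℝ) 1 := ⟨hr.1.le, hr.2.le.trans hρ.2⟩
        have h1 := hg r hr' (hMu r ⟨hr.1.le, hr.2.le⟩)
        have h2 := Real.rpow_pos_of_pos (hupos r hr') q
        have h3 := mul_pos hK1pos h2
        exact mul_nonpos_of_nonneg_of_nonpos (pow_pos hr.1 m).le (by linarith))
    refine antitoneOn_of_hasDerivAt (f' := fun r => r * h r) cu.continuousOn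
      (fun r hr => hs.du r ⟨hr.1.le, hr.2.le.trans hρ.2⟩) (fun r hr => ?_)
    have h1 := hF ⟨le_rfl, hρ.1⟩ ⟨hr.1.le, hr.2.le⟩ hr.1.le
    simp only [ne_eq, Nat.add_eq_zero_iff, one_ne_zero, and_false, not_false_eq_true,
      zero_pow, zero_mul, add_zero] at h1
    have h2 := pow_pos hr.1 (m + 1)
    have h3 : h r ≤ 0 := by
      by_contra! h4
      exact absurd h1 (not_le.2 (mul_pos h2 h4))
    exact mul_nonpos_of_nonneg_of_nonpos hr.1.le h3
  have hhle : ∀ ρ ∈ Ioc (0 : ℝ) 1, (∀ r ∈ Icc 0 ρ, M ≤ u r) → h ρ ≤ -(c * u ρ ^ q) := by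
    intro ρ hρ hMu
    have hanti := hlarge ρ ⟨hρ.1.le, hρ.2⟩ hMu
    have huρ := hupos ρ ⟨hρ.1.le, hρ.2⟩
    have hF := antitoneOn_of_hasDerivAt (f := fun r => r ^ (m + 1) * (h r + c * u ρ ^ q))
      (a := 0) (c := ρ) (by fun_prop)
      (fun r hr => hs.hasDerivAt_pow_mul _ ⟨hr.1, hr.2.le.trans hρ.2⟩) (fun r hr => by
        have hr' : r ∈ Icc (0 : ℝ) 1 := ⟨hr.1.le, hr.2.le.trans hρ.2⟩
        have h1 := hg r hr' (hMu r ⟨hr.1.le, hr.2.le⟩)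
        have h2 := Real.rpow_le_rpow huρ.le (hanti ⟨hr.1.le, hr.2.le⟩ ⟨hρ.1.le, le_rfl⟩ hr.2.le)
          (show 0 ≤ q by linarith)
        have h3 : ((m : ℝ) + 1) * (c * u ρ ^ q) = K1 / 2 * u ρ ^ q := by
          rw [hc]; field_simp
        rw [h3]
        refine mul_nonpos_of_nonneg_of_nonpos (pow_pos hr.1 m).le ?_
        linarith [mul_le_mul_of_nonneg_left h2 hK1pos.le])
    have h1 := hF ⟨le_rfl, hρ.1.le⟩ ⟨hρ.1.le, le_rfl⟩ hρ.1.le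
    simp only [ne_eq, Nat.add_eq_zero_iff, one_ne_zero, and_false, not_false_eq_true,
      zero_pow, zero_mul] at h1
    have h2 := pow_pos hρ.1 (m + 1)
    by_contra! h4
    exact absurd h1 (not_le.2 (mul_pos h2 (by linarith)))
  obtain ⟨r1, hr1, hur1, hMlt⟩ := exists_first_zero (f := fun r => u r - M) (a := 0) (c := r0)
    (by fun_prop) (by rw [hud]; linarith) (by
      by_contra! hcon
      have hMu : ∀ r ∈ Icc 0 r0, M ≤ u r := fun r hr => by linarith [hcon r hr]
      have hup : ∀ r ∈ Icc 0 r0, 0 < u r := fun r hr => hM0.trans_le (hMu r hr)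
      have hG := monotoneOn_of_hasDerivAt
        (f := fun r => u r ^ (1 - q) - (q - 1) * c * r ^ 2 / 2)
        (f' := fun r => (1 - q) * u r ^ (-q) * (r * h r) - (q - 1) * c * (2 * r) / 2)
        (a := 0) (c := r0) (ContinuousOn.sub
          (cu.continuousOn.rpow_const fun r hr => Or.inl (hup r hr).ne') (by fun_prop))
        (fun r hr => by
          have h1 := hs.hasDerivAt_rpow (a := -q) (r := r) ⟨hr.1.le, by linarith [hr.2]⟩
            (hup r ⟨hr.1.le, hr.2.le⟩)
          have h2 := ((hasDerivAt_pow 2 r).const_mul ((q - 1) * c)).div_const 2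
          rw [show -q + 1 = 1 - q by ring] at h1
          refine (h1.sub h2).congr_deriv ?_
          simp)
        (fun r hr => by
          have h1 := hhle r ⟨hr.1, by linarith [hr.2]⟩
            (fun t ht => hMu t ⟨ht.1, ht.2.trans hr.2.le⟩)
          have h2 := Real.rpow_pos_of_pos (hup r ⟨hr.1.le, hr.2.le⟩) (-q)
          have h3 : u r ^ (-q) * u r ^ q = 1 := by
            rw [← Real.rpow_add (hup r ⟨hr.1.le, hr.2.le⟩)]; simp
          have h4 : u r ^ (-q) * h r ≤ -c := by
            refine (mul_le_mul_of_nonneg_left h1 h2.le).trans (le_of_eq ?_)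
            linear_combination (-c) * h3
          have h5 := mul_pos hq' hr.1
          linarith [mul_le_mul_of_nonneg_left h4 h5.le])
      have h1 := hG ⟨le_rfl, hr0.le⟩ ⟨hr0.le, le_rfl⟩ hr0.le
      simp only [hud] at h1
      have h2 : 0 < d ^ (1 - q) := Real.rpow_pos_of_pos hd0 _
      have h3 : u r0 ^ (1 - q) ≤ M ^ (1 - q) := Real.rpow_le_rpow_of_nonpos hM0
        (hMu r0 ⟨hr0.le, le_rfl⟩) (by linarith)
      have h4 : M ^ (1 - q) * M ^ (q - 1) = 1 := by
        rw [← Real.rpow_add hM0]; simp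
      have h5 : 0 < M ^ (q - 1) := Real.rpow_pos_of_pos hM0 _
      rw [div_lt_iff₀ (by positivity)] at hM3
      norm_num at h1
      have h6 : (q - 1) * c * r0 ^ 2 / 2 ≤ M ^ (1 - q) := by linarith
      have h7 := mul_le_mul_of_nonneg_right h6 h5.le
      rw [h4] at h7
      linarith)
  have hr1' : r1 ∈ Ioc (0 : ℝ) 1 := ⟨hr1.1, by linarith [hr1.2]⟩
  have huM : u r1 = M := by linarith
  have hMu : ∀ r ∈ Icc 0 r1, M ≤ u r := fun r hr => by
    rcases eq_or_lt_of_le hr.2 with h1 | h1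
    · rw [h1, huM]
    · linarith [hMlt r ⟨hr.1, h1⟩]
  have hanti := hlarge r1 ⟨hr1.1.le, hr1'.2⟩ hMu
  have hud' : ∀ r ∈ Icc 0 r1, u r ∈ Icc 0 d := fun r hr => ⟨hM0.le.trans (hMu r hr),
    hud ▸ hanti ⟨le_rfl, hr1.1.le⟩ hr hr.1⟩
  -- growth of the Pohozaev function
  obtain ⟨rd, hrd⟩ : ∃ rd : ℝ, rd = d ^ ((1 - q) / 2) := ⟨_, rfl⟩
  have hrd0 : 0 < rd := hrd ▸ Real.rpow_pos_of_pos hd0 _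
  have hrd2 : rd ^ 2 * d ^ q = d := by
    rw [hrd, ← Real.rpow_natCast, ← Real.rpow_mul hd0.le, ← Real.rpow_add hd0]
    conv_rhs => rw [← Real.rpow_one d]
    congr 1
    push_cast
    ring
  have hhalf : ∀ r ∈ Icc 0 r1, r ≤ rd → d / 2 ≤ u r := by
    intro r hr hrrd
    have h1 := hs.lower_bound hw hlam hq ⟨hr.1, hr.2.trans hr1'.2⟩ hud
      (fun t ht => hud' t ⟨ht.1, ht.2.trans hr.2⟩)
    have h2 : d ^ q * r ^ 2 ≤ d := by
      have h3 := pow_le_pow_left₀ hr.1 hrrd 2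
      have h4 := Real.rpow_pos_of_pos hd0 q
      linarith [mul_le_mul_of_nonneg_left h3 h4.le]
    have h5 : d ^ q * r ^ 2 / (2 * (m + 1)) ≤ d / 2 := by
      rw [div_le_div_iff₀ (by positivity) (by norm_num)]
      linarith [mul_nonneg hm0 hd0.le]
    linarith
  have hrdr1 : rd < r1 := by
    by_contra! hcon
    have := hhalf r1 ⟨hr1.1.le, le_rfl⟩ hcon
    linarith
  have cP := hs.continuous_pohozaev hw hq
  have dP : ∀ r ∈ Ioo 0 r1, HasDerivAt (pohozaev m K lam q u h) (r ^ m * u r ^ 2 *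
      (((m + 1 - y r) / (q + 1) - (m - 1) / 2) * (K r * u r ^ (q - 1)) - lam)) r := fun r hr =>
    hs.hasDerivAt_pohozaev hw hq hm ⟨hr.1, hr.2.le.trans hr1'.2⟩
      (hM0.trans_le (hMu r ⟨hr.1.le, hr.2.le⟩))
  have hP : ∀ r ∈ Ioo 0 r1, c0 / 4 * K1 * (r ^ m * u r ^ (q + 1)) ≤ r ^ m * u r ^ 2 *
      (((m + 1 - y r) / (q + 1) - (m - 1) / 2) * (K r * u r ^ (q - 1)) - lam) := by
    intro r hr
    have hMr := hMu r ⟨hr.1.le, hr.2.le⟩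
    have hur := hM0.trans_le hMr
    rw [rpow_add_one_eq hq hur.le]
    have h1 : c0 / 2 ≤ (m + 1 - y r) / (q + 1) - (m - 1) / 2 := by
      have h2 := hy r ⟨hr.1, hr.2.le.trans hr1.2⟩
      have h3 : y r / (q + 1) ≤ c0 / 2 := by
        rw [div_le_iff₀ hq1]; linarith
      rw [sub_div]
      linarith
    have h4 := hKge r ⟨hr.1.le, hr.2.le.trans hr1'.2⟩
    have h5 := hpw r hMr
    have h6 : 0 < u r ^ (q - 1) := Real.rpow_pos_of_pos hur _
    have h7 : K1 * u r ^ (q - 1) ≤ K r * u r ^ (q - 1) := mul_le_mul_of_nonneg_right h4 h6.le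
    have h8 := mul_le_mul h1 h7 (by positivity) (by linarith)
    have h9 : lam ≤ c0 / 4 * K1 * u r ^ (q - 1) :=
      hM2.trans (mul_le_mul_of_nonneg_left h5 (by positivity))
    have h10 : 0 ≤ r ^ m * u r ^ 2 := by
      have := hr.1
      positivity
    have h11 := mul_le_mul_of_nonneg_left (show c0 / 4 * K1 * u r ^ (q - 1) ≤
      ((m + 1 - y r) / (q + 1) - (m - 1) / 2) * (K r * u r ^ (q - 1)) - lam by linarith) h10
    linarith
  have hPmono := monotoneOn_of_hasDerivAt (a := 0) (c := r1) cP.continuousOn dP (fun r hr =>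
    le_trans (by
      have := hr.1
      have := hM0.trans_le (hMu r ⟨hr.1.le, hr.2.le⟩)
      positivity) (hP r hr))
  have hPrd : C * d ^ E ≤ pohozaev m K lam q u h rd := by
    have hQ := monotoneOn_of_hasDerivAt (f := fun r => pohozaev m K lam q u h r -
        c0 / 4 * K1 * (d / 2) ^ (q + 1) * r ^ (m + 1) / (m + 1))
      (f' := fun r => r ^ m * u r ^ 2 *
        (((m + 1 - y r) / (q + 1) - (m - 1) / 2) * (K r * u r ^ (q - 1)) - lam) -
        c0 / 4 * K1 * (d / 2) ^ (q + 1) * r ^ m) (a := 0) (c := rd) (by fun_prop)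
      (fun r hr => by
        refine ((dP r ⟨hr.1, hr.2.trans hrdr1⟩).sub (((hasDerivAt_pow (m + 1) r).const_mul
          (c0 / 4 * K1 * (d / 2) ^ (q + 1))).div_const ((m : ℝ) + 1))).congr_deriv ?_
        rw [Nat.add_sub_cancel]
        push_cast
        field_simp)
      (fun r hr => by
        have hrI : r ∈ Ioo 0 r1 := ⟨hr.1, hr.2.trans hrdr1⟩
        have h1 := hP r hrI
        have h2 := hhalf r ⟨hr.1.le, hrI.2.le⟩ hr.2.le
        have h3 := Real.rpow_le_rpow (by positivity) h2 hq1.le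
        have h4 := pow_pos hr.1 m
        have h5 : 0 < c0 / 4 * K1 * r ^ m := by positivity
        linarith [mul_le_mul_of_nonneg_left h3 h5.le])
    have h1 := hQ ⟨le_rfl, hrd0.le⟩ ⟨hrd0.le, le_rfl⟩ hrd0.le
    have h2 : pohozaev m K lam q u h 0 = 0 := by simp [pohozaev]
    have h3 : c0 / 4 * K1 * (d / 2) ^ (q + 1) * rd ^ (m + 1) / (m + 1) = C * d ^ E := by
      rw [hC, hE, Real.rpow_add hd0, hrd, ← Real.rpow_natCast, ← Real.rpow_mul hd0.le,
        div_eq_mul_one_div d 2, Real.mul_rpow hd0.le (by norm_num)]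
      push_cast
      ring
    simp only [h2, h3, ne_eq, Nat.add_eq_zero_iff, one_ne_zero, and_false, not_false_eq_true,
      zero_pow, mul_zero, zero_div, sub_zero] at h1
    linarith
  have hPr1 : S ^ 2 / 2 + M ^ (q + 1) ≤ pohozaev m K lam q u h r1 :=
    (hdE.trans hPrd).trans (hPmono ⟨hrd0.le, hrdr1.le⟩ ⟨hr1.1.le, le_rfl⟩ hrdr1.le)
  have hS0 : 0 < S := by rw [hS]; positivity
  have hb1 : r1 * h r1 < 0 := by
    have h1 := hhle r1 hr1' hMu
    have h2 : 0 < c * u r1 ^ q := mul_pos hcpos (Real.rpow_pos_of_pos (huM ▸ hM0) _)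
    exact mul_neg_of_pos_of_neg hr1.1 (by linarith)
  have hSle : S ≤ -(r1 * (r1 * h r1)) := by
    by_contra! hcon
    have hmid : pohozaev m K lam q u h r1 ≤ (r1 * (r1 * h r1)) ^ 2 / 2 + M ^ (q + 1) := by
      have hMq : 0 < M ^ (q + 1) := Real.rpow_pos_of_pos hM0 _
      have h1 : K r1 * M ^ (q + 1) / (q + 1) ≤ M ^ (q + 1) := by
        rw [div_le_iff₀ hq1]
        linarith [mul_le_mul_of_nonneg_right (hw.le_one r1) hMq.le,
          mul_pos hMq (show 0 < q by linarith)]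
      have h2 : r1 ^ (m + 1) ≤ r1 ^ 2 := pow_le_pow_of_le_one hr1.1.le hr1'.2 (by omega)
      have h3 : r1 ^ (m + 1) ≤ 1 := pow_le_one₀ hr1.1.le hr1'.2
      have h4 : ((m : ℝ) - 1) / 2 * (r1 ^ m * M * (r1 * h r1)) ≤ 0 :=
        mul_nonpos_of_nonneg_of_nonpos (by linarith)
          (mul_nonpos_of_nonneg_of_nonpos (by have := hr1.1; positivity) hb1.le)
      have h5 : 0 < r1 ^ (m + 1) := pow_pos hr1.1 _
      have h6 := mul_le_mul_of_nonneg_right h2 (sq_nonneg (r1 * h r1))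
      have h7 : r1 ^ (m + 1) * (K r1 * M ^ (q + 1) / (q + 1)) ≤ 1 * M ^ (q + 1) :=
        mul_le_mul h3 h1 (by have := hw.pos r1; positivity) zero_le_one
      have h8 : 0 ≤ r1 ^ (m + 1) * (lam * M ^ 2 / 2) := by positivity
      unfold pohozaev
      rw [huM]
      linarith
    have hneg : r1 * (r1 * h r1) < 0 := mul_neg_of_pos_of_neg hr1.1 hb1
    linarith [pow_lt_pow_left₀ hcon (by linarith) two_ne_zero]
  -- the large slope at `r1` forces a zero before `2 * r1`
  have h2r1 : 2 * r1 ≤ 1 := by linarith [hr1.2]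
  have hstep : ∀ x ∈ Icc r1 (2 * r1), (∀ r ∈ Icc r1 x, u r ≤ M) → x * h x < -(M / r1) := by
    intro x hx hle
    have hx0 := hr1.1.trans_le hx.1
    have hF := antitoneOn_of_hasDerivAt
      (f := fun r => r ^ (m + 1) * (h r + 0) - (2 * r1) ^ m * (lam * M) * r)
      (f' := fun r => r ^ m * (lam * u r - K r * (max (u r) 0) ^ q + (m + 1) * 0) -
        (2 * r1) ^ m * (lam * M))
      (a := r1) (c := x) (by fun_prop)
      (fun r hr => by
        refine ((hs.hasDerivAt_pow_mul 0 ⟨hr1.1.trans hr.1, by linarith [hr.2, hx.2]⟩).sub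
          ((hasDerivAt_id r).const_mul ((2 * r1) ^ m * (lam * M)))).congr_deriv ?_
        simp)
      (fun r hr => by
        have hr0 := hr1.1.trans hr.1
        have h1 := hle r ⟨hr.1.le, hr.2.le⟩
        have h2 : r ^ m ≤ (2 * r1) ^ m := pow_le_pow_left₀ hr0.le (by linarith [hr.2, hx.2]) m
        have h3 : 0 ≤ K r * (max (u r) 0) ^ q :=
          mul_nonneg (hw.pos r).le (Real.rpow_nonneg (le_max_right _ _) _)
        have h4 := mul_le_mul_of_nonneg_left h1 hlam
        have h5 := pow_pos hr0 m
        have h6 : 0 ≤ lam * M := by positivity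
        linarith [mul_le_mul_of_nonneg_left h4 h5.le, mul_nonneg h5.le h3,
          mul_le_mul_of_nonneg_right h2 h6])
    have h1 := hF ⟨le_rfl, hx.1⟩ ⟨hx.1, le_rfl⟩ hx.1
    simp only [add_zero] at h1
    have hpx := pow_pos hx0 m
    have hp1 := pow_pos hr1.1 m
    have h2 : (2 * r1) ^ m * (lam * M) * (x - r1) ≤ r1 ^ m * (2 ^ m * (lam * M)) / r1 := by
      rw [mul_pow, le_div_iff₀ hr1.1]
      have h3 : (x - r1) * r1 ≤ 1 :=
        mul_le_one₀ (by linarith [hx.2]) hr1.1.le hr1'.2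
      have h4 : 0 ≤ 2 ^ m * r1 ^ m * (lam * M) := by positivity
      linarith [mul_le_mul_of_nonneg_left h3 h4]
    have h3 : r1 ^ (m + 1) * h r1 ≤ -(r1 ^ m * S / r1) := by
      rw [le_neg, div_le_iff₀ hr1.1, pow_succ]
      linarith [mul_le_mul_of_nonneg_left hSle hp1.le]
    have h4 : x ^ m * M ≤ 2 ^ m * M * r1 ^ m := by
      have := pow_le_pow_left₀ hx0.le hx.2 m
      rw [mul_pow] at this
      linarith [mul_le_mul_of_nonneg_right this hM0.le]
    have h5 : x ^ (m + 1) * h x ≤ -(r1 ^ m * (2 ^ m * M + 1) / r1) := by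
      have h6 : r1 ^ m * (2 ^ m * (lam * M)) / r1 - r1 ^ m * S / r1 =
          -(r1 ^ m * (2 ^ m * M + 1) / r1) := by
        rw [hS]; ring
      linarith
    have h7 : x ^ m * (x * h x + M / r1) < 0 := by
      have h8 : x ^ m * (x * h x + M / r1) = x ^ (m + 1) * h x + x ^ m * M / r1 := by ring
      have h9 : x ^ m * M / r1 < r1 ^ m * (2 ^ m * M + 1) / r1 := by
        rw [div_lt_div_iff_of_pos_right hr1.1]
        linarith
      rw [h8]
      linarith
    by_contra! hcon
    exact absurd h7 (not_lt.2 (mul_nonneg hpx.le (by linarith)))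
  have huanti : ∀ x ∈ Icc r1 (2 * r1), (∀ r ∈ Ico r1 x, r * h r < 0) → ∀ r ∈ Icc r1 x, u r ≤ M := by
    intro x hx hneg r hr
    have := antitoneOn_of_hasDerivAt (f := u) (f' := fun r => r * h r) (a := r1) (c := x)
      cu.continuousOn
      (fun r hr => hs.du r ⟨(hr1.1.trans hr.1).le, by linarith [hr.2, hx.2]⟩)
      (fun r hr => (hneg r ⟨hr.1.le, hr.2⟩).le)
    exact huM ▸ this ⟨le_rfl, hx.1⟩ hr hr.1
  have hbneg : ∀ x ∈ Icc r1 (2 * r1), x * h x < 0 := by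
    by_contra! hcon
    obtain ⟨x1, hx1, hx2⟩ := hcon
    obtain ⟨x, hx, hx0, hxneg⟩ := exists_first_zero (f := fun r => -(r * h r)) (a := r1)
      (c := 2 * r1) (by fun_prop) (by linarith) ⟨x1, hx1, by linarith⟩
    have h1 := hstep x ⟨hx.1.le, hx.2⟩ (huanti x ⟨hx.1.le, hx.2⟩
      (fun r hr => by linarith [hxneg r hr]))
    have h2 : 0 < M / r1 := div_pos hM0 hr1.1
    linarith
  have hr2 : r1 ≤ 2 * r1 := by linarith [hr1.1]
  have hule := huanti (2 * r1) ⟨hr2, le_rfl⟩ (fun r hr => hbneg r ⟨hr.1, hr.2.le⟩)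
  have hfin := antitoneOn_of_hasDerivAt (f := fun r => u r + M / r1 * r)
    (f' := fun r => r * h r + M / r1) (a := r1) (c := 2 * r1) (by fun_prop)
    (fun r hr => by
      refine ((hs.du r ⟨(hr1.1.trans hr.1).le, hr.2.le.trans h2r1⟩).add
        ((hasDerivAt_id r).const_mul (M / r1))).congr_deriv ?_
      simp)
    (fun r hr => by
      have := hstep r ⟨hr.1.le, hr.2.le⟩ (fun t ht => hule t ⟨ht.1, ht.2.trans hr.2.le⟩)
      linarith)
  have h1 := hfin ⟨le_rfl, hr2⟩ ⟨hr2, le_rfl⟩ hr2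
  have h2 := hupos (2 * r1) ⟨by linarith [hr1.1], h2r1⟩
  have h3 : M / r1 * r1 = M := div_mul_cancel₀ _ hr1.1.ne'
  simp only [huM] at h1
  linarith

end Shooting

section Flow

variable {m : ℕ} {K y : ℝ → ℝ} {lam q : ℝ} {u w h h' : ℝ → ℝ}

lemma continuous_max_rpow {f : ℝ → ℝ} (hf : Continuous f) {a : ℝ} (ha : 0 ≤ a) :
    Continuous fun r => (max (f r) 0) ^ a :=
  (hf.max continuous_const).rpow_const fun _ => Or.inr ha

lemma continuous_source (hK : Continuous K) (hu : Continuous u) (hq : 1 < q) :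
    Continuous fun s => lam * u s - K s * (max (u s) 0) ^ q := by
  have := continuous_max_rpow hu (a := q) (by linarith)
  fun_prop

lemma IsRad.eq_volt (hs : IsRad m K lam q u h) (hK : Continuous K) (hq : 1 < q) :
    ∀ r ∈ Icc (0 : ℝ) 1,
      u r = u 0 + volt m (fun s => lam * u s - K s * (max (u s) 0) ^ q) r := by
  have hg := continuous_source (lam := lam) hK hs.cu hq
  set g : ℝ → ℝ := fun s => lam * u s - K s * (max (u s) 0) ^ q with hgdef
  have ch := hs.ch
  have cu := hs.cu
  have ca := continuous_avg m hg
  have cv := continuous_volt m hg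
  have hd : ∀ r ∈ Ioo (0 : ℝ) 1,
      HasDerivAt (fun r => r ^ (m + 1) * (h r + 0) - r ^ (m + 1) * avg m g r) 0 r := by
    intro r hr
    refine ((hs.hasDerivAt_pow_mul 0 ⟨hr.1, hr.2.le⟩).sub
      (hasDerivAt_pow_mul_avg m hg r)).congr_deriv ?_
    simp [hgdef]
  have hmono := monotoneOn_of_hasDerivAt (a := 0) (c := 1) (by fun_prop) hd (fun _ _ => le_rfl)
  have hanti := antitoneOn_of_hasDerivAt (a := 0) (c := 1) (by fun_prop) hd (fun _ _ => le_rfl)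
  have hh : ∀ r ∈ Ioc (0 : ℝ) 1, h r = avg m g r := by
    intro r hr
    have h1 := hmono ⟨le_rfl, zero_le_one⟩ ⟨hr.1.le, hr.2⟩ hr.1.le
    have h2 := hanti ⟨le_rfl, zero_le_one⟩ ⟨hr.1.le, hr.2⟩ hr.1.le
    have h3 := le_antisymm h2 h1
    simp only [ne_eq, Nat.add_eq_zero_iff, one_ne_zero, and_false, not_false_eq_true,
      zero_pow, zero_mul, add_zero, sub_zero] at h3
    exact mul_left_cancel₀ (pow_pos hr.1 (m + 1)).ne' (sub_eq_zero.1 h3)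
  have hd2 : ∀ r ∈ Ioo (0 : ℝ) 1, HasDerivAt (fun r => u r - volt m g r) 0 r := by
    intro r hr
    refine ((hs.du r ⟨hr.1.le, hr.2.le⟩).sub (hasDerivAt_volt m hg r)).congr_deriv ?_
    rw [hh r ⟨hr.1, hr.2.le⟩, sub_self]
  intro r hr
  have h1 := monotoneOn_of_hasDerivAt (a := 0) (c := 1) (by fun_prop) hd2 (fun _ _ => le_rfl)
    ⟨le_rfl, zero_le_one⟩ hr hr.1
  have h2 := antitoneOn_of_hasDerivAt (a := 0) (c := 1) (by fun_prop) hd2 (fun _ _ => le_rfl)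
    ⟨le_rfl, zero_le_one⟩ hr hr.1
  simp only [volt_zero] at h1 h2
  linarith

lemma isRad_of_volt (hK : Continuous K) (hq : 1 < q) (hu : Continuous u) {d : ℝ}
    (hud : ∀ r ∈ Icc (0 : ℝ) 1,
      u r = d + volt m (fun s => lam * u s - K s * (max (u s) 0) ^ q) r) :
    IsRad m K lam q (fun r => d + volt m (fun s => lam * u s - K s * (max (u s) 0) ^ q) r)
      (avg m (fun s => lam * u s - K s * (max (u s) 0) ^ q)) := by
  have hg := continuous_source (lam := lam) hK hu hq
  refine ⟨continuous_const.add (continuous_volt m hg), continuous_avg m hg,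
    fun r _ => (hasDerivAt_volt m hg r).const_add d, fun r hr => ?_, ?_⟩
  · rw [← hud r ⟨hr.1.le, hr.2⟩]
    exact hasDerivAt_avg m hg hr.1
  · rw [← hud 0 ⟨le_rfl, zero_le_one⟩, avg_zero]

/-- A priori upper bound for solutions of the integral equation. -/
lemma volt_bound {g : ℝ → ℝ} (hg : Continuous g) (hu : Continuous u) (hlam : 0 ≤ lam)
    (hgu : ∀ s ∈ Icc (0 : ℝ) 1, g s ≤ lam * max (u s) 0) {d d₁ : ℝ} (hd : d ≤ d₁) (hd₁ : 0 ≤ d₁)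
    (hud : ∀ r ∈ Icc (0 : ℝ) 1, u r = d + volt m g r) :
    ∀ r ∈ Icc (0 : ℝ) 1, u r ≤ 2 * d₁ * Real.exp (2 * (lam + 1)) := by
  have c1 : Continuous fun s => max (u s) 0 := hu.max continuous_const
  have h0 : ∀ r ∈ Icc (0 : ℝ) 1, 0 ≤ volt m (fun s => max (u s) 0) r := fun r hr => by
    have := volt_mono m (f := fun _ => 0) continuous_const c1 hr.1 (fun s _ => le_max_right _ _)
    simpa [volt, avg] using this
  intro r hr
  have h1 := volt_gronwall m c1 (L := lam + 1) (a := d₁) (by linarith) hd₁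
    (R := 1) ⟨zero_le_one, le_rfl⟩ (fun r hr => by
      have h2 := volt_mono m (g := fun s => lam * max (u s) 0) hg (by fun_prop) hr.1
        (fun s hs => hgu s ⟨hs.1, hs.2.trans hr.2⟩)
      have h3 := volt_add m (f := fun _ => 0) continuous_const c1 lam r
      have h4 : volt m (fun _ => 0) r = 0 := by simp [volt, avg]
      simp only [zero_add, h4] at h3
      rw [h3] at h2
      have h5 := hud r hr
      have h6 := h0 r hr
      refine max_le (by nlinarith) (by positivity)) r hr
  refine (le_max_left _ _).trans (h1.trans ?_)
  have : Real.exp (2 * (lam + 1) * r) ≤ Real.exp (2 * (lam + 1)) :=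
    Real.exp_le_exp.2 (by nlinarith [hr.2])
  exact mul_le_mul_of_nonneg_left this (by positivity)

/-- Derivative of the truncated power nonlinearity. -/
def truncDeriv (q M t : ℝ) : ℝ := q * (max 0 (min t M)) ^ (q - 1)

/-- The power `t₊^q`, continued linearly beyond `M`. -/
def truncPow (q M t : ℝ) : ℝ := ∫ x in (0 : ℝ)..t, truncDeriv q M x

lemma continuous_truncDeriv (hq : 1 < q) (M : ℝ) : Continuous (truncDeriv q M) := by
  unfold truncDeriv
  exact continuous_const.mul ((continuous_const.max (continuous_id.min continuous_const)).rpow_const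
    fun _ => Or.inr (by linarith))

lemma truncDeriv_mem (hq : 1 < q) {M : ℝ} (hM : 0 ≤ M) (t : ℝ) :
    truncDeriv q M t ∈ Icc 0 (q * M ^ (q - 1)) := by
  unfold truncDeriv
  have h0 : 0 ≤ max 0 (min t M) := le_max_left _ _
  refine ⟨by positivity, mul_le_mul_of_nonneg_left (Real.rpow_le_rpow h0 ?_ (by linarith))
    (by linarith)⟩
  exact max_le hM (min_le_right _ _)

lemma truncDeriv_eq {M t : ℝ} (ht : t ≤ M) : truncDeriv q M t = q * (max t 0) ^ (q - 1) := by
  rw [truncDeriv, min_eq_left ht, max_comm]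

lemma hasDerivAt_truncPow (hq : 1 < q) (M t : ℝ) :
    HasDerivAt (truncPow q M) (truncDeriv q M t) t :=
  have hc := continuous_truncDeriv hq M
  intervalIntegral.integral_hasDerivAt_right (hc.intervalIntegrable _ _)
    (hc.stronglyMeasurableAtFilter _ _) hc.continuousAt

lemma truncPow_eq (hq : 1 < q) {M t : ℝ} (hM : 0 ≤ M) (ht : t ≤ M) :
    truncPow q M t = (max t 0) ^ q := by
  rcases le_total t 0 with h | h
  · rw [max_eq_right h, Real.zero_rpow (by linarith), truncPow, intervalIntegral.integral_symm]
    rw [intervalIntegral.integral_congr (g := fun _ => (0 : ℝ))]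
    · simp
    · intro x hx
      rw [uIcc_of_le h] at hx
      simp only
      rw [truncDeriv_eq (hx.2.trans hM), max_eq_right hx.2, Real.zero_rpow (by linarith), mul_zero]
  · rw [max_eq_left h, truncPow, intervalIntegral.integral_congr (g := fun x => q * x ^ (q - 1))]
    · rw [intervalIntegral.integral_const_mul, integral_rpow (Or.inl (by linarith)),
        sub_add_cancel, Real.zero_rpow (by linarith)]
      have : q ≠ 0 := by linarith
      field_simp
      ring
    · intro x hx
      rw [uIcc_of_le h] at hx
      simp only
      rw [truncDeriv_eq (hx.2.trans ht), max_eq_left hx.1]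

lemma truncPow_nonneg (hq : 1 < q) {M : ℝ} (hM : 0 ≤ M) (t : ℝ) : 0 ≤ truncPow q M t := by
  rcases le_total t 0 with h | h
  · rw [truncPow_eq hq hM (h.trans hM)]
    positivity
  · exact intervalIntegral.integral_nonneg h fun x _ => (truncDeriv_mem hq hM x).1

lemma truncPow_lipschitz (hq : 1 < q) {M : ℝ} (hM : 0 ≤ M) (a b : ℝ) :
    |truncPow q M a - truncPow q M b| ≤ q * M ^ (q - 1) * |a - b| :=
  convex_univ.norm_image_sub_le_of_norm_hasDerivWithin_le
    (fun t _ => (hasDerivAt_truncPow hq M t).hasDerivWithinAt)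
    (fun t _ => by
      have := truncDeriv_mem hq hM t
      rw [Real.norm_eq_abs, abs_of_nonneg this.1]
      exact this.2) (mem_univ b) (mem_univ a)

lemma truncDeriv_uniform (hq : 1 < q) {M : ℝ} (hM : 0 ≤ M) {ε : ℝ} (hε : 0 < ε) :
    ∃ δ > 0, ∀ a b, |b - a| ≤ δ → |truncDeriv q M b - truncDeriv q M a| ≤ ε := by
  have h1 := (isCompact_Icc (a := (0 : ℝ)) (b := M)).uniformContinuousOn_of_continuous
    (continuous_truncDeriv hq M).continuousOn
  obtain ⟨δ, hδ, h2⟩ := Metric.uniformContinuousOn_iff.1 h1 ε hε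
  refine ⟨δ / 2, by positivity, fun a b hab => ?_⟩
  have key : ∀ t, truncDeriv q M t = truncDeriv q M (max 0 (min t M)) := fun t => by
    have h3 : max 0 (min t M) ≤ M := max_le hM (min_le_right _ _)
    rw [truncDeriv, truncDeriv, min_eq_left h3, max_eq_right (le_max_left _ _)]
  have hmem : ∀ t : ℝ, max 0 (min t M) ∈ Icc 0 M := fun t =>
    ⟨le_max_left _ _, max_le hM (min_le_right _ _)⟩
  rw [key a, key b]
  refine (h2 _ (hmem b) _ (hmem a) ?_).le
  have h4 : |max 0 (min b M) - max 0 (min a M)| ≤ |b - a| := by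
    have h5 := abs_max_sub_max_le_abs (min b M) (min a M) 0
    have h6 : |min b M - min a M| ≤ |b - a| := by
      have := abs_min_sub_min_le_max b M a M
      simpa using this
    rw [max_comm 0, max_comm 0]
    exact h5.trans h6
  rw [Real.dist_eq]
  linarith

lemma truncPow_taylor (hq : 1 < q) {M : ℝ} (hM : 0 ≤ M) {ε : ℝ} (hε : 0 < ε) :
    ∃ δ > 0, ∀ a b, |b - a| ≤ δ →
      |truncPow q M b - truncPow q M a - truncDeriv q M a * (b - a)| ≤ ε * |b - a| := by
  obtain ⟨δ, hδ, h1⟩ := truncDeriv_uniform hq hM hε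
  refine ⟨δ, hδ, fun a b hab => ?_⟩
  have h2 := (convex_uIcc a b).norm_image_sub_le_of_norm_hasDerivWithin_le
    (f := fun t => truncPow q M t - truncDeriv q M a * t)
    (f' := fun t => truncDeriv q M t - truncDeriv q M a) (C := ε)
    (fun t _ => ((hasDerivAt_truncPow hq M t).sub
      (by simpa using (hasDerivAt_id t).const_mul (truncDeriv q M a))).hasDerivWithinAt)
    (fun t ht => by
      rw [Real.norm_eq_abs]
      exact h1 a t ((abs_sub_left_of_mem_uIcc ht).trans hab)) left_mem_uIcc right_mem_uIcc
  simp only [Real.norm_eq_abs] at h2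
  refine le_trans (le_of_eq ?_) h2
  congr 1
  ring

end Flow

section Flow

variable {m : ℕ} {K y : ℝ → ℝ} {lam q : ℝ} {u w h k : ℝ → ℝ}

/-- The truncated source term. -/
def truncSource (K : ℝ → ℝ) (lam q M s t : ℝ) : ℝ := lam * t - K s * truncPow q M t

/-- The derivative of the truncated source term in the unknown. -/
def truncSourceDeriv (K : ℝ → ℝ) (lam q M s t : ℝ) : ℝ := lam - K s * truncDeriv q M t

lemma continuous_truncPow (hq : 1 < q) (M : ℝ) : Continuous (truncPow q M) :=
  continuous_iff_continuousAt.2 fun t => (hasDerivAt_truncPow hq M t).continuousAt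

lemma continuous_truncSource (hK : Continuous K) (hq : 1 < q) (M : ℝ) :
    Continuous fun x : ℝ × ℝ => truncSource K lam q M x.1 x.2 := by
  have := continuous_truncPow hq M
  unfold truncSource
  fun_prop

lemma continuous_truncSourceDeriv (hK : Continuous K) (hq : 1 < q) (M : ℝ) :
    Continuous fun x : ℝ × ℝ => truncSourceDeriv K lam q M x.1 x.2 := by
  have := continuous_truncDeriv hq M
  unfold truncSourceDeriv
  fun_prop

lemma truncSource_lipschitz (hw : IsWeight K y) (hlam : 0 ≤ lam) (hq : 1 < q) {M : ℝ}
    (hM : 0 ≤ M) (s a b : ℝ) :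
    |truncSource K lam q M s a - truncSource K lam q M s b| ≤
      (lam + q * M ^ (q - 1) + 1) * |a - b| := by
  have h1 := truncPow_lipschitz hq hM a b
  have h2 : truncSource K lam q M s a - truncSource K lam q M s b =
      lam * (a - b) - K s * (truncPow q M a - truncPow q M b) := by
    unfold truncSource; ring
  rw [h2]
  have h3 := abs_sub (lam * (a - b)) (K s * (truncPow q M a - truncPow q M b))
  rw [abs_mul, abs_mul, abs_of_nonneg hlam, abs_of_pos (hw.pos s)] at h3
  have h4 : K s * |truncPow q M a - truncPow q M b| ≤ 1 * |truncPow q M a - truncPow q M b| :=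
    mul_le_mul_of_nonneg_right (hw.le_one s) (abs_nonneg _)
  nlinarith [abs_nonneg (a - b)]

lemma truncSourceDeriv_bound (hw : IsWeight K y) (hlam : 0 ≤ lam) (hq : 1 < q) {M : ℝ}
    (hM : 0 ≤ M) (s a : ℝ) : |truncSourceDeriv K lam q M s a| ≤ lam + q * M ^ (q - 1) + 1 := by
  have h1 := truncDeriv_mem hq hM a
  have h2 := hw.pos s
  have h3 := hw.le_one s
  unfold truncSourceDeriv
  rw [abs_le]
  constructor <;> nlinarith [h1.1, h1.2, mul_nonneg h2.le h1.1]

lemma truncSource_taylor (hw : IsWeight K y) (hq : 1 < q) {M : ℝ}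
    (hM : 0 ≤ M) {ε : ℝ} (hε : 0 < ε) : ∃ δ > 0, ∀ s ∈ Icc (0 : ℝ) 1, ∀ a b, |b - a| ≤ δ →
      |truncSource K lam q M s b - truncSource K lam q M s a -
        truncSourceDeriv K lam q M s a * (b - a)| ≤ ε * |b - a| := by
  obtain ⟨δ, hδ, h1⟩ := truncPow_taylor hq hM hε
  refine ⟨δ, hδ, fun s _ a b hab => ?_⟩
  have h2 : truncSource K lam q M s b - truncSource K lam q M s a -
      truncSourceDeriv K lam q M s a * (b - a) =
      -(K s * (truncPow q M b - truncPow q M a - truncDeriv q M a * (b - a))) := by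
    unfold truncSource truncSourceDeriv; ring
  rw [h2, abs_neg, abs_mul, abs_of_pos (hw.pos s)]
  refine le_trans ?_ (h1 a b hab)
  exact mul_le_of_le_one_left (abs_nonneg _) (hw.le_one s)

lemma truncSource_eq (hq : 1 < q) {M s t : ℝ} (hM : 0 ≤ M) (ht : t ≤ M) :
    truncSource K lam q M s t = lam * t - K s * (max t 0) ^ q := by
  rw [truncSource, truncPow_eq hq hM ht]

lemma truncSource_le (hw : IsWeight K y) (hlam : 0 ≤ lam) (hq : 1 < q) {M : ℝ} (hM : 0 ≤ M)
    (s t : ℝ) : truncSource K lam q M s t ≤ lam * max t 0 := by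
  have h1 := mul_nonneg (hw.pos s).le (truncPow_nonneg hq hM t)
  have h2 := mul_le_mul_of_nonneg_left (le_max_left t 0) hlam
  unfold truncSource
  linarith

lemma source_le (hw : IsWeight K y) (hlam : 0 ≤ lam) (s t : ℝ) :
    lam * t - K s * (max t 0) ^ q ≤ lam * max t 0 := by
  have h1 := mul_nonneg (hw.pos s).le (Real.rpow_nonneg (le_max_right t 0) q)
  have h2 := mul_le_mul_of_nonneg_left (le_max_left t 0) hlam
  linarith

lemma IsRad.eq_trunc_volt (hs : IsRad m K lam q u h) (hw : IsWeight K y) (hlam : 0 ≤ lam)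
    (hq : 1 < q) {d₁ : ℝ} (hd₁ : 0 ≤ d₁) (hu : u 0 ≤ d₁) : ∀ r ∈ Icc (0 : ℝ) 1, u r = u 0 +
      volt m (fun s => truncSource K lam q (2 * d₁ * Real.exp (2 * (lam + 1))) s (u s)) r := by
  have hcs := continuous_source (lam := lam) hw.cont hs.cu hq
  have h1 := hs.eq_volt hw.cont hq
  have h2 := volt_bound hcs hs.cu hlam (fun s _ => source_le hw hlam s _) hu hd₁ h1
  intro r hr
  refine (h1 r hr).trans ?_
  congr 1
  refine volt_congr m hcs ((continuous_truncSource hw.cont hq _).comp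
    (continuous_id.prodMk hs.cu)) hr.1 fun s hs' => ?_
  exact (truncSource_eq hq (by positivity) (h2 s ⟨hs'.1, hs'.2.trans hr.2⟩)).symm

/-- Radial solutions depend continuously on their value at the origin. -/
lemma IsRad.lipschitz (hw : IsWeight K y) (hlam : 0 ≤ lam) (hq : 1 < q) {d₁ : ℝ} (hd₁ : 0 ≤ d₁) :
    ∃ C, 0 ≤ C ∧ ∀ u h w k : ℝ → ℝ, IsRad m K lam q u h → IsRad m K lam q w k → u 0 ≤ d₁ →
      w 0 ≤ d₁ → ∀ r ∈ Icc (0 : ℝ) 1, |u r - w r| ≤ C * |u 0 - w 0| := by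
  set M : ℝ := 2 * d₁ * Real.exp (2 * (lam + 1)) with hM
  have hM0 : 0 ≤ M := by positivity
  set L : ℝ := lam + q * M ^ (q - 1) + 1 with hL
  have hL0 : 0 < L := by positivity
  refine ⟨2 * Real.exp (2 * L), by positivity, fun u h w k hu hk hud hwd r hr => ?_⟩
  refine (volt_sol_lipschitz m (continuous_truncSource hw.cont hq M) hL0
    (truncSource_lipschitz hw hlam hq hM0) ⟨zero_le_one, le_rfl⟩ hu.cu hk.cu
    (hu.eq_trunc_volt hw hlam hq hd₁ hud) (hk.eq_trunc_volt hw hlam hq hd₁ hwd) r hr).trans ?_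
  have : Real.exp (2 * L * r) ≤ Real.exp (2 * L) := Real.exp_le_exp.2 (by nlinarith [hr.2])
  nlinarith [abs_nonneg (u 0 - w 0)]

lemma IsRad.eqOn (hw : IsWeight K y) (hlam : 0 ≤ lam) (hq : 1 < q) (hu : IsRad m K lam q u h)
    (hk : IsRad m K lam q w k) (h0 : u 0 = w 0) : EqOn u w (Icc 0 1) := by
  obtain ⟨C, -, h1⟩ := IsRad.lipschitz (m := m) hw hlam hq (abs_nonneg (u 0))
  intro r hr
  have := h1 u h w k hu hk (le_abs_self _) (h0 ▸ le_abs_self _) r hr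
  rw [h0, sub_self, abs_zero, mul_zero] at this
  exact sub_eq_zero.1 (abs_nonpos_iff.1 this)

/-- The flow of the radial equation with respect to the value at the origin, together with its
linearization. -/
theorem exists_flow (m : ℕ) (hw : IsWeight K y) (hlam : 0 ≤ lam) (hq : 1 < q) {d₁ : ℝ}
    (hd₁ : 0 ≤ d₁) : ∃ u h v η : ℝ → ℝ → ℝ,
      (∀ d ≤ d₁, IsRad m K lam q (u d) (h d) ∧ IsLin m K lam q (u d) (v d) (η d)) ∧
      (∀ d, u d 0 = d) ∧
      ∀ d, ∀ r ∈ Icc (0 : ℝ) 1, HasDerivAt (fun d => u d r) (v d r) d := by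
  set M : ℝ := 2 * d₁ * Real.exp (2 * (lam + 1)) with hM
  have hM0 : 0 ≤ M := by positivity
  set L : ℝ := lam + q * M ^ (q - 1) + 1 with hL
  have hL0 : 0 < L := by positivity
  have hG := continuous_truncSource (lam := lam) hw.cont hq M
  have hg := continuous_truncSourceDeriv (lam := lam) hw.cont hq M
  have hLip := truncSource_lipschitz hw hlam hq hM0
  choose U hUc hU using exists_volt_sol m hG hL0 hLip
  have hlin : ∀ d, Continuous fun x : ℝ × ℝ => truncSourceDeriv K lam q M x.1 (U d x.1) * x.2 :=
    fun d => (hg.comp (continuous_fst.prodMk ((hUc d).comp continuous_fst))).mul continuous_snd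
  have hlinLip : ∀ d s a b, |truncSourceDeriv K lam q M s (U d s) * a -
      truncSourceDeriv K lam q M s (U d s) * b| ≤ L * |a - b| := fun d s a b => by
    rw [← mul_sub, abs_mul]
    exact mul_le_mul_of_nonneg_right (truncSourceDeriv_bound hw hlam hq hM0 _ _) (abs_nonneg _)
  choose V hVc hV using fun d => exists_volt_sol m (hlin d) hL0 (hlinLip d) 1
  have hsrc : ∀ d, Continuous fun s => truncSource K lam q M s (U d s) := fun d =>
    hG.comp (continuous_id.prodMk (hUc d))
  have hsrcd : ∀ d, Continuous fun s => truncSourceDeriv K lam q M s (U d s) * V d s := fun d =>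
    (hlin d).comp (continuous_id.prodMk (hVc d))
  refine ⟨fun d r => d + volt m (fun s => truncSource K lam q M s (U d s)) r,
    fun d => avg m (fun s => truncSource K lam q M s (U d s)),
    fun d r => 1 + volt m (fun s => truncSourceDeriv K lam q M s (U d s) * V d s) r,
    fun d => avg m (fun s => truncSourceDeriv K lam q M s (U d s) * V d s),
    fun d hd => ?_, fun d => by simp [volt_zero], fun d r hr => ?_⟩
  · have hb : ∀ r ∈ Icc (0 : ℝ) 1, U d r ≤ M := volt_bound (hsrc d) (hUc d) hlam
      (fun s _ => truncSource_le hw hlam hq hM0 _ _) hd hd₁ (hU d)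
    refine ⟨⟨continuous_const.add (continuous_volt m (hsrc d)), continuous_avg m (hsrc d),
      fun r _ => (hasDerivAt_volt m (hsrc d) r).const_add d, fun r hr => ?_, ?_⟩,
      ⟨continuous_avg m (hsrcd d), fun r _ => (hasDerivAt_volt m (hsrcd d) r).const_add 1,
        fun r hr => ?_, by simp [volt_zero]⟩⟩
    · beta_reduce
      rw [← hU d r ⟨hr.1.le, hr.2⟩, ← truncSource_eq hq hM0 (hb r ⟨hr.1.le, hr.2⟩)]
      exact hasDerivAt_avg m (hsrc d) hr.1
    · beta_reduce
      rw [← hU d 0 ⟨le_rfl, zero_le_one⟩, avg_zero,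
        truncSource_eq hq hM0 (hb 0 ⟨le_rfl, zero_le_one⟩)]
    · have h1 := hb r ⟨hr.1.le, hr.2⟩
      refine ((hasDerivAt_id r).mul (hasDerivAt_avg m (hsrcd d) hr.1)).congr_deriv ?_
      beta_reduce
      rw [← hU d r ⟨hr.1.le, hr.2⟩, ← hV d r ⟨hr.1.le, hr.2⟩, truncSourceDeriv,
        truncDeriv_eq h1]
      have := hr.1.ne'
      simp only [id]
      field_simp
      ring
  · have h1 := volt_sol_hasDerivAt m hG hg hL0 hLip (truncSourceDeriv_bound hw hlam hq hM0)
      (fun ε hε => truncSource_taylor hw hq hM0 hε) hUc hU d (hVc d) (hV d) hr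
    beta_reduce
    rw [← hV d r hr]
    refine h1.congr_of_eventuallyEq (Eventually.of_forall fun e => ?_)
    exact (hU e r hr).symm

end Flow

section RadialSolutions

variable {m : ℕ} {K y : ℝ → ℝ} {lam q : ℝ} {u w h k : ℝ → ℝ}

lemma continuousOn_flow (hw : IsWeight K y) (hlam : 0 ≤ lam) (hq : 1 < q) {d₁ : ℝ}
    (hd₁ : 0 ≤ d₁) {u h : ℝ → ℝ → ℝ} (hu : ∀ d ≤ d₁, IsRad m K lam q (u d) (h d))
    (hu0 : ∀ d, u d 0 = d) :
    ContinuousOn (fun x : ℝ × ℝ => u x.2 x.1) (Icc 0 1 ×ˢ Icc 1 d₁) := by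
  obtain ⟨C, hC, hL⟩ := IsRad.lipschitz (m := m) hw hlam hq hd₁
  rintro ⟨r, d⟩ hx
  have h1 : Tendsto (fun x : ℝ × ℝ => u x.2 x.1 - u d x.1) (𝓝[Icc 0 1 ×ˢ Icc 1 d₁] (r, d))
      (𝓝 0) := by
    refine squeeze_zero_norm' (a := fun x : ℝ × ℝ => C * |x.2 - d|) ?_ ?_
    · filter_upwards [self_mem_nhdsWithin] with x hx'
      have := hL _ _ _ _ (hu x.2 hx'.2.2) (hu d hx.2.2) (by rw [hu0]; exact hx'.2.2)
        (by rw [hu0]; exact hx.2.2) x.1 hx'.1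
      rwa [hu0, hu0] at this
    · have : Continuous fun x : ℝ × ℝ => C * |x.2 - d| := by fun_prop
      refine (this.tendsto' (r, d) 0 (by simp)).mono_left nhdsWithin_le_nhds
  have h2 : Tendsto (fun x : ℝ × ℝ => u d x.1) (𝓝[Icc 0 1 ×ˢ Icc 1 d₁] (r, d)) (𝓝 (u d r)) :=
    (((hu d hx.2.2).cu.comp continuous_fst).tendsto (r, d)).mono_left nhdsWithin_le_nhds
  have h3 := h1.add h2
  simp only [zero_add, sub_add_cancel] at h3
  exact h3

lemma ge_zero_of_pos_left {f : ℝ → ℝ} (hf : Continuous f) {a : ℝ} (ha : 0 < a)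
    (h : ∀ r ∈ Ico 0 a, 0 < f r) : 0 ≤ f a := by
  by_contra! hcon
  obtain ⟨x, hx, hx0, -⟩ := exists_first_zero hf.continuousOn (h 0 ⟨le_rfl, ha⟩)
    ⟨a, ⟨ha.le, le_rfl⟩, hcon.le⟩
  rcases eq_or_lt_of_le hx.2 with h1 | h1
  · rw [h1] at hx0; linarith
  · linarith [h x ⟨hx.1.le, h1⟩]

lemma not_lt_of_radial_solutions (hw : IsWeight K y) (hlam : 0 ≤ lam) (hq : 1 < q) (hm : 1 ≤ m)
    (hu : IsRad m K lam q u h) (hup : ∀ r ∈ Ico (0 : ℝ) 1, 0 < u r) (hu1 : u 1 = 0)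
    (hk : IsRad m K lam q w k) (hkp : ∀ r ∈ Ico (0 : ℝ) 1, 0 < w r) (hk1 : w 1 = 0) :
    ¬ u 0 < w 0 := by
  intro hlt
  obtain ⟨d₁, hd₁⟩ : ∃ d₁, d₁ = w 0 := ⟨_, rfl⟩
  obtain ⟨d₀, hd₀⟩ : ∃ d₀, d₀ = u 0 := ⟨_, rfl⟩
  have h01 : d₀ < d₁ := by rw [hd₀, hd₁]; exact hlt
  have hI : (1 : ℝ) ∈ Ioc (0 : ℝ) 1 := ⟨one_pos, le_rfl⟩
  have hd0 : 1 < d₀ := hd₀ ▸ hu.one_lt_of_zero hw hlam hq hI hup hu1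
  obtain ⟨U, H, V, E, hUr, hU0, hUd⟩ := exists_flow m hw hlam hq (d₁ := d₁) (by linarith)
  have hUw : EqOn (U d₁) w (Icc 0 1) :=
    (hUr d₁ le_rfl).1.eqOn hw hlam hq hk (by rw [hU0, hd₁])
  have hUu : EqOn (U d₀) u (Icc 0 1) :=
    (hUr d₀ h01.le).1.eqOn hw hlam hq hu (by rw [hU0, hd₀])
  have hcont := continuousOn_flow hw hlam hq (by linarith) (fun d hd => (hUr d hd).1) hU0
  obtain ⟨S, hS⟩ : ∃ S : Set (ℝ × ℝ), S = (Icc (0 : ℝ) 1 ×ˢ Icc 1 d₁) ∩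
    (fun x : ℝ × ℝ => U x.2 x.1) ⁻¹' Iic 0 := ⟨_, rfl⟩
  have hSc : IsCompact S := by
    rw [hS]
    exact (isCompact_Icc.prod isCompact_Icc).of_isClosed_subset
      (hcont.preimage_isClosed_of_isClosed (isClosed_Icc.prod isClosed_Icc) isClosed_Iic)
      inter_subset_left
  have h1S : ((1, d₁) : ℝ × ℝ) ∈ S := by
    rw [hS]
    refine ⟨⟨⟨zero_le_one, le_rfl⟩, ⟨by linarith, le_rfl⟩⟩, ?_⟩
    simp [hUw ⟨zero_le_one, le_rfl⟩, hk1]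
  have h0S : ((1, d₀) : ℝ × ℝ) ∈ S := by
    rw [hS]
    refine ⟨⟨⟨zero_le_one, le_rfl⟩, ⟨by linarith, h01.le⟩⟩, ?_⟩
    simp [hUu ⟨zero_le_one, le_rfl⟩, hu1]
  obtain ⟨x, hx, hxmin⟩ := hSc.exists_isMinOn ⟨_, h1S⟩ continuous_fst.continuousOn
  obtain ⟨ρ, d, hρdS, hdlt, hmin⟩ : ∃ ρ d : ℝ, (ρ, d) ∈ S ∧ d < d₁ ∧ ∀ p ∈ S, ρ ≤ p.1 := by
    rcases lt_or_eq_of_le (show x.2 ≤ d₁ by rw [hS] at hx; exact hx.1.2.2) with h1 | h1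
    · exact ⟨x.1, x.2, hx, h1, fun p hp => hxmin hp⟩
    · refine ⟨1, d₀, h0S, h01, fun p hp => ?_⟩
      have h2 : x.1 = 1 := by
        rw [hS] at hx
        have h3 : U x.2 x.1 ≤ 0 := hx.2
        rw [h1, hUw hx.1.1] at h3
        by_contra hne
        exact absurd h3 (not_le.2 (hkp _ ⟨hx.1.1.1, lt_of_le_of_ne hx.1.1.2 hne⟩))
      have h3 : x.1 ≤ p.1 := hxmin hp
      rwa [h2] at h3
  rw [hS] at hρdS
  obtain ⟨⟨hρ, hd⟩, hle⟩ := hρdS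
  simp only [mem_preimage, mem_Iic] at hle hρ hd
  have hpos : ∀ e ∈ Icc 1 d₁, ∀ r ∈ Ico 0 ρ, 0 < U e r := by
    intro e he r hr
    by_contra! hcon
    have := hmin (r, e) (by rw [hS]; exact ⟨⟨⟨hr.1, hr.2.le.trans hρ.2⟩, he⟩, hcon⟩)
    exact absurd hr.2 (not_lt.2 this)
  have hρ0 : 0 < ρ := lt_of_le_of_ne hρ.1 fun heq => by
    rw [← heq, hU0] at hle
    linarith [hd.1]
  have hge : ∀ e ∈ Icc 1 d₁, 0 ≤ U e ρ := fun e he =>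
    ge_zero_of_pos_left (hUr e he.2).1.cu hρ0 (hpos e he)
  have hz : U d ρ = 0 := le_antisymm hle (hge d hd)
  have hdgt : 1 < d := by
    have := (hUr d hd.2).1.one_lt_of_zero hw hlam hq ⟨hρ0, hρ.2⟩ (hpos d hd) hz
    rwa [hU0] at this
  have hloc : IsLocalMin (fun e => U e ρ) d := by
    filter_upwards [Icc_mem_nhds hdgt hdlt] with e he
    rw [hz]
    exact hge e he
  exact (hUr d hd.2).2.ne_zero (hUr d hd.2).1 hw hlam hq hm ⟨hρ0, hρ.2⟩ (hpos d hd) hz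
    (hloc.hasDerivAt_eq_zero (hUd d ρ hρ))

/-- Uniqueness of the positive radial Dirichlet solution. -/
theorem radial_unique (hw : IsWeight K y) (hlam : 0 ≤ lam) (hq : 1 < q) (hm : 1 ≤ m)
    (hu : IsRad m K lam q u h) (hup : ∀ r ∈ Ico (0 : ℝ) 1, 0 < u r) (hu1 : u 1 = 0)
    (hk : IsRad m K lam q w k) (hkp : ∀ r ∈ Ico (0 : ℝ) 1, 0 < w r) (hk1 : w 1 = 0) :
    EqOn u w (Icc 0 1) :=
  hu.eqOn hw hlam hq hk (le_antisymm
    (not_lt.1 (not_lt_of_radial_solutions hw hlam hq hm hk hkp hk1 hu hup hu1))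
    (not_lt.1 (not_lt_of_radial_solutions hw hlam hq hm hu hup hu1 hk hkp hk1)))

/-- Existence of a positive radial Dirichlet solution. -/
theorem radial_exists (hw : IsWeight K y) (hlam : 0 ≤ lam) (hq : 1 < q) (hm : 1 ≤ m)
    (hsub : ((m : ℝ) - 1) * (q + 1) < 2 * (m + 1)) :
    ∃ u h : ℝ → ℝ, IsRad m K lam q u h ∧ (∀ r ∈ Ico (0 : ℝ) 1, 0 < u r) ∧ u 1 = 0 := by
  obtain ⟨d₁, hbig, hd₁⟩ := ((eventually_exists_zero hw hlam hq hm hsub).and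
    (eventually_gt_atTop 1)).exists
  obtain ⟨U, H, V, E, hUr, hU0, -⟩ := exists_flow m hw hlam hq (d₁ := d₁) (by linarith)
  have hcont := continuousOn_flow hw hlam hq (by linarith) (fun d hd => (hUr d hd).1) hU0
  obtain ⟨S, hS⟩ : ∃ S : Set (ℝ × ℝ), S = (Icc (0 : ℝ) 1 ×ˢ Icc 1 d₁) ∩
    (fun x : ℝ × ℝ => U x.2 x.1) ⁻¹' Iic 0 := ⟨_, rfl⟩
  have hSc : IsCompact S := by
    rw [hS]
    exact (isCompact_Icc.prod isCompact_Icc).of_isClosed_subset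
      (hcont.preimage_isClosed_of_isClosed (isClosed_Icc.prod isClosed_Icc) isClosed_Iic)
      inter_subset_left
  obtain ⟨r₁, hr₁, hr₁le⟩ := hbig (U d₁) (H d₁) (hUr d₁ le_rfl).1 (hU0 d₁)
  have h1S : ((r₁, d₁) : ℝ × ℝ) ∈ S := by
    rw [hS]
    exact ⟨⟨hr₁, ⟨hd₁.le, le_rfl⟩⟩, hr₁le⟩
  obtain ⟨⟨r, d⟩, hx, hmin⟩ := hSc.exists_isMinOn ⟨_, h1S⟩ continuous_snd.continuousOn
  rw [hS] at hx
  obtain ⟨⟨hr, hd⟩, hle⟩ := hx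
  simp only [mem_preimage, mem_Iic] at hr hd hle
  have hrad := (hUr d hd.2).1
  obtain ⟨ρ, hρ, hz, hpos⟩ := exists_first_zero hrad.cu.continuousOn
    (by rw [hU0]; linarith [hd.1]) ⟨r, hr, hle⟩
  have hdgt : 1 < d := by
    have := hrad.one_lt_of_zero hw hlam hq hρ hpos hz
    rwa [hU0] at this
  have hnn : ∀ t ∈ Icc (0 : ℝ) 1, 0 ≤ U d t := by
    intro t ht
    have hlim : Tendsto (fun e => U e t) (𝓝[Ico 1 d] d) (𝓝 (U d t)) := by
      have h1 : ContinuousOn (fun e => U e t) (Icc 1 d₁) :=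
        hcont.comp (f := fun e => (t, e)) (by fun_prop) fun e he => ⟨ht, he⟩
      exact (h1 d hd).mono fun e he => ⟨he.1, he.2.le.trans hd.2⟩
    have : (𝓝[Ico 1 d] d).NeBot := by
      rw [← mem_closure_iff_nhdsWithin_neBot, closure_Ico hdgt.ne]
      exact ⟨hdgt.le, le_rfl⟩
    refine ge_of_tendsto hlim (eventually_nhdsWithin_of_forall fun e he => ?_)
    by_contra! hcon
    have h1 : d ≤ e := hmin (show (t, e) ∈ S by
      rw [hS]; exact ⟨⟨ht, ⟨he.1, he.2.le.trans hd.2⟩⟩, hcon.le⟩)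
    exact absurd he.2 (not_lt.2 h1)
  have hρ1 : ρ = 1 := by
    by_contra hne
    have hlt : ρ < 1 := lt_of_le_of_ne hρ.2 hne
    have hloc : IsLocalMin (U d) ρ := by
      filter_upwards [Icc_mem_nhds hρ.1 hlt] with e he
      rw [hz]
      exact hnn e he
    have h1 := hloc.hasDerivAt_eq_zero (hrad.du ρ ⟨hρ.1.le, hρ.2⟩)
    refine hrad.deriv_ne_zero hw hlam hq hρ ?_ hz ((mul_eq_zero.1 h1).resolve_left hρ.1.ne')
    rw [hU0]
    linarith
  subst hρ1
  exact ⟨U d, H d, hrad, hpos, hz⟩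

end RadialSolutions

section Laplacian

variable {N : ℕ} {u w : Euc N → ℝ} {x : Euc N}

lemma ContDiffAt.differentiableAt_fderiv_of_two (hu : ContDiffAt ℝ 2 u x) :
    DifferentiableAt ℝ (fderiv ℝ u) x :=
  (hu.fderiv_right (m := 1) (by norm_num)).differentiableAt (by norm_num)

lemma ContDiffAt.eventually_differentiableAt (hu : ContDiffAt ℝ 2 u x) :
    ∀ᶠ y in 𝓝 x, DifferentiableAt ℝ u y :=
  (hu.eventually (by simp)).mono fun _ h => h.differentiableAt (by norm_num)

lemma fderiv_fderiv_apply (hu : ContDiffAt ℝ 2 u x) (e e' : Euc N) :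
    fderiv ℝ (fun y => fderiv ℝ u y e) x e' = fderiv ℝ (fderiv ℝ u) x e' e := by
  rw [fderiv_clm_apply hu.differentiableAt_fderiv_of_two (differentiableAt_const _)]
  simp

lemma lap_eq_sum (hu : ContDiffAt ℝ 2 u x) (b : OrthonormalBasis (Fin N) ℝ (Euc N)) :
    lap u x = ∑ i, fderiv ℝ (fderiv ℝ u) x (b i) (b i) := by
  have h1 := congrFun (InnerProductSpace.laplacian_eq_iteratedFDeriv_orthonormalBasis u b) x
  have h2 := congrFun (InnerProductSpace.laplacian_eq_iteratedFDeriv_orthonormalBasis u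
    (EuclideanSpace.basisFun (Fin N) ℝ)) x
  rw [h1] at h2
  simp only [iteratedFDeriv_two_apply] at h2
  simp only [lap, fderiv_fderiv_apply hu]
  simpa using h2.symm

lemma lap_congr (h : u =ᶠ[𝓝 x] w) : lap u x = lap w x := by
  unfold lap
  refine Finset.sum_congr rfl fun i _ => ?_
  have h1 : (fun y => fderiv ℝ u y (EuclideanSpace.single i (1 : ℝ))) =ᶠ[𝓝 x]
      fun y => fderiv ℝ w y (EuclideanSpace.single i (1 : ℝ)) := by
    filter_upwards [h.eventuallyEq_nhds] with y hy
    rw [hy.fderiv_eq]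
  rw [h1.fderiv_eq]

lemma lap_sub (hu : ContDiffAt ℝ 2 u x) (hw : ContDiffAt ℝ 2 w x) :
    lap (fun y => u y - w y) x = lap u x - lap w x := by
  have h1 : fderiv ℝ (fun y => u y - w y) =ᶠ[𝓝 x] fun y => fderiv ℝ u y - fderiv ℝ w y := by
    filter_upwards [hu.eventually_differentiableAt, hw.eventually_differentiableAt] with y h h'
    exact fderiv_fun_sub h h'
  have b := EuclideanSpace.basisFun (Fin N) ℝ
  rw [lap_eq_sum (hu.sub hw) b, lap_eq_sum hu b, lap_eq_sum hw b, h1.fderiv_eq,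
    fderiv_fun_sub hu.differentiableAt_fderiv_of_two hw.differentiableAt_fderiv_of_two,
    ← Finset.sum_sub_distrib]
  simp

lemma lap_const_mul (c : ℝ) (hu : ContDiffAt ℝ 2 u x) :
    lap (fun y => c * u y) x = c * lap u x := by
  have h1 : fderiv ℝ (fun y => c * u y) =ᶠ[𝓝 x] fun y => c • fderiv ℝ u y := by
    filter_upwards [hu.eventually_differentiableAt] with y h
    exact fderiv_const_mul h c
  have b := EuclideanSpace.basisFun (Fin N) ℝ
  rw [lap_eq_sum (contDiffAt_const.mul hu) b, lap_eq_sum hu b, h1.fderiv_eq,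
    fderiv_fun_const_smul hu.differentiableAt_fderiv_of_two, Finset.mul_sum]
  simp

lemma lap_comp_isometry (R : Euc N ≃ₗᵢ[ℝ] Euc N) (c : Euc N)
    (hu : ContDiffAt ℝ 2 u (R x + c)) :
    lap (fun y => u (R y + c)) x = lap u (R x + c) := by
  have hd : ∀ y, HasFDerivAt (fun y => R y + c)
      (R.toContinuousLinearEquiv : Euc N →L[ℝ] Euc N) y := fun y =>
    (R.toContinuousLinearEquiv : Euc N →L[ℝ] Euc N).hasFDerivAt.add_const c
  have hR : ContDiff ℝ 2 (fun y => R y + c) := R.contDiff.add contDiff_const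
  have hc : ContDiffAt ℝ 2 (fun y => u (R y + c)) x := hu.comp x hR.contDiffAt
  have b := EuclideanSpace.basisFun (Fin N) ℝ
  rw [lap_eq_sum hc b, lap_eq_sum hu (b.map R)]
  refine Finset.sum_congr rfl fun i _ => ?_
  rw [← fderiv_fderiv_apply hc, ← fderiv_fderiv_apply hu]
  have h1 : (fun y => fderiv ℝ (fun y => u (R y + c)) y (b i)) =ᶠ[𝓝 x]
      fun y => fderiv ℝ u (R y + c) (R (b i)) := by
    filter_upwards [hR.continuous.continuousAt.eventually hu.eventually_differentiableAt]
      with y hy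
    have := (hy.hasFDerivAt.comp y (hd y)).fderiv
    change fderiv ℝ (u ∘ fun y => R y + c) y (b i) = _
    rw [this]; rfl
  rw [h1.fderiv_eq]
  have h2 : DifferentiableAt ℝ (fun z => fderiv ℝ u z (R (b i))) (R x + c) :=
    hu.differentiableAt_fderiv_of_two.clm_apply (differentiableAt_const _)
  have := (h2.hasFDerivAt.comp x (hd x)).fderiv
  change fderiv ℝ ((fun z => fderiv ℝ u z (R (b i))) ∘ fun y => R y + c) x (b i) = _
  rw [this]
  simp

lemma lap_comp_inner {e : Euc N} (he : ‖e‖ = 1) {f f' f'' : ℝ → ℝ}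
    (h1 : ∀ t, HasDerivAt f (f' t) t) (h2 : ∀ t, HasDerivAt f' (f'' t) t) (x : Euc N) :
    lap (fun y => f (inner ℝ e y)) x = f'' (inner ℝ e x) := by
  have key : ∀ {g g' : ℝ → ℝ}, (∀ t, HasDerivAt g (g' t) t) → ∀ (y : Euc N) (i : Fin N),
      HasFDerivAt (fun y => g (inner ℝ e y)) (g' (inner ℝ e y) • innerSL ℝ e) y := by
    intro g g' hg y i
    exact (hg _).comp_hasFDerivAt y (innerSL ℝ e).hasFDerivAt
  have h3 : ∀ i : Fin N, fderiv ℝ (fun y => fderiv ℝ (fun y => f (inner ℝ e y)) y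
      (EuclideanSpace.single i 1)) x (EuclideanSpace.single i 1) =
      f'' (inner ℝ e x) * (e i) ^ 2 := by
    intro i
    have h4 : (fun y => fderiv ℝ (fun y => f (inner ℝ e y)) y (EuclideanSpace.single i 1)) =
        fun y => e i * f' (inner ℝ e y) := by
      ext y
      rw [(key h1 y i).fderiv]
      simp [EuclideanSpace.inner_single_right, mul_comm]
    rw [h4, ((key h2 x i).const_mul (e i)).fderiv]
    simp [EuclideanSpace.inner_single_right]
    ring
  have h5 : ∑ i, (e i) ^ 2 = 1 := by
    have := EuclideanSpace.norm_sq_eq e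
    simp only [he, Real.norm_eq_abs, sq_abs] at this
    linarith
  unfold lap
  simp only [h3]
  rw [← Finset.mul_sum, h5, mul_one]

lemma deriv_deriv_nonneg_of_isLocalMin {f : ℝ → ℝ} {a : ℝ} (hf : ContinuousAt f a)
    (h : IsLocalMin f a) : 0 ≤ deriv (deriv f) a := by
  by_contra! hneg
  have hmax := isLocalMax_of_deriv_deriv_neg hneg h.deriv_eq_zero hf
  have heq : f =ᶠ[𝓝 a] fun _ => f a := by
    filter_upwards [h, hmax] with y h1 h2
    exact le_antisymm h2 h1
  rw [heq.deriv.deriv_eq] at hneg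
  simp at hneg

lemma fderiv_fderiv_eq_deriv_deriv (hu : ContDiffAt ℝ 2 u x) (e : Euc N) :
    fderiv ℝ (fun y => fderiv ℝ u y e) x e = deriv (deriv fun t : ℝ => u (x + t • e)) 0 := by
  have hl : ∀ t : ℝ, HasDerivAt (fun t : ℝ => x + t • e) e t := fun t => by
    simpa using ((hasDerivAt_id t).smul_const e).const_add x
  have hlc : Tendsto (fun t : ℝ => x + t • e) (𝓝 0) (𝓝 x) := by
    have : Continuous fun t : ℝ => x + t • e := by fun_prop
    exact this.tendsto' 0 x (by simp)
  have h0 : x + (0 : ℝ) • e = x := by simp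
  have hd : deriv (fun t : ℝ => u (x + t • e)) =ᶠ[𝓝 0] fun t => fderiv ℝ u (x + t • e) e := by
    filter_upwards [hlc.eventually hu.eventually_differentiableAt] with t ht
    exact (ht.hasFDerivAt.comp_hasDerivAt t (hl t)).deriv
  have h2 : DifferentiableAt ℝ (fun z => fderiv ℝ u z e) (x + (0 : ℝ) • e) := by
    rw [h0]
    exact hu.differentiableAt_fderiv_of_two.clm_apply (differentiableAt_const _)
  rw [hd.deriv_eq]
  have hdd := (h2.hasFDerivAt.comp_hasDerivAt (0 : ℝ) (hl 0)).deriv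
  rw [h0] at hdd
  exact hdd.symm

lemma lap_nonneg_of_isLocalMin (hu : ContDiffAt ℝ 2 u x) (h : IsLocalMin u x) :
    0 ≤ lap u x := by
  unfold lap
  refine Finset.sum_nonneg fun i _ => ?_
  rw [fderiv_fderiv_eq_deriv_deriv hu]
  set e : Euc N := EuclideanSpace.single i 1
  have hlc : Tendsto (fun t : ℝ => x + t • e) (𝓝 0) (𝓝 x) := by
    have : Continuous fun t : ℝ => x + t • e := by fun_prop
    exact this.tendsto' 0 x (by simp)
  refine deriv_deriv_nonneg_of_isLocalMin ?_ ?_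
  · refine ContinuousAt.comp (g := u) ?_ (by fun_prop)
    simpa using hu.continuousAt
  · filter_upwards [hlc.eventually h] with t ht
    simpa using ht

end Laplacian

section MovingPlanes

/-- `v` is a positive solution on the unit ball of `-Δv + lam v = K(|x|) v^q`, extended by zero
to a continuous function on the whole space. -/
structure IsBallSol {N : ℕ} (K : ℝ → ℝ) (lam q : ℝ) (v : Euc N → ℝ) : Prop where
  cont : Continuous v
  zero : ∀ x, 1 ≤ ‖x‖ → v x = 0
  pos : ∀ x, ‖x‖ < 1 → 0 < v x
  smooth : ∀ x, ‖x‖ < 1 → ContDiffAt ℝ 2 v x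
  eq : ∀ x, ‖x‖ < 1 → lap v x = lam * v x - K ‖x‖ * v x ^ q

/-- Reflection across the hyperplane `⟪e, x⟫ = μ`. -/
def hypRefl {N : ℕ} (e : Euc N) (μ : ℝ) (x : Euc N) : Euc N :=
  x + (2 * (μ - inner ℝ e x)) • e

variable {N : ℕ} {e : Euc N} {μ : ℝ} {x : Euc N}

lemma continuous_hypRefl (e : Euc N) : Continuous fun z : ℝ × Euc N => hypRefl e z.1 z.2 := by
  unfold hypRefl
  fun_prop

lemma inner_hypRefl (he : ‖e‖ = 1) : inner ℝ e (hypRefl e μ x) = 2 * μ - inner ℝ e x := by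
  rw [hypRefl, inner_add_right, inner_smul_right, real_inner_self_eq_norm_sq, he]
  ring

lemma hypRefl_hypRefl (he : ‖e‖ = 1) : hypRefl e μ (hypRefl e μ x) = x := by
  rw [hypRefl, inner_hypRefl he, hypRefl, add_assoc, ← add_smul]
  have : 2 * (μ - inner ℝ e x) + 2 * (μ - (2 * μ - inner ℝ e x)) = 0 := by ring
  rw [this, zero_smul, add_zero]

lemma norm_sq_hypRefl (he : ‖e‖ = 1) :
    ‖hypRefl e μ x‖ ^ 2 = ‖x‖ ^ 2 - 4 * μ * (inner ℝ e x - μ) := by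
  rw [hypRefl, norm_add_sq_real, inner_smul_right, norm_smul, he, real_inner_comm e x,
    Real.norm_eq_abs, mul_one, sq_abs]
  ring

lemma hypRefl_of_inner_eq (h : inner ℝ e x = μ) : hypRefl e μ x = x := by
  simp [hypRefl, h]

lemma norm_hypRefl_le (he : ‖e‖ = 1) (hμ : 0 ≤ μ) (hx : μ ≤ inner ℝ e x) : ‖hypRefl e μ x‖ ≤ ‖x‖ := by
  have h := norm_sq_hypRefl (μ := μ) (x := x) he
  have h2 := mul_nonneg hμ (sub_nonneg.2 hx)
  exact abs_le_of_sq_le_sq' (by linarith) (norm_nonneg x) |>.2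

lemma norm_hypRefl_lt (he : ‖e‖ = 1) (hμ : 0 < μ) (hx : μ < inner ℝ e x) : ‖hypRefl e μ x‖ < ‖x‖ := by
  have h := norm_sq_hypRefl (μ := μ) (x := x) he
  have h2 := mul_pos hμ (sub_pos.2 hx)
  exact lt_of_pow_lt_pow_left₀ 2 (norm_nonneg x) (by linarith)

lemma hypRefl_eq_reflection (he : ‖e‖ = 1) :
    hypRefl e μ = fun x => Submodule.reflection (Submodule.span ℝ {e})ᗮ x + (2 * μ) • e := by
  ext1 x
  rw [Submodule.reflection_orthogonal_apply, Submodule.reflection_singleton_apply, he, hypRefl]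
  simp only [RCLike.ofReal_real_eq_id, id_eq, one_pow, div_one, two_smul]
  module

lemma contDiffAt_comp_hypRefl (he : ‖e‖ = 1) {v : Euc N → ℝ} (h : ContDiffAt ℝ 2 v (hypRefl e μ x)) :
    ContDiffAt ℝ 2 (fun y => v (hypRefl e μ y)) x := by
  refine ContDiffAt.comp x h ?_
  rw [hypRefl_eq_reflection he]
  exact ((Submodule.reflection (Submodule.span ℝ {e})ᗮ).contDiff.add contDiff_const).contDiffAt

lemma lap_comp_hypRefl (he : ‖e‖ = 1) {v : Euc N → ℝ} (h : ContDiffAt ℝ 2 v (hypRefl e μ x)) :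
    lap (fun y => v (hypRefl e μ y)) x = lap v (hypRefl e μ x) := by
  rw [hypRefl_eq_reflection he] at h ⊢
  exact lap_comp_isometry _ _ h

lemma rpow_sub_rpow_le {q M a b : ℝ} (hq : 1 < q) (ha : 0 ≤ a) (hab : a ≤ b) (hb : b ≤ M) :
    b ^ q - a ^ q ≤ q * M ^ (q - 1) * (b - a) := by
  have hd : ∀ t ∈ Ioo a b, HasDerivAt (fun t => t ^ q - q * M ^ (q - 1) * t)
      (q * t ^ (q - 1) - q * M ^ (q - 1)) t := by
    intro t ht
    have h1 := Real.hasDerivAt_rpow_const (x := t) (p := q) (Or.inl (ha.trans_lt ht.1).ne')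
    exact (h1.sub ((hasDerivAt_id t).const_mul (q * M ^ (q - 1)))).congr_deriv (by ring)
  have hc : ContinuousOn (fun t => t ^ q - q * M ^ (q - 1) * t) (Icc a b) := by
    have : Continuous fun t : ℝ => t ^ q := continuous_id.rpow_const fun _ => Or.inr (by linarith)
    exact (this.sub (continuous_const.mul continuous_id)).continuousOn
  have := antitoneOn_of_hasDerivAt hc hd (fun t ht => by
    have : t ^ (q - 1) ≤ M ^ (q - 1) :=
      Real.rpow_le_rpow (ha.trans ht.1.le) (ht.2.le.trans hb) (by linarith)
    nlinarith) ⟨le_rfl, hab⟩ ⟨hab, le_rfl⟩ hab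
  simp only at this
  linarith

variable {K y : ℝ → ℝ} {lam q : ℝ} {v : Euc N → ℝ}

lemma IsBallSol.nonneg (hv : IsBallSol K lam q v) (x : Euc N) : 0 ≤ v x := by
  rcases lt_or_ge ‖x‖ 1 with h | h
  · exact (hv.pos x h).le
  · exact (hv.zero x h).ge

lemma IsBallSol.exists_bound (hv : IsBallSol K lam q v) : ∃ M, 0 ≤ M ∧ ∀ x, v x ≤ M := by
  obtain ⟨M, hM⟩ := (isCompact_closedBall (0 : Euc N) 1).exists_bound_of_continuousOn
    hv.cont.continuousOn
  have h0 : 0 ≤ M := (norm_nonneg _).trans (hM 0 (by simp))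
  refine ⟨M, h0, fun x => ?_⟩
  rcases lt_or_ge ‖x‖ 1 with h | h
  · exact (le_abs_self _).trans (hM x (by simpa using h.le))
  · rw [hv.zero x h]; exact h0

lemma IsBallSol.contDiffAt_sub (hv : IsBallSol K lam q v) (he : ‖e‖ = 1) (hμ : 0 ≤ μ)
    (hx : ‖x‖ < 1) (hxμ : μ ≤ inner ℝ e x) :
    ContDiffAt ℝ 2 (fun y => v (hypRefl e μ y) - v y) x :=
  (contDiffAt_comp_hypRefl he (hv.smooth _ ((norm_hypRefl_le he hμ hxμ).trans_lt hx))).sub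
    (hv.smooth x hx)

lemma IsBallSol.lap_sub_eq (hv : IsBallSol K lam q v) (he : ‖e‖ = 1) (hμ : 0 ≤ μ)
    (hx : ‖x‖ < 1) (hxμ : μ ≤ inner ℝ e x) :
    lap (fun y => v (hypRefl e μ y) - v y) x = lam * (v (hypRefl e μ x) - v x) -
      (K ‖hypRefl e μ x‖ * v (hypRefl e μ x) ^ q - K ‖x‖ * v x ^ q) := by
  have h1 := (norm_hypRefl_le he hμ hxμ).trans_lt hx
  rw [lap_sub (contDiffAt_comp_hypRefl he (hv.smooth _ h1)) (hv.smooth x hx),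
    lap_comp_hypRefl he (hv.smooth _ h1), hv.eq _ h1, hv.eq _ hx]
  ring

lemma IsBallSol.lap_sub_le_of_nonneg (hv : IsBallSol K lam q v) (hw : IsWeight K y) (hq : 1 < q)
    (he : ‖e‖ = 1) (hμ : 0 ≤ μ) (hx : ‖x‖ < 1) (hxμ : μ ≤ inner ℝ e x)
    (h : v x ≤ v (hypRefl e μ x)) :
    lap (fun y => v (hypRefl e μ y) - v y) x ≤ lam * (v (hypRefl e μ x) - v x) := by
  rw [hv.lap_sub_eq he hμ hx hxμ]
  have h1 := hw.antitone (norm_nonneg _) (norm_hypRefl_le he hμ hxμ)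
  have h2 : v x ^ q ≤ v (hypRefl e μ x) ^ q := Real.rpow_le_rpow (hv.nonneg x) h (by linarith)
  have h3 := mul_le_mul h1 h2 (Real.rpow_nonneg (hv.nonneg x) q) (hw.pos _).le
  linarith

lemma IsBallSol.lap_sub_le_of_nonpos (hv : IsBallSol K lam q v) (hw : IsWeight K y) (hq : 1 < q)
    {M : ℝ} (hM : ∀ x, v x ≤ M) (he : ‖e‖ = 1) (hμ : 0 ≤ μ) (hx : ‖x‖ < 1)
    (hxμ : μ ≤ inner ℝ e x) (h : v (hypRefl e μ x) ≤ v x) :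
    lap (fun y => v (hypRefl e μ y) - v y) x ≤
      (lam - q * M ^ (q - 1)) * (v (hypRefl e μ x) - v x) := by
  rw [hv.lap_sub_eq he hμ hx hxμ]
  have h1 := hw.antitone (norm_nonneg _) (norm_hypRefl_le he hμ hxμ)
  have h2 := rpow_sub_rpow_le hq (hv.nonneg _) h (hM x)
  have h3 : v (hypRefl e μ x) ^ q ≤ v x ^ q := Real.rpow_le_rpow (hv.nonneg _) h (by linarith)
  have h4 := mul_le_mul_of_nonneg_right h1 (Real.rpow_nonneg (hv.nonneg (hypRefl e μ x)) q)
  have h5 := mul_le_mul_of_nonneg_right (hw.le_one ‖x‖) (sub_nonneg.2 h3)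
  linarith

lemma isLocalMin_of_isMinOn_inner {f : Euc N → ℝ} {D : Set (Euc N)} (h : IsMinOn f D x)
    {a b : ℝ} (hx : ‖x‖ < 1) (ha : a < inner ℝ e x) (hb : inner ℝ e x < b)
    (hD : ∀ y, ‖y‖ < 1 → a < inner ℝ e y → inner ℝ e y < b → y ∈ D) : IsLocalMin f x := by
  have c1 : Continuous fun y : Euc N => inner ℝ e y := by fun_prop
  filter_upwards [(continuous_norm.tendsto x).eventually_lt_const hx,
    (c1.tendsto x).eventually_const_lt ha, (c1.tendsto x).eventually_lt_const hb] with y h1 h2 h3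
  exact h (hD y h1 h2 h3)

/-- Maximum principle in a narrow strip. -/
lemma IsBallSol.narrow (hv : IsBallSol K lam q v) (hw : IsWeight K y) (hq : 1 < q)
    (hlam : 0 ≤ lam) {M : ℝ} (hM0 : 0 ≤ M) (hM : ∀ x, v x ≤ M) (he : ‖e‖ = 1) (hμ : 0 ≤ μ)
    {a δ : ℝ} (ha : 0 < a) (ha2 : a ^ 2 = q * M ^ (q - 1) + 1) (hδ : a * δ < Real.pi / 2)
    (hfar : ∀ x, μ + δ ≤ inner ℝ e x → v x ≤ v (hypRefl e μ x)) :
    ∀ x, μ ≤ inner ℝ e x → v x ≤ v (hypRefl e μ x) := by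
  by_contra! hcon
  obtain ⟨z, hzμ, hz⟩ := hcon
  have hC : 0 ≤ q * M ^ (q - 1) := mul_nonneg (by linarith) (Real.rpow_nonneg hM0 _)
  have ci : Continuous fun y : Euc N => inner ℝ e y := by fun_prop
  set D : Set (Euc N) := {x | ‖x‖ ≤ 1 ∧ μ ≤ inner ℝ e x ∧ inner ℝ e x ≤ μ + δ} with hD
  have hDc : IsCompact D := by
    refine (isCompact_closedBall (0 : Euc N) 1).of_isClosed_subset ?_ ?_
    · exact (isClosed_le continuous_norm continuous_const).inter
        ((isClosed_le continuous_const ci).inter (isClosed_le ci continuous_const))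
    · intro x hx; simpa using hx.1
  set g : Euc N → ℝ := fun x => Real.cos (a * (inner ℝ e x - μ)) with hg
  set w : Euc N → ℝ := fun x => v (hypRefl e μ x) - v x with hwdef
  have cw : Continuous w :=
    (hv.cont.comp ((continuous_hypRefl e).comp (Continuous.prodMk_right μ))).sub hv.cont
  have cg : Continuous g := by fun_prop
  have hgpos : ∀ x ∈ D, 0 < g x := by
    intro x hx
    have h1 : 0 ≤ a * (inner ℝ e x - μ) := mul_nonneg ha.le (sub_nonneg.2 hx.2.1)
    have h2 : a * (inner ℝ e x - μ) ≤ a * δ :=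
      mul_le_mul_of_nonneg_left (by linarith [hx.2.2]) ha.le
    exact Real.cos_pos_of_mem_Ioo ⟨by linarith [Real.pi_pos], by linarith⟩
  have hneg_mem : ∀ x, μ ≤ inner ℝ e x → v (hypRefl e μ x) < v x →
      ‖x‖ < 1 ∧ μ < inner ℝ e x ∧ inner ℝ e x < μ + δ := by
    intro x hx hx'
    refine ⟨?_, ?_, ?_⟩
    · by_contra! h
      rw [hv.zero x h] at hx'
      linarith [hv.nonneg (hypRefl e μ x)]
    · refine lt_of_le_of_ne hx fun h => ?_
      rw [hypRefl_of_inner_eq h.symm] at hx'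
      exact lt_irrefl _ hx'
    · by_contra! h
      linarith [hfar x h]
  have hzD := hneg_mem z hzμ hz
  have hzD' : z ∈ D := ⟨hzD.1.le, hzD.2.1.le, hzD.2.2.le⟩
  obtain ⟨x, hxD, hxmin⟩ := hDc.exists_isMinOn ⟨z, hzD'⟩
    (f := fun x => w x / g x) (cw.continuousOn.div cg.continuousOn fun x hx => (hgpos x hx).ne')
  set m := w x / g x with hm
  have hmneg : m < 0 := (hxmin hzD').trans_lt
    (div_neg_of_neg_of_pos (sub_neg.2 hz) (hgpos z hzD'))
  have hwx : w x = m * g x := by rw [hm, div_mul_cancel₀ _ (hgpos x hxD).ne']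
  have hwneg : w x < 0 := by rw [hwx]; exact mul_neg_of_neg_of_pos hmneg (hgpos x hxD)
  obtain ⟨hx1, hx2, hx3⟩ := hneg_mem x hxD.2.1 (sub_neg.1 hwneg)
  have hF : IsMinOn (fun y => w y - m * g y) D x := by
    intro y hy
    have h1 : m ≤ w y / g y := hxmin hy
    rw [le_div_iff₀ (hgpos y hy)] at h1
    change w x - m * g x ≤ w y - m * g y
    linarith
  have hloc := isLocalMin_of_isMinOn_inner hF hx1 hx2 hx3
    (fun y h1 h2 h3 => ⟨h1.le, h2.le, h3.le⟩)
  have hwd : ContDiffAt ℝ 2 w x := hv.contDiffAt_sub he hμ hx1 hx2.le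
  have hgd : ContDiffAt ℝ 2 g x := by
    have : ContDiff ℝ 2 g := by
      apply Real.contDiff_cos.comp
      exact contDiff_const.mul ((contDiff_const.inner ℝ contDiff_id).sub contDiff_const)
    exact this.contDiffAt
  have hlapg : lap g x = -a ^ 2 * g x := by
    have hd : ∀ t : ℝ, HasDerivAt (fun t => a * (t - μ)) a t := fun t => by
      simpa using ((hasDerivAt_id t).sub_const μ).const_mul a
    have h1 : ∀ t, HasDerivAt (fun t => Real.cos (a * (t - μ)))
        (-a * Real.sin (a * (t - μ))) t := fun t =>
      ((Real.hasDerivAt_cos _).comp t (hd t)).congr_deriv (by ring)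
    have h2 : ∀ t, HasDerivAt (fun t => -a * Real.sin (a * (t - μ)))
        (-a ^ 2 * Real.cos (a * (t - μ))) t := fun t =>
      (((Real.hasDerivAt_sin _).comp t (hd t)).const_mul (-a)).congr_deriv (by ring)
    exact lap_comp_inner he h1 h2 x
  have hlap := lap_nonneg_of_isLocalMin (hwd.sub (contDiffAt_const.mul hgd)) hloc
  rw [lap_sub hwd (contDiffAt_const.mul hgd), lap_const_mul m hgd, hlapg] at hlap
  have hle := hv.lap_sub_le_of_nonpos hw hq hM he hμ hx1 hx2.le (sub_neg.1 hwneg).le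
  change lap w x ≤ _ * w x at hle
  rw [show m * (-a ^ 2 * g x) = -a ^ 2 * (m * g x) by ring, ← hwx, ha2] at hlap
  nlinarith

/-- Strong maximum principle on a cap. -/
lemma IsBallSol.strong (hv : IsBallSol K lam q v) (hw : IsWeight K y) (hq : 1 < q)
    (hlam : 0 ≤ lam) (he : ‖e‖ = 1) (hμ : 0 < μ)
    (h : ∀ x, μ ≤ inner ℝ e x → v x ≤ v (hypRefl e μ x)) (x : Euc N) (hx : ‖x‖ ≤ 1)
    (hxμ : μ < inner ℝ e x) : v x < v (hypRefl e μ x) := by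
  have hsph : ∀ z : Euc N, ‖z‖ = 1 → μ < inner ℝ e z → v z < v (hypRefl e μ z) := by
    intro z hz hzμ
    rw [hv.zero z hz.ge]
    exact hv.pos _ ((norm_hypRefl_lt he hμ hzμ).trans_eq hz)
  obtain ⟨c, hc1, hc2⟩ := exists_between hxμ
  have ci : Continuous fun y : Euc N => inner ℝ e y := by fun_prop
  set w : Euc N → ℝ := fun x => v (hypRefl e μ x) - v x with hwdef
  have cw : Continuous w :=
    (hv.cont.comp ((continuous_hypRefl e).comp (Continuous.prodMk_right μ))).sub hv.cont
  set α : ℝ := 1 + lam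
  set g : Euc N → ℝ := fun x => Real.exp (α * inner ℝ e x) - Real.exp (α * c) with hg
  have cg : Continuous g := by fun_prop
  have hα : 0 < α := by positivity
  have hble : ∀ z : Euc N, ‖z‖ ≤ 1 → g z ≤ Real.exp α := by
    intro z hz
    have h1 : inner ℝ e z ≤ 1 := (real_inner_le_norm e z).trans (by rw [he, one_mul]; exact hz)
    have h2 : Real.exp (α * inner ℝ e z) ≤ Real.exp α :=
      Real.exp_le_exp.2 (by nlinarith)
    linarith [Real.exp_pos (α * c)]
  have hmemD : ∀ T : Set (Euc N), IsClosed T → IsCompact {z : Euc N | ‖z‖ ≤ 1 ∧ z ∈ T} := by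
    intro T hT
    refine (isCompact_closedBall (0 : Euc N) 1).of_isClosed_subset
      ((isClosed_le continuous_norm continuous_const).inter hT) ?_
    intro x hx; simpa using hx.1
  obtain ⟨ε, hε, hεs⟩ : ∃ ε, 0 < ε ∧ ∀ z : Euc N, ‖z‖ = 1 → c ≤ inner ℝ e z →
      ε * g z ≤ w z := by
    have hS : IsCompact {z : Euc N | ‖z‖ ≤ 1 ∧ z ∈ {z : Euc N | ‖z‖ = 1 ∧ c ≤ inner ℝ e z}} :=
      hmemD _ ((isClosed_eq continuous_norm continuous_const).inter
        (isClosed_le continuous_const ci))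
    obtain ⟨b, hb, hbw⟩ := hS.exists_forall_le' cw.continuousOn (a := 0)
      (fun z hz => sub_pos.2 (hsph z hz.2.1 (hc1.trans_le hz.2.2)))
    refine ⟨b / Real.exp α, by positivity, fun z hz hzc => ?_⟩
    have h1 := mul_le_mul_of_nonneg_left (hble z hz.le) (div_pos hb (Real.exp_pos α)).le
    rw [div_mul_cancel₀ _ (Real.exp_pos α).ne'] at h1
    exact h1.trans (hbw z ⟨hz.le, hz, hzc⟩)
  have hDc : IsCompact {z : Euc N | ‖z‖ ≤ 1 ∧ z ∈ {z : Euc N | c ≤ inner ℝ e z}} :=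
    hmemD _ (isClosed_le continuous_const ci)
  obtain ⟨z, hzD, hzmin⟩ := hDc.exists_isMinOn ⟨x, hx, hc2.le⟩
    (f := fun x => w x - ε * g x) (cw.sub (continuous_const.mul cg)).continuousOn
  have hkey : 0 ≤ w z - ε * g z := by
    by_contra! hneg
    have hz1 : ‖z‖ < 1 := by
      refine lt_of_le_of_ne hzD.1 fun h1 => ?_
      linarith [hεs z h1 hzD.2]
    have hwz : 0 ≤ w z := sub_nonneg.2 (h z (hc1.le.trans hzD.2))
    have hz2 : c < inner ℝ e z := by
      refine lt_of_le_of_ne hzD.2 fun h1 => ?_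
      have : g z = 0 := by rw [hg]; simp [← h1]
      rw [this] at hneg
      linarith
    have hloc := isLocalMin_of_isMinOn_inner hzmin hz1 hz2 (lt_add_one _)
      (fun y h1 h2 h3 => ⟨h1.le, h2.le⟩)
    have hwd : ContDiffAt ℝ 2 w z := hv.contDiffAt_sub he hμ.le hz1 (hc1.trans hz2).le
    have hgd : ContDiffAt ℝ 2 g z := by
      have : ContDiff ℝ 2 g :=
        (Real.contDiff_exp.comp (contDiff_const.mul (contDiff_const.inner ℝ contDiff_id))).sub
          contDiff_const
      exact this.contDiffAt
    have hlapg : lap g z = α ^ 2 * Real.exp (α * inner ℝ e z) := by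
      have hd : ∀ t : ℝ, HasDerivAt (fun t => α * t) α t := fun t => by
        simpa using (hasDerivAt_id t).const_mul α
      have h1 : ∀ t, HasDerivAt (fun t => Real.exp (α * t) - Real.exp (α * c))
          (α * Real.exp (α * t)) t := fun t =>
        (((Real.hasDerivAt_exp _).comp t (hd t)).sub_const _).congr_deriv (by ring)
      have h2 : ∀ t, HasDerivAt (fun t => α * Real.exp (α * t))
          (α ^ 2 * Real.exp (α * t)) t := fun t =>
        (((Real.hasDerivAt_exp _).comp t (hd t)).const_mul α).congr_deriv (by ring)
      exact lap_comp_inner he h1 h2 z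
    have hlap := lap_nonneg_of_isLocalMin (hwd.sub (contDiffAt_const.mul hgd)) hloc
    rw [lap_sub hwd (contDiffAt_const.mul hgd), lap_const_mul ε hgd, hlapg] at hlap
    have hle := hv.lap_sub_le_of_nonneg hw hq he hμ.le hz1 (hc1.trans hz2).le
      (h z (hc1.le.trans hzD.2))
    change lap w z ≤ lam * w z at hle
    have h3 : w z ≤ ε * Real.exp (α * inner ℝ e z) := by
      have : ε * g z ≤ ε * Real.exp (α * inner ℝ e z) :=
        mul_le_mul_of_nonneg_left (by rw [hg]; linarith [Real.exp_pos (α * c)]) hε.le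
      linarith
    have h4 := mul_le_mul_of_nonneg_left h3 hlam
    have h5 : 0 < ε * Real.exp (α * inner ℝ e z) := by positivity
    have h6 : α ^ 2 = 1 + 2 * lam + lam ^ 2 := by ring
    rw [h6] at hlap
    nlinarith [mul_nonneg hlam h5.le, mul_nonneg (sq_nonneg lam) h5.le]
  have h1 : 0 ≤ w x - ε * g x := hkey.trans (hzmin ⟨hx, hc2.le⟩)
  have h2 : 0 < g x := sub_pos.2 (Real.exp_lt_exp.2 (mul_lt_mul_of_pos_left hc2 hα))
  have h3 := mul_pos hε h2
  have h4 : 0 < w x := by linarith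
  exact sub_pos.1 h4

lemma IsBallSol.le_hypRefl (hv : IsBallSol K lam q v) (hw : IsWeight K y) (hq : 1 < q)
    (hlam : 0 ≤ lam) (he : ‖e‖ = 1) :
    ∀ μ ∈ Icc (0 : ℝ) 1, ∀ x, inner ℝ e x ≤ μ ∨ v x ≤ v (hypRefl e μ x) := by
  obtain ⟨M, hM0, hM⟩ := hv.exists_bound
  have ci : Continuous fun y : Euc N => inner ℝ e y := by fun_prop
  have hC : 0 ≤ q * M ^ (q - 1) := mul_nonneg (by linarith) (Real.rpow_nonneg hM0 _)
  obtain ⟨a, ha, ha2⟩ : ∃ a, 0 < a ∧ a ^ 2 = q * M ^ (q - 1) + 1 :=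
    ⟨√(q * M ^ (q - 1) + 1), by positivity, Real.sq_sqrt (by positivity)⟩
  obtain ⟨δ, hδ, hδ2⟩ : ∃ δ, 0 < δ ∧ a * δ < Real.pi / 2 :=
    ⟨1 / a, by positivity, by
      rw [mul_one_div_cancel ha.ne']; linarith [Real.pi_gt_three]⟩
  set S : Set ℝ := {t | ∀ x, inner ℝ e x ≤ 1 - t ∨ v x ≤ v (hypRefl e (1 - t) x)} with hS
  have hSclosed : IsClosed S := by
    have : S = ⋂ x, {t | inner ℝ e x ≤ 1 - t} ∪ {t | v x ≤ v (hypRefl e (1 - t) x)} := by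
      ext t; simp [hS]
    rw [this]
    refine isClosed_iInter fun x => (isClosed_le continuous_const (by fun_prop)).union
      (isClosed_le continuous_const (hv.cont.comp ?_))
    exact (continuous_hypRefl e).comp (by fun_prop : Continuous fun t : ℝ => (1 - t, x))
  have hform : ∀ μ, (∀ x, inner ℝ e x ≤ μ ∨ v x ≤ v (hypRefl e μ x)) ↔
      ∀ x, μ ≤ inner ℝ e x → v x ≤ v (hypRefl e μ x) := by
    intro μ
    refine forall_congr' fun x => ⟨fun h hx => ?_, fun h => ?_⟩
    · rcases h with h | h
      · rw [hypRefl_of_inner_eq (le_antisymm h hx)]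
      · exact h
    · rcases le_total (inner ℝ e x) μ with h1 | h1
      · exact Or.inl h1
      · exact Or.inr (h h1)
  have hsub : Icc (0 : ℝ) 1 ⊆ S := by
    refine (hSclosed.inter isClosed_Icc).Icc_subset_of_forall_exists_gt ?_ ?_
    · intro x
      rw [sub_zero]
      rcases le_or_gt (inner ℝ e x) 1 with h1 | h1
      · exact Or.inl h1
      · right
        have : 1 < ‖x‖ := h1.trans_le ((real_inner_le_norm e x).trans (by rw [he, one_mul]))
        rw [hv.zero x this.le]
        exact hv.nonneg _
    · rintro t ⟨htS, ht0, ht1⟩ t' (htt' : t < t')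
      have hμ : 0 < 1 - t := by linarith
      have hpos := hv.strong hw hq hlam he hμ ((hform _).1 htS)
      have hQ : IsCompact {x : Euc N | ‖x‖ ≤ 1 ∧ 1 - t + δ / 2 ≤ inner ℝ e x} := by
        refine (isCompact_closedBall (0 : Euc N) 1).of_isClosed_subset
          ((isClosed_le continuous_norm continuous_const).inter
            (isClosed_le continuous_const ci)) ?_
        intro x hx; simpa using hx.1
      have hev : ∀ᶠ τ in 𝓝 t, ∀ x ∈ {x : Euc N | ‖x‖ ≤ 1 ∧ 1 - t + δ / 2 ≤ inner ℝ e x},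
          v x < v (hypRefl e (1 - τ) x) := by
        refine hQ.eventually_forall_of_forall_eventually fun x hx => ?_
        have c1 : Continuous fun z : ℝ × Euc N => v z.2 := hv.cont.comp continuous_snd
        have c2 : Continuous fun z : ℝ × Euc N => v (hypRefl e (1 - z.1) z.2) :=
          hv.cont.comp ((continuous_hypRefl e).comp
            (by fun_prop : Continuous fun z : ℝ × Euc N => (1 - z.1, z.2)))
        exact (isOpen_lt c1 c2).mem_nhds (hpos x hx.1 (by linarith [hx.2]))
      have hev2 : ∀ᶠ τ in 𝓝[>] t, τ < min (min t' 1) (t + δ / 2) :=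
        (eventually_lt_nhds (by
          refine lt_min (lt_min htt' ht1) (by linarith))).filter_mono nhdsWithin_le_nhds
      obtain ⟨τ, ⟨h1, h2⟩, h3⟩ := ((hev.filter_mono nhdsWithin_le_nhds).and hev2 |>.and
        self_mem_nhdsWithin).exists
      simp only [lt_min_iff] at h2
      refine ⟨τ, (hform _).2 (hv.narrow hw hq hlam hM0 hM he (by linarith) ha ha2 hδ2 ?_),
        h3, h2.1.1.le⟩
      intro x hx
      rcases le_or_gt ‖x‖ 1 with hx1 | hx1
      · exact (h1 x ⟨hx1, by linarith⟩).le
      · rw [hv.zero x hx1.le]; exact hv.nonneg _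
  intro μ hμ x
  have h1 : 1 - μ ∈ Icc (0 : ℝ) 1 := ⟨by linarith [hμ.2], by linarith [hμ.1]⟩
  have := hsub h1 x
  simpa using this

lemma IsBallSol.hypRefl_zero (hv : IsBallSol K lam q v) (hw : IsWeight K y) (hq : 1 < q)
    (hlam : 0 ≤ lam) (he : ‖e‖ = 1) (x : Euc N) : v (hypRefl e 0 x) = v x := by
  have key : ∀ e : Euc N, ‖e‖ = 1 → ∀ x, 0 ≤ inner ℝ e x → v x ≤ v (hypRefl e 0 x) := by
    intro e he x hx
    rcases hv.le_hypRefl hw hq hlam he 0 ⟨le_rfl, zero_le_one⟩ x with h | h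
    · rw [hypRefl_of_inner_eq (le_antisymm h hx)]
    · exact h
  have hneg : ∀ x : Euc N, hypRefl (-e) 0 x = hypRefl e 0 x := by
    intro x
    simp only [hypRefl, inner_neg_left, smul_neg, zero_sub, neg_neg, mul_neg, neg_smul]
  have he' : ‖-e‖ = 1 := by rwa [norm_neg]
  have key2 : ∀ x, v x ≤ v (hypRefl e 0 x) := by
    intro x
    rcases le_total 0 (inner ℝ e x) with h | h
    · exact key e he x h
    · have := key (-e) he' x (by rw [inner_neg_left]; linarith)
      rwa [hneg] at this
  refine le_antisymm ?_ (key2 x)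
  have := key2 (hypRefl e 0 x)
  rwa [hypRefl_hypRefl he] at this

/-- Positive solutions on the ball are radial. -/
theorem IsBallSol.radial (hv : IsBallSol K lam q v) (hw : IsWeight K y) (hq : 1 < q)
    (hlam : 0 ≤ lam) {x z : Euc N} (h : ‖x‖ = ‖z‖) : v x = v z := by
  rcases eq_or_ne x z with rfl | hne
  · rfl
  have hn : ‖x - z‖ ≠ 0 := norm_ne_zero_iff.2 (sub_ne_zero.2 hne)
  set e : Euc N := ‖x - z‖⁻¹ • (x - z) with he
  have he1 : ‖e‖ = 1 := by
    rw [he, norm_smul, norm_inv, norm_norm, inv_mul_cancel₀ hn]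
  have hx : hypRefl e 0 x = z := by
    have h1 : inner ℝ (x - z) x = ‖x - z‖ ^ 2 / 2 := by
      rw [norm_sub_sq_real, inner_sub_left, real_inner_self_eq_norm_sq, ← h, real_inner_comm]
      ring
    rw [hypRefl, he, inner_smul_left, h1, smul_smul]
    have : 2 * (0 - (starRingEnd ℝ) ‖x - z‖⁻¹ * (‖x - z‖ ^ 2 / 2)) * ‖x - z‖⁻¹ = -1 := by
      simp only [map_inv₀, conj_trivial]
      field_simp
      ring
    rw [this]
    simp
  rw [← hv.hypRefl_zero hw hq hlam he1 x, hx]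

end MovingPlanes

section RadialReduction

variable {m : ℕ} {K y : ℝ → ℝ} {lam q : ℝ}

lemma ContDiffAt.differentiableAt_deriv_of_two {f : ℝ → ℝ} {r : ℝ} (hf : ContDiffAt ℝ 2 f r) :
    DifferentiableAt ℝ (deriv f) r :=
  ((hf.fderiv_right (m := 1) (by norm_num)).differentiableAt (by norm_num)).clm_apply
    (differentiableAt_const _)

lemma deriv_deriv_comp_sqrt {f : ℝ → ℝ} {r : ℝ} (hr : 0 < r) (hf : ContDiffAt ℝ 2 f r) :
    deriv (deriv fun t : ℝ => f √(r ^ 2 + t ^ 2)) 0 = deriv f r / r := by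
  have hpos : ∀ t : ℝ, 0 < r ^ 2 + t ^ 2 := fun t => by positivity
  set φ : ℝ → ℝ := fun t => √(r ^ 2 + t ^ 2) with hφ
  have hφ0 : φ 0 = r := by simp [hφ, Real.sqrt_sq hr.le]
  have hφpos : ∀ t, 0 < φ t := fun t => Real.sqrt_pos.2 (hpos t)
  have hφd : ∀ t, HasDerivAt φ (t / φ t) t := by
    intro t
    have h1 : HasDerivAt (fun t : ℝ => r ^ 2 + t ^ 2) (2 * t) t := by
      simpa using (hasDerivAt_pow 2 t).const_add (r ^ 2)
    refine (h1.sqrt (hpos t).ne').congr_deriv ?_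
    have := (hφpos t).ne'
    change 2 * t / (2 * φ t) = t / φ t
    field_simp
  have hφc : Tendsto φ (𝓝 0) (𝓝 r) := by
    have := (hφd 0).continuousAt.tendsto
    rwa [hφ0] at this
  have hev : ∀ᶠ s in 𝓝 r, DifferentiableAt ℝ f s :=
    (hf.eventually (by simp)).mono fun _ h => h.differentiableAt (by norm_num)
  have hd1 : deriv (fun t => f (φ t)) =ᶠ[𝓝 0] fun t => deriv f (φ t) / φ t * t := by
    filter_upwards [hφc.eventually hev] with t ht
    have := (ht.hasDerivAt.comp t (hφd t)).deriv
    change deriv (f ∘ φ) t = _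
    rw [this]; ring
  rw [hd1.deriv_eq]
  have hd2 : DifferentiableAt ℝ (deriv f) (φ 0) := by
    rw [hφ0]
    exact hf.differentiableAt_deriv_of_two
  have hd3 : DifferentiableAt ℝ (fun t => deriv f (φ t) / φ t) 0 :=
    (hd2.comp (0 : ℝ) (hφd 0).differentiableAt).div (hφd 0).differentiableAt (hφpos 0).ne'
  have := (hd3.hasDerivAt.mul (hasDerivAt_id (0 : ℝ))).deriv
  change deriv ((fun t => deriv f (φ t) / φ t) * id) 0 = _
  rw [this]
  simp [hφ0]

lemma lap_radial {v : Euc (m + 1) → ℝ} {f : ℝ → ℝ} (hvf : ∀ x, v x = f ‖x‖) {r : ℝ} (hr : 0 < r)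
    (hf : ContDiffAt ℝ 2 f r)
    (hv : ContDiffAt ℝ 2 v (r • EuclideanSpace.single (0 : Fin (m + 1)) (1 : ℝ))) :
    lap v (r • EuclideanSpace.single (0 : Fin (m + 1)) (1 : ℝ)) =
      deriv (deriv f) r + m * (deriv f r / r) := by
  unfold lap
  rw [Fin.sum_univ_succ]
  congr 1
  · rw [fderiv_fderiv_eq_deriv_deriv hv]
    have h1 : (fun t : ℝ => v (r • EuclideanSpace.single (0 : Fin (m + 1)) (1 : ℝ) +
        t • EuclideanSpace.single (0 : Fin (m + 1)) (1 : ℝ))) =ᶠ[𝓝 0] fun t => f (r + t) := by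
      filter_upwards [eventually_gt_nhds (neg_lt_zero.2 hr)] with t ht
      rw [hvf, ← add_smul, norm_smul, PiLp.norm_single, norm_one, mul_one,
        Real.norm_of_nonneg (by linarith)]
    rw [h1.deriv.deriv_eq]
    have h2 : deriv (fun t => f (r + t)) = fun t => deriv f (r + t) := by
      ext t; exact deriv_comp_const_add ..
    rw [h2, deriv_comp_const_add, add_zero]
  · have h1 : ∀ i : Fin m, fderiv ℝ (fun y => fderiv ℝ v y (EuclideanSpace.single i.succ 1))
        (r • EuclideanSpace.single (0 : Fin (m + 1)) (1 : ℝ)) (EuclideanSpace.single i.succ 1) =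
        deriv f r / r := by
      intro i
      rw [fderiv_fderiv_eq_deriv_deriv hv, ← deriv_deriv_comp_sqrt hr hf]
      congr 2
      ext t
      rw [hvf]
      congr 1
      rw [← Real.sqrt_sq (norm_nonneg _), norm_add_sq_real]
      congr 1
      rw [inner_smul_left, inner_smul_right, norm_smul, norm_smul]
      simp [EuclideanSpace.inner_single_left]
    simp [h1]

/-- The radial profile of a positive solution solves the radial equation. -/
theorem IsBallSol.exists_isRad {v : Euc (m + 1) → ℝ} (hv : IsBallSol K lam q v)
    (hw : IsWeight K y) (hq : 1 < q) (hlam : 0 ≤ lam) (hm : 1 ≤ m) :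
    ∃ u h : ℝ → ℝ, IsRad m K lam q u h ∧ (∀ r ∈ Ico (0 : ℝ) 1, 0 < u r) ∧ u 1 = 0 ∧
      ∀ x, ‖x‖ ≤ 1 → v x = u ‖x‖ := by
  set e : Euc (m + 1) := EuclideanSpace.single 0 1 with he
  have he1 : ‖e‖ = 1 := by simp [he]
  set f : ℝ → ℝ := fun r => v (r • e) with hf
  have hnorm : ∀ r : ℝ, ‖r • e‖ = |r| := fun r => by
    rw [norm_smul, he1, mul_one, Real.norm_eq_abs]
  have hvf : ∀ x, v x = f ‖x‖ := fun x =>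
    hv.radial hw hq hlam (by rw [hnorm, abs_norm])
  have cf : Continuous f := hv.cont.comp (by fun_prop)
  have hf2 : ∀ r : ℝ, |r| < 1 → ContDiffAt ℝ 2 f r := fun r hr =>
    ContDiffAt.comp r (hv.smooth _ (by rwa [hnorm])) (contDiff_id.smul contDiff_const).contDiffAt
  have hpos : ∀ r ∈ Ico (0 : ℝ) 1, 0 < f r := fun r hr =>
    hv.pos _ (by rw [hnorm, abs_of_nonneg hr.1]; exact hr.2)
  have hzero : f 1 = 0 := hv.zero _ (by rw [hnorm, abs_one])
  have hd1 : ∀ r : ℝ, |r| < 1 → HasDerivAt f (deriv f r) r := fun r hr =>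
    ((hf2 r hr).differentiableAt (by norm_num)).hasDerivAt
  have hd2 : ∀ r : ℝ, |r| < 1 → HasDerivAt (deriv f) (deriv (deriv f) r) r := fun r hr =>
    (hf2 r hr).differentiableAt_deriv_of_two.hasDerivAt
  set g : ℝ → ℝ := fun s => lam * f s - K s * (max (f s) 0) ^ q with hg
  have cg : Continuous g := continuous_source hw.cont cf hq
  have hode : ∀ r ∈ Ioo (0 : ℝ) 1, deriv (deriv f) r + m * (deriv f r / r) = g r := by
    intro r hr
    have h1 : |r| < 1 := by rw [abs_of_pos hr.1]; exact hr.2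
    rw [← lap_radial hvf hr.1 (hf2 r h1) (hv.smooth _ (by rwa [← he, hnorm])), ← he,
      hv.eq _ (by rwa [hnorm]), hnorm, abs_of_pos hr.1, hg]
    simp only
    rw [max_eq_left (hpos r ⟨hr.1.le, hr.2⟩).le]
  have hder : ∀ r ∈ Ioo (0 : ℝ) 1, deriv f r = r * avg m g r := by
    intro r hr
    have hb : ∀ s ∈ Icc 0 r, |s| < 1 := fun s hs => by
      rw [abs_of_nonneg hs.1]; exact hs.2.trans_lt hr.2
    have hc : ContinuousOn (fun s => s ^ m * deriv f s - s ^ (m + 1) * avg m g s) (Icc 0 r) := by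
      have h1 : ContinuousOn (deriv f) (Icc 0 r) := fun s hs =>
        (hd2 s (hb s hs)).continuousAt.continuousWithinAt
      have := continuous_avg m cg
      fun_prop
    have hd : ∀ s ∈ Ioo 0 r,
        HasDerivAt (fun s => s ^ m * deriv f s - s ^ (m + 1) * avg m g s) 0 s := by
      intro s hs
      have h0 := hs.1.ne'
      refine (((hasDerivAt_pow m s).mul (hd2 s (hb s ⟨hs.1.le, hs.2.le⟩))).sub
        (hasDerivAt_pow_mul_avg m cg s)).congr_deriv ?_
      rw [← hode s ⟨hs.1, hs.2.trans hr.2⟩]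
      obtain ⟨n, rfl⟩ : ∃ n, m = n + 1 := ⟨m - 1, by omega⟩
      simp only [Nat.add_sub_cancel]
      field_simp
      ring
    have h1 := monotoneOn_of_hasDerivAt hc hd (fun _ _ => le_rfl)
      ⟨le_rfl, hr.1.le⟩ ⟨hr.1.le, le_rfl⟩ hr.1.le
    have h2 := antitoneOn_of_hasDerivAt hc hd (fun _ _ => le_rfl)
      ⟨le_rfl, hr.1.le⟩ ⟨hr.1.le, le_rfl⟩ hr.1.le
    have h3 := le_antisymm h2 h1
    have hm0 : m ≠ 0 := by omega
    simp only [ne_eq, hm0, not_false_eq_true, zero_pow, zero_mul, Nat.add_eq_zero_iff,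
      one_ne_zero, and_false, sub_zero] at h3
    refine mul_left_cancel₀ (pow_pos hr.1 m).ne' ?_
    rw [sub_eq_zero.1 h3]
    ring
  have hd3 : ∀ r ∈ Ioo (0 : ℝ) 1, HasDerivAt (fun r => f r - volt m g r) 0 r := by
    intro r hr
    refine ((hd1 r (by rw [abs_of_pos hr.1]; exact hr.2)).sub
      (hasDerivAt_volt m cg r)).congr_deriv ?_
    rw [hder r hr, sub_self]
  have hvolt : ∀ r ∈ Icc (0 : ℝ) 1, f r = f 0 + volt m g r := by
    intro r hr
    have hc := (cf.sub (continuous_volt m cg)).continuousOn (s := Icc (0 : ℝ) 1)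
    have h1 := monotoneOn_of_hasDerivAt hc hd3 (fun _ _ => le_rfl)
      ⟨le_rfl, zero_le_one⟩ hr hr.1
    have h2 := antitoneOn_of_hasDerivAt hc hd3 (fun _ _ => le_rfl)
      ⟨le_rfl, zero_le_one⟩ hr hr.1
    simp only [Pi.sub_apply, volt_zero] at h1 h2
    linarith
  refine ⟨_, _, isRad_of_volt hw.cont hq cf hvolt, fun r hr => ?_, ?_, fun x hx => ?_⟩
  · exact (hvolt r ⟨hr.1, hr.2.le⟩) ▸ hpos r hr
  · exact (hvolt 1 ⟨zero_le_one, le_rfl⟩) ▸ hzero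
  · rw [hvf, hvolt _ ⟨norm_nonneg x, hx⟩]

end RadialReduction

section RadialLift

variable {N : ℕ} {m : ℕ} {K y : ℝ → ℝ} {lam q : ℝ} {u h : ℝ → ℝ}

/-- The inner product on `Euc N` as a continuous linear map into the dual. -/
def dualCLM (N : ℕ) : Euc N →L[ℝ] Euc N →L[ℝ] ℝ :=
  LinearMap.toContinuousLinearMap
    { toFun := fun x => innerSL ℝ x
      map_add' := fun x z => by simp
      map_smul' := fun c x => by simp }

lemma dualCLM_apply (x z : Euc N) : dualCLM N x z = inner ℝ x z := rfl

lemma hasFDerivAt_norm_of_ne {x : Euc N} (hx : x ≠ 0) :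
    HasFDerivAt (fun x : Euc N => ‖x‖) (‖x‖⁻¹ • dualCLM N x) x := by
  have hn : ‖x‖ ≠ 0 := norm_ne_zero_iff.2 hx
  have h1 := (hasStrictFDerivAt_norm_sq x).hasFDerivAt.sqrt (pow_ne_zero 2 hn)
  have h2 : (fun x : Euc N => √(‖x‖ ^ 2)) = fun x => ‖x‖ := by
    ext z; exact Real.sqrt_sq (norm_nonneg z)
  rw [h2, Real.sqrt_sq (norm_nonneg x)] at h1
  refine h1.congr_fderiv ?_
  ext z
  simp only [_root_.smul_apply, dualCLM_apply, innerSL_apply_apply, smul_eq_mul,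
    nsmul_eq_mul, Nat.cast_ofNat]
  field_simp

lemma hasFDerivAt_comp_norm (hd : ∀ r ∈ Icc (0 : ℝ) 1, HasDerivAt u (r * h r) r) {x : Euc N}
    (hx : ‖x‖ ≤ 1) : HasFDerivAt (fun x => u ‖x‖) (h ‖x‖ • dualCLM N x) x := by
  have h1 := hd ‖x‖ ⟨norm_nonneg x, hx⟩
  rcases eq_or_ne x 0 with rfl | hx0
  · rw [map_zero, smul_zero]
    rw [norm_zero, zero_mul, hasDerivAt_iff_isLittleO] at h1
    rw [hasFDerivAt_iff_isLittleO]
    have h2 : Tendsto (fun x : Euc N => ‖x‖) (𝓝 0) (𝓝 0) := by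
      simpa using (continuous_norm (E := Euc N)).tendsto 0
    have h3 := h1.comp_tendsto h2
    simp only [Function.comp_def, sub_zero, smul_zero] at h3
    simpa using h3.of_norm_right
  · refine (h1.comp_hasFDerivAt x (hasFDerivAt_norm_of_ne hx0)).congr_fderiv ?_
    rw [smul_smul]
    congr 1
    field_simp [norm_ne_zero_iff.2 hx0]

/-- The derivative of the gradient `h(|x|) x`, where `r h' = p`. -/
def radialHess (h p : ℝ → ℝ) (x : Euc N) : Euc N →L[ℝ] Euc N →L[ℝ] ℝ :=
  h ‖x‖ • dualCLM N + (p ‖x‖ / ‖x‖ ^ 2) • (dualCLM N x).smulRight (dualCLM N x)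

set_option synthInstance.maxHeartbeats 400000 in
lemma hasFDerivAt_radialGrad {p : ℝ → ℝ} (ch : Continuous h)
    (hd : ∀ r ∈ Ioc (0 : ℝ) 1, HasDerivAt h (p r / r) r) {x : Euc N} (hx : ‖x‖ ≤ 1) :
    HasFDerivAt (fun x => h ‖x‖ • dualCLM N x) (radialHess h p x) x := by
  rcases eq_or_ne x 0 with rfl | hx0
  · have h1 : radialHess h p (0 : Euc N) = h 0 • dualCLM N := by
      ext z w
      simp only [radialHess, _root_.add_apply, _root_.smul_apply,
        ContinuousLinearMap.smulRight_apply, dualCLM_apply, inner_zero_left, norm_zero,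
        smul_eq_mul, mul_zero, add_zero]
    rw [h1, hasFDerivAt_iff_isLittleO]
    have h2 : (fun x : Euc N => h ‖x‖ • dualCLM N x - h ‖(0 : Euc N)‖ • dualCLM N 0 -
        (h 0 • dualCLM N) (x - 0)) = fun x => (h ‖x‖ - h 0) • dualCLM N x := by
      ext1 x
      ext w
      simp [sub_mul, dualCLM_apply]
    rw [h2]
    have h3 : (fun x : Euc N => h ‖x‖ - h 0) =o[𝓝 0] fun _ => (1 : ℝ) := by
      rw [Asymptotics.isLittleO_one_iff]
      have : Continuous fun x : Euc N => h ‖x‖ - h 0 := by fun_prop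
      exact this.tendsto' 0 0 (by simp)
    have h4 := (dualCLM N).isBigO_id (𝓝 0)
    simpa using h3.smul_isBigO h4
  · have hn : 0 < ‖x‖ := norm_pos_iff.2 hx0
    have h1 := ((hd ‖x‖ ⟨hn, hx⟩).comp_hasFDerivAt x (hasFDerivAt_norm_of_ne hx0)).smul
      (dualCLM N).hasFDerivAt
    refine h1.congr_fderiv ?_
    ext z w
    simp only [radialHess, Function.comp_apply, _root_.add_apply,
      _root_.smul_apply, ContinuousLinearMap.smulRight_apply, dualCLM_apply,
      smul_eq_mul]
    field_simp

set_option synthInstance.maxHeartbeats 400000 in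
lemma continuous_radialHess {p : ℝ → ℝ} (ch : Continuous h) (cp : Continuous p) (hp : p 0 = 0) :
    Continuous (radialHess (N := N) h p) := by
  refine continuous_clm_apply.2 fun z => continuous_clm_apply.2 fun w => ?_
  have h0 : (fun x : Euc N => radialHess h p x z w) = fun x =>
      h ‖x‖ * inner ℝ z w + p ‖x‖ / ‖x‖ ^ 2 * (inner ℝ x z * inner ℝ x w) := by
    ext x
    simp only [radialHess, _root_.add_apply, _root_.smul_apply,
      ContinuousLinearMap.smulRight_apply, dualCLM_apply, smul_eq_mul]
  rw [h0]
  have c1 : Continuous fun x : Euc N => inner ℝ x z * inner ℝ x w := by fun_prop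
  refine Continuous.add (by fun_prop) ?_
  rw [continuous_iff_continuousAt]
  intro x
  rcases eq_or_ne x 0 with rfl | hx0
  · rw [ContinuousAt]
    simp only [inner_zero_left, mul_zero]
    refine squeeze_zero_norm (a := fun x : Euc N => |p ‖x‖| * (‖z‖ * ‖w‖)) (fun x => ?_) ?_
    · rw [norm_mul, norm_div, norm_pow, norm_norm, norm_mul, Real.norm_eq_abs (p ‖x‖)]
      have h1 : ‖inner ℝ x z‖ * ‖inner ℝ x w‖ ≤ ‖x‖ ^ 2 * (‖z‖ * ‖w‖) := by
        calc ‖inner ℝ x z‖ * ‖inner ℝ x w‖ ≤ (‖x‖ * ‖z‖) * (‖x‖ * ‖w‖) :=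
              mul_le_mul (norm_inner_le_norm x z) (norm_inner_le_norm x w) (norm_nonneg _)
                (by positivity)
          _ = _ := by ring
      rcases eq_or_ne ‖x‖ 0 with h2 | h2
      · rw [h2]
        simp only [ne_eq, OfNat.ofNat_ne_zero, not_false_eq_true, zero_pow, div_zero, zero_mul]
        positivity
      · calc |p ‖x‖| / ‖x‖ ^ 2 * (‖inner ℝ x z‖ * ‖inner ℝ x w‖)
            ≤ |p ‖x‖| / ‖x‖ ^ 2 * (‖x‖ ^ 2 * (‖z‖ * ‖w‖)) :=
              mul_le_mul_of_nonneg_left h1 (by positivity)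
          _ = _ := by field_simp
    · have : Continuous fun x : Euc N => |p ‖x‖| * (‖z‖ * ‖w‖) := by fun_prop
      exact this.tendsto' 0 0 (by simp [hp])
  · have hn : ‖x‖ ^ 2 ≠ 0 := pow_ne_zero 2 (norm_ne_zero_iff.2 hx0)
    exact ((cp.comp continuous_norm).continuousAt.div
      (continuous_norm.pow 2).continuousAt hn).mul c1.continuousAt

/-- A positive solution of the radial problem yields a positive solution on the ball. -/
theorem IsRad.lift (hs : IsRad m K lam q u h) (hK : Continuous K) (hq : 1 < q) :
    ContDiffOn ℝ 2 (fun x : Euc (m + 1) => u ‖x‖) (Metric.ball 0 1) ∧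
      ∀ x : Euc (m + 1), ‖x‖ < 1 →
        lap (fun x => u ‖x‖) x = lam * u ‖x‖ - K ‖x‖ * (max (u ‖x‖) 0) ^ q := by
  have cg := continuous_source (lam := lam) hK hs.cu hq
  set g : ℝ → ℝ := fun s => lam * u s - K s * (max (u s) 0) ^ q with hg
  set p : ℝ → ℝ := fun s => g s - (m + 1) * h s with hp
  have ch := hs.ch
  have cp : Continuous p := by fun_prop
  have hp0 : p 0 = 0 := by
    have : (m : ℝ) + 1 ≠ 0 := by positivity
    simp only [hp, hs.h0, hg]
    field_simp
    ring
  have hv1 : ∀ x ∈ Metric.ball (0 : Euc (m + 1)) 1,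
      HasFDerivAt (fun x : Euc (m + 1) => u ‖x‖) (h ‖x‖ • dualCLM _ x) x := fun x hx =>
    hasFDerivAt_comp_norm hs.du (by simpa using (mem_ball_zero_iff.1 hx).le)
  have hv2 : ∀ x ∈ Metric.ball (0 : Euc (m + 1)) 1,
      HasFDerivAt (fun x : Euc (m + 1) => h ‖x‖ • dualCLM _ x) (radialHess h p x) x := fun x hx =>
    hasFDerivAt_radialGrad ch hs.dh (mem_ball_zero_iff.1 hx).le
  have hC1 : ContDiffOn ℝ 1 (fun x : Euc (m + 1) => h ‖x‖ • dualCLM _ x)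
      (Metric.ball 0 1) := by
    have h1 : (1 : WithTop ℕ∞) = 0 + 1 := by norm_num
    rw [h1, contDiffOn_succ_iff_fderiv_of_isOpen Metric.isOpen_ball]
    refine ⟨fun x hx => (hv2 x hx).differentiableAt.differentiableWithinAt, by simp, ?_⟩
    rw [contDiffOn_zero]
    exact (continuous_radialHess ch cp hp0).continuousOn.congr fun x hx => (hv2 x hx).fderiv
  have hC2 : ContDiffOn ℝ 2 (fun x : Euc (m + 1) => u ‖x‖) (Metric.ball 0 1) := by
    have h1 : (2 : WithTop ℕ∞) = 1 + 1 := by norm_num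
    rw [h1, contDiffOn_succ_iff_fderiv_of_isOpen Metric.isOpen_ball]
    exact ⟨fun x hx => (hv1 x hx).differentiableAt.differentiableWithinAt, by simp,
      hC1.congr fun x hx => (hv1 x hx).fderiv⟩
  refine ⟨hC2, fun x hx => ?_⟩
  have hxb : x ∈ Metric.ball (0 : Euc (m + 1)) 1 := mem_ball_zero_iff.2 hx
  have hnb := Metric.isOpen_ball.mem_nhds hxb
  have hev : fderiv ℝ (fun x : Euc (m + 1) => u ‖x‖) =ᶠ[𝓝 x] fun x => h ‖x‖ • dualCLM _ x := by
    filter_upwards [hnb] with z hz using (hv1 z hz).fderiv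
  rw [lap_eq_sum (hC2.contDiffAt hnb) (EuclideanSpace.basisFun (Fin (m + 1)) ℝ), hev.fderiv_eq,
    (hv2 x hxb).fderiv]
  have hsum : ∑ i, (x i) ^ 2 = ‖x‖ ^ 2 := by
    rw [EuclideanSpace.norm_sq_eq]; simp
  have h1 : ∀ i : Fin (m + 1), radialHess h p x (EuclideanSpace.basisFun (Fin (m + 1)) ℝ i)
      (EuclideanSpace.basisFun (Fin (m + 1)) ℝ i) =
      h ‖x‖ + p ‖x‖ / ‖x‖ ^ 2 * (x i) ^ 2 := by
    intro i
    simp only [radialHess, _root_.add_apply,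
      _root_.smul_apply, ContinuousLinearMap.smulRight_apply, dualCLM_apply,
      smul_eq_mul, EuclideanSpace.basisFun_apply]
    have e1 : inner ℝ x (EuclideanSpace.single i (1 : ℝ)) = x i := by
      simp [EuclideanSpace.inner_single_right]
    have e2 : inner ℝ (EuclideanSpace.single i (1 : ℝ)) (EuclideanSpace.single i (1 : ℝ)) =
        (1 : ℝ) := by
      simp
    rw [e1, e2]
    ring
  simp only [h1]
  rw [Finset.sum_add_distrib, ← Finset.mul_sum, hsum]
  simp only [Finset.sum_const, Finset.card_univ, Fintype.card_fin, nsmul_eq_mul, Nat.cast_add,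
    Nat.cast_one]
  have h2 : p ‖x‖ / ‖x‖ ^ 2 * ‖x‖ ^ 2 = p ‖x‖ := by
    rcases eq_or_ne ‖x‖ 0 with h0 | h0
    · rw [h0, hp0]; simp
    · rw [div_mul_cancel₀ _ (pow_ne_zero 2 h0)]
  rw [h2]
  change _ = g ‖x‖
  simp only [hp]
  ring

end RadialLift

lemma isWeight_kernel {k s : ℝ} (hk : 0 ≤ k) (hs : 0 < s) :
    IsWeight (fun r => (1 + |r| ^ k) ^ (-s)) (fun r => s * k * (r ^ k / (1 + r ^ k))) := by
  have hb : ∀ r : ℝ, 1 ≤ 1 + |r| ^ k := fun r => by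
    linarith [Real.rpow_nonneg (abs_nonneg r) k]
  have hmono : ∀ {a b : ℝ}, 0 < a → a ≤ b → a ^ k / (1 + a ^ k) ≤ b ^ k / (1 + b ^ k) := by
    intro a b ha hab
    have h1 : a ^ k ≤ b ^ k := Real.rpow_le_rpow ha.le hab hk
    have h2 : 0 < a ^ k := Real.rpow_pos_of_pos ha k
    rw [div_le_div_iff₀ (by linarith) (by linarith)]
    nlinarith
  refine ⟨?_, fun r => ?_, fun r => ?_, fun r hr => ?_, fun r hr => ?_, ?_, ?_⟩
  · refine Continuous.rpow_const ?_ fun r => Or.inl (by linarith [hb r])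
    exact continuous_const.add (continuous_abs.rpow_const fun _ => Or.inr hk)
  · exact Real.rpow_pos_of_pos (by linarith [hb r]) _
  · exact Real.rpow_le_one_of_one_le_of_nonpos (hb r) (by linarith)
  · have hrk : 0 < r ^ k := Real.rpow_pos_of_pos hr k
    have h1 : HasDerivAt (fun r : ℝ => (1 + r ^ k) ^ (-s))
        (-(s * k * (r ^ k / (1 + r ^ k)) * (1 + r ^ k) ^ (-s) / r)) r := by
      refine ((((Real.hasDerivAt_rpow_const (p := k) (Or.inl hr.ne')).const_add 1).rpow_const
        (p := -s) (Or.inl (by linarith)))).congr_deriv ?_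
      rw [Real.rpow_sub_one hr.ne', Real.rpow_sub_one (by linarith)]
      field_simp
    have h2 : (fun r : ℝ => (1 + |r| ^ k) ^ (-s)) =ᶠ[𝓝 r] fun r => (1 + r ^ k) ^ (-s) := by
      filter_upwards [eventually_gt_nhds hr] with t ht
      rw [abs_of_pos ht]
    refine (h1.congr_of_eventuallyEq h2).congr_deriv ?_
    simp only [abs_of_pos hr]
  · have hrk : 0 < r ^ k := Real.rpow_pos_of_pos hr k
    positivity
  · intro a ha b _ hab
    exact mul_le_mul_of_nonneg_left (hmono ha hab) (mul_nonneg hs.le hk)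
  · rcases hk.eq_or_lt with rfl | hk'
    · simp
    · have h1 : Tendsto (fun r : ℝ => r ^ k) (𝓝 0) (𝓝 0) := by
        have := (continuous_id.rpow_const (p := k) fun r : ℝ => Or.inr hk).tendsto (0 : ℝ)
        simpa [Real.zero_rpow hk'.ne'] using this
      have h2 := (h1.div (h1.const_add 1) (by norm_num)).const_mul (s * k)
      simp only [add_zero, div_one, mul_zero] at h2
      exact h2.mono_left nhdsWithin_le_nhds

lemma IsPosSolution.isBallSol {N : ℕ} {k s p lam : ℝ} {v : Euc N → ℝ}
    (hv : IsPosSolution (Metric.ball (0 : Euc N) 1) (fker N k s p) lam v) :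
    IsBallSol (fun r => (1 + |r| ^ k) ^ (-s)) lam (p - 1)
      (indicator (Metric.ball (0 : Euc N) 1) v) := by
  obtain ⟨h1, h2, h3, h4, h5⟩ := hv
  have hev : ∀ x : Euc N, ‖x‖ < 1 → indicator (Metric.ball (0 : Euc N) 1) v =ᶠ[𝓝 x] v := by
    intro x hx
    filter_upwards [Metric.isOpen_ball.mem_nhds (mem_ball_zero_iff.2 hx)] with z hz
    exact indicator_of_mem hz v
  refine ⟨continuous_indicator h4 h2, fun x hx => ?_, fun x hx => ?_, fun x hx => ?_,
    fun x hx => ?_⟩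
  · exact indicator_of_notMem (by simpa using hx) v
  · rw [(hev x hx).eq_of_nhds]
    exact h3 x (mem_ball_zero_iff.2 hx)
  · exact (h1.contDiffAt (Metric.isOpen_ball.mem_nhds (mem_ball_zero_iff.2 hx))).congr_of_eventuallyEq
      (hev x hx)
  · rw [lap_congr (hev x hx), (hev x hx).eq_of_nhds]
    have := h5 x (mem_ball_zero_iff.2 hx)
    simp only [fker] at this
    rw [abs_norm]
    linarith

/-- for `-Δu + λu = (1+|x|^k)^{-s} u^{p-1}` on the unit ball, with `N ≥ 2`
and `λ ≥ 0`, there is exactly one positive solution, and it is radially symmetric and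
decreasing in `r = |x|`. -/
theorem statement14 {N : ℕ} (hN : 2 ≤ N) {s k p lam : ℝ} (hs : 1 < s) (hk : 0 ≤ k)
    (hp2 : 2 < p) (hpcrit : 3 ≤ N → p < 2 * N / ((N : ℝ) - 2))
    (hlam : 0 ≤ lam) :
    ∃ u : Euc N → ℝ,
      IsPosSolution (Metric.ball (0 : Euc N) 1) (fker N k s p) lam u ∧
      (∀ v : Euc N → ℝ, IsPosSolution (Metric.ball (0 : Euc N) 1) (fker N k s p) lam v →
        EqOn v u (closure (Metric.ball (0 : Euc N) 1))) ∧
      ∃ ρ : ℝ → ℝ, (∀ x ∈ closure (Metric.ball (0 : Euc N) 1), u x = ρ ‖x‖) ∧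
        StrictAntiOn ρ (Icc (0 : ℝ) 1) := by
  obtain ⟨m, rfl⟩ : ∃ m, N = m + 1 := ⟨N - 1, by omega⟩
  have hm : 1 ≤ m := by omega
  have hq : 1 < p - 1 := by linarith
  have hw := isWeight_kernel hk (by linarith : 0 < s)
  have hsub : ((m : ℝ) - 1) * (p - 1 + 1) < 2 * (m + 1) := by
    rcases hm.eq_or_lt with rfl | hm2
    · norm_num
    · have h1 := hpcrit (by omega)
      have h2 : (1 : ℝ) < m := by exact_mod_cast hm2
      rw [lt_div_iff₀ (by push_cast; linarith)] at h1
      push_cast at h1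
      linarith
  obtain ⟨u, h, hu, hup, hu1⟩ := radial_exists (m := m) hw hlam hq hm hsub
  obtain ⟨hC2, hlap⟩ := hu.lift hw.cont hq
  have hcl : closure (Metric.ball (0 : Euc (m + 1)) 1) = Metric.closedBall 0 1 :=
    closure_ball 0 one_ne_zero
  have hfr : frontier (Metric.ball (0 : Euc (m + 1)) 1) = Metric.sphere 0 1 :=
    frontier_ball 0 one_ne_zero
  refine ⟨fun x => u ‖x‖, ⟨hC2, (hu.cu.comp continuous_norm).continuousOn, fun x hx => ?_,
    fun x hx => ?_, fun x hx => ?_⟩, fun v hv => ?_, u, fun x _ => rfl, ?_⟩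
  · exact hup _ ⟨norm_nonneg x, mem_ball_zero_iff.1 hx⟩
  · rw [hfr, mem_sphere_zero_iff_norm] at hx
    change u ‖x‖ = 0
    rw [hx, hu1]
  · have hx' := mem_ball_zero_iff.1 hx
    rw [hlap x hx', max_eq_left (hup _ ⟨norm_nonneg x, hx'⟩).le, fker, abs_norm]
    ring
  · have hb := hv.isBallSol
    obtain ⟨w, l, hwl, hwp, hw1, hvw⟩ := hb.exists_isRad hw hq hlam hm
    have heq := radial_unique hw hlam hq hm hwl hwp hw1 hu hup hu1
    intro x hx
    have hx1 : ‖x‖ ≤ 1 := by rwa [hcl, mem_closedBall_zero_iff] at hx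
    have h1 := hvw x hx1
    rw [heq ⟨norm_nonneg x, hx1⟩] at h1
    change v x = u ‖x‖
    rw [← h1]
    rcases hx1.eq_or_lt with h2 | h2
    · rw [hb.zero x h2.ge]
      exact hv.2.2.2.1 x (by rw [hfr, mem_sphere_zero_iff_norm, h2])
    · exact (indicator_of_mem (mem_ball_zero_iff.2 h2) v).symm
  · exact hu.strictAntiOn hw hlam hq ⟨one_pos, le_rfl⟩ hup hu1
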